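/- arXiv:2404.10769 — 3 statements merged into one kernel-verified Lean document; each statement's English description precedes it below -/
import Mathlib

section
/- Let p ∈ ℝ^d, let K_0 ⊂ ℂ^d be a compact absolutely convex neighbourhood of 0, let K := p + K_0, let f be holomorphic on an open neighbourhood of K with values in ℂ^r, let μ be a Borel probability measure on ℝ^d whose support is compact and contained in the interior of K_0, and let K_1 ⊂ interior(K_0) be compact. For m ≤ n and data Z = (z^1,…,z^N) ∈ K^N define f̃_{m,n,Z} : ℂ^d → ℂ^r with components f̃_{m,n,Z,i}(z) := Σ_{k=1}^{r_m^E} Σ_{l=1}^{r_m^F} u_{p,α^{(k)}}(z)·conj((Ĉ_{m,n,Z})_{l,k})·conj(∂_{w_i} v_{f(p),β^{(l)}}(0)), where ∂_{w_i} is the partial derivative in the i-th coordinate of ℂ^r. Then there exists C' > 0, depending only on f, p, K_0, K_1 and μ, such that for all integers 1 ≤ m ≤ n, every γ ∈ (0,1), every N ∈ ℤ_{>0} and all z_0^1,…,z_0^N ∈ supp(μ), if D_n(μ) is invertible and ‖I − D_n(μ)^{−1/2}·D_n(μ̂_N)·D_n(μ)^{−1/2}‖_op ≤ 1−γ (where μ̂_N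 := N^{−1}Σ_{i=1}^N δ_{z_0^i}), then with Z_N := (p+z_0^1,…,p+z_0^N): sup_{z ∈ p+K_1} ‖f̃_{m,n,Z_N}(z) − f(z)‖ ≤ C'·( ‖f(p)‖^m/√((m−1)!) + √(m!/γ)·R_μ^n/Λ_n(μ)^{1/2} + R_{K_1}^m ), where R_μ := sup_{x∈supp(μ)} |x|_{K_0} and R_{K_1} := sup_{z∈K_1} |z|_{K_0}. -/
open MeasureTheory Complex Filter Matrix
open scoped BigOperators ENNReal Topology

noncomputable section

namespace PFA

/-- The canonical inclusion of `ℝ^d` into `ℂ^d`. -/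
def cpx {d : ℕ} (x : Fin d → ℝ) : Fin d → ℂ := fun i => (x i : ℂ)

/-- Euclidean norm on `ℂ^d`. -/
def enorm' {d : ℕ} (z : Fin d → ℂ) : ℝ := Real.sqrt (∑ i, ‖z i‖ ^ 2)

/-- An absolutely convex subset of `ℂ^d`. -/
def AbsConvex {d : ℕ} (K : Set (Fin d → ℂ)) : Prop :=
  ∀ x ∈ K, ∀ y ∈ K, ∀ a b : ℂ, ‖a‖ + ‖b‖ ≤ 1 → a • x + b • y ∈ K

/-- The (topological) support of a Borel measure. -/
def msupport {X : Type*} [TopologicalSpace X] [MeasurableSpace X] (μ : Measure X) : Set X :=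
  {x | ∀ U : Set X, IsOpen U → x ∈ U → 0 < μ U}

/-- translate of a set -/
def transSet {d : ℕ} (p : Fin d → ℂ) (K : Set (Fin d → ℂ)) : Set (Fin d → ℂ) :=
  (fun z => p + z) '' K

/-- multi-indices of degree at most `n` -/
abbrev MIdx (d n : ℕ) := {α : Fin d → ℕ // ∑ i, α i ≤ n}

instance instFintypeMIdx (d n : ℕ) : Fintype (MIdx d n) :=
  Fintype.subtype
    ((Fintype.piFinset fun _ : Fin d => Finset.range (n + 1)).filter fun α => ∑ i, α i ≤ n)
    (by
      intro α
      simp only [Finset.mem_filter, Fintype.mem_piFinset, Finset.mem_range, Nat.lt_succ_iff]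
      exact ⟨fun h => h.2, fun h =>
        ⟨fun i => le_trans (Finset.single_le_sum (fun j _ => Nat.zero_le (α j))
          (Finset.mem_univ i)) h, h⟩⟩)

/-- inclusion of multi-index sets -/
def midxIncl {d m n : ℕ} (h : m ≤ n) (a : MIdx d m) : MIdx d n := ⟨a.1, a.2.trans h⟩

/-- moment matrix `D_n(μ)` -/
def momentMatrix (d n : ℕ) (μ : Measure (Fin d → ℝ)) : Matrix (MIdx d n) (MIdx d n) ℝ :=
  Matrix.of fun a b => ∫ x, ∏ i, x i ^ (a.1 i + b.1 i) ∂μ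

/-- smallest eigenvalue of a real matrix -/
def minEig {ι : Type*} [Fintype ι] (M : Matrix ι ι ℝ) : ℝ :=
  sInf {t : ℝ | ∃ v : ι → ℝ, v ≠ 0 ∧ M.mulVec v = t • v}

/-- ℓ²→ℓ² operator norm of a matrix -/
def matOpNorm {𝕜 : Type*} [RCLike 𝕜] {ι κ : Type*} [Fintype ι] [Fintype κ]
    (M : Matrix ι κ 𝕜) : ℝ :=
  sSup {t : ℝ | ∃ v : κ → 𝕜, (∑ j, ‖v j‖ ^ 2) ≤ 1 ∧
    t = Real.sqrt (∑ i, ‖∑ j, M i j * v j‖ ^ 2)}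

/-- Frobenius norm of a matrix -/
def matFrobNorm {𝕜 : Type*} [RCLike 𝕜] {ι κ : Type*} [Fintype ι] [Fintype κ]
    (M : Matrix ι κ 𝕜) : ℝ :=
  Real.sqrt (∑ i, ∑ j, ‖M i j‖ ^ 2)

/-- the four Penrose conditions characterizing the Moore–Penrose pseudo-inverse -/
def IsMoorePenrose {ι κ : Type*} [Fintype ι] [Fintype κ]
    (A : Matrix ι κ ℂ) (X : Matrix κ ι ℂ) : Prop :=
  A * X * A = A ∧ X * A * X = X ∧ (A * X)ᴴ = A * X ∧ (X * A)ᴴ = X * A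

/-- complex partial derivative in the `k`-th coordinate -/
def pderivAt {d : ℕ} (k : Fin d) (g : (Fin d → ℂ) → ℂ) : (Fin d → ℂ) → ℂ :=
  fun z => fderiv ℂ g z (Pi.single k 1)

/-- iterated complex partial derivative `∂^γ` -/
def mpderiv {d : ℕ} (γ : Fin d → ℕ) (g : (Fin d → ℂ) → ℂ) : (Fin d → ℂ) → ℂ :=
  ((List.finRange d).map fun k => (pderivAt k)^[γ k]).foldr (fun F h => F h) g

/-- the jet functional `ν_{q,κ}` -/
def jetFun {d : ℕ} (q : Fin d → ℂ) (κ : Fin d → ℕ) (h : (Fin d → ℂ) → ℂ) : ℂ :=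
  ((Real.exp (-(∑ i, ‖q i‖ ^ 2) / 2) / Real.sqrt (∏ i, (κ i).factorial) : ℝ) : ℂ) *
    ∑ γ ∈ Fintype.piFinset fun i => Finset.range (κ i + 1),
      (∏ i, ((κ i).choose (γ i) : ℂ)) *
        (∏ i, (-(starRingEnd ℂ) (q i)) ^ (κ i - γ i)) * mpderiv γ h q

/-- the functions `u_{p,α}` (also used for `v_{q,β}`) -/
def uFn {d : ℕ} (p : Fin d → ℂ) (α : Fin d → ℕ) (z : Fin d → ℂ) : ℂ :=
  ((Real.exp (-(∑ i, ‖p i‖ ^ 2) / 2) / Real.sqrt (∏ i, (α i).factorial) : ℝ) : ℂ) *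
    (∏ i, (z i - p i) ^ (α i)) * Complex.exp (∑ i, z i * (starRingEnd ℂ) (p i))

/-- sample matrix `U_{p,n,Z}` (resp. `V_{q,n,W}`) -/
def sampMat {d N : ℕ} (n : ℕ) (p : Fin d → ℂ) (Z : Fin N → Fin d → ℂ) :
    Matrix (Fin N) (MIdx d n) ℂ :=
  Matrix.of fun i a => uFn p a.1 (Z i)

/-- Data matrix `Ĉ_{m,n,Z}`, given a Moore–Penrose pseudo-inverse `X` of `U_{p,n,Z}ᴴ`:
the leftmost block of `V_{q,m,W}ᴴ * X`. -/
def dataMat {d r N : ℕ} {m n : ℕ} (hmn : m ≤ n) (q : Fin r → ℂ)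
    (W : Fin N → Fin r → ℂ) (X : Matrix (Fin N) (MIdx d n) ℂ) :
    Matrix (MIdx r m) (MIdx d m) ℂ :=
  ((sampMat m q W)ᴴ * X).submatrix id (midxIncl hmn)

/-- jet representation matrix of the push-forward of `f` at `p` -/
def IsJetMatrix {d r : ℕ} (m : ℕ) (p : Fin d → ℂ) (f : (Fin d → ℂ) → Fin r → ℂ)
    (C : Matrix (MIdx r m) (MIdx d m) ℂ) : Prop :=
  ∀ h : MvPolynomial (Fin r) ℂ, ∀ a : MIdx d m,
    jetFun p a.1 (fun z => MvPolynomial.eval (f z) h) =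
      ∑ b : MIdx r m, C b a * jetFun (f p) b.1 (fun w => MvPolynomial.eval w h)

/-- `π^{-d}` times Lebesgue measure on `ℂ^d` -/
def μE (d : ℕ) : Measure (Fin d → ℂ) := ((ENNReal.ofReal Real.pi) ^ d)⁻¹ • volume

/-- `e_w(z) = exp⟨z,w⟩` -/
def eW {d : ℕ} (w : Fin d → ℂ) (z : Fin d → ℂ) : ℂ :=
  Complex.exp (∑ i, z i * (starRingEnd ℂ) (w i))

/-- supporting function `h_K` -/
def suppFn {d : ℕ} (K : Set (Fin d → ℂ)) (ζ : Fin d → ℂ) : ℝ :=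
  sSup ((fun z => (∑ i, ζ i * (starRingEnd ℂ) (z i)).re) '' K)

/-- polar set `K°` -/
def polarSet {d : ℕ} (K : Set (Fin d → ℂ)) : Set (Fin d → ℂ) :=
  {z | ∀ w ∈ K, ‖∑ i, z i * (starRingEnd ℂ) (w i)‖ ≤ 1}

/-- membership in the Fock space -/
def MemFock {d : ℕ} (h : (Fin d → ℂ) → ℂ) : Prop :=
  Differentiable ℂ h ∧
    Integrable (fun z => ‖h z‖ ^ 2 * Real.exp (-(∑ i, ‖z i‖ ^ 2))) (μE d)

/-- Fock-space inner product -/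
def fockInner {d : ℕ} (h g : (Fin d → ℂ) → ℂ) : ℂ :=
  ∫ z, h z * (starRingEnd ℂ) (g z) * ((Real.exp (-(∑ i, ‖z i‖ ^ 2)) : ℝ) : ℂ) ∂(μE d)

/-- orthogonal projection onto `span{u_{p,α} : |α| ≤ n}`, written out using the
orthonormal system `u_{p,α}` -/
def jetProj {d : ℕ} (n : ℕ) (p : Fin d → ℂ) (g : (Fin d → ℂ) → ℂ) : (Fin d → ℂ) → ℂ :=
  fun z => ∑ a : MIdx d n, fockInner g (uFn p a.1) * uFn p a.1 z


theorem line_diff {d : ℕ} {Ω : Set (Fin d → ℂ)} {H : (Fin d → ℂ) → ℂ}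
    (hH : DifferentiableOn ℂ H Ω) (y u : Fin d → ℂ) :
    DifferentiableOn ℂ (fun s : ℂ => H (y + s • u)) ((fun s : ℂ => y + s • u) ⁻¹' Ω) := by
  refine hH.comp (f := fun s : ℂ => y + s • u) ?_ (fun s hs => hs)
  exact (Differentiable.differentiableOn (by fun_prop))

theorem line_open {d : ℕ} {Ω : Set (Fin d → ℂ)} (hΩ : IsOpen Ω) (y u : Fin d → ℂ) :
    IsOpen ((fun s : ℂ => y + s • u) ⁻¹' Ω) :=
  hΩ.preimage (by fun_prop)

theorem line_deriv {d : ℕ} {Ω : Set (Fin d → ℂ)} (hΩ : IsOpen Ω) {H : (Fin d → ℂ) → ℂ}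
    (hH : DifferentiableOn ℂ H Ω) (y u : Fin d → ℂ) (s : ℂ) (hs : y + s • u ∈ Ω) :
    deriv (fun s : ℂ => H (y + s • u)) s = fderiv ℂ H (y + s • u) u := by
  have h1 : HasFDerivAt H (fderiv ℂ H (y + s • u)) (y + s • u) :=
    (hH.differentiableAt (hΩ.mem_nhds hs)).hasFDerivAt
  have h2 : HasDerivAt (fun s : ℂ => y + s • u) u s := by
    simpa using ((hasDerivAt_id s).smul_const u).const_add y
  exact (h1.comp_hasDerivAt s h2).deriv

theorem goursat {d : ℕ} {Ω : Set (Fin d → ℂ)} (hΩ : IsOpen Ω) {H : (Fin d → ℂ) → ℂ}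
    (hH : DifferentiableOn ℂ H Ω) (v : Fin d → ℂ) :
    DifferentiableOn ℂ (fun z => fderiv ℂ H z v) Ω := by
  intro z0 hz0
  apply DifferentiableAt.differentiableWithinAt
  obtain ⟨ρ', hρ', hsub'⟩ := Metric.nhds_basis_closedBall.mem_iff.1 (hΩ.mem_nhds hz0)
  obtain ⟨ρ, hρ, rfl⟩ : ∃ ρ : ℝ, 0 < ρ ∧ ρ' = 3 * ρ := ⟨ρ' / 3, by positivity, by ring⟩
  obtain ⟨M, hM⟩ := (isCompact_closedBall z0 (3 * ρ)).exists_bound_of_continuousOn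
    (hH.continuousOn.mono hsub')
  have hM0 : 0 ≤ M := (norm_nonneg _).trans (hM z0 (by simp; positivity))
  -- bound for the derivative
  have hbd : ∀ y ∈ Metric.closedBall z0 (2 * ρ), ‖fderiv ℂ H y‖ ≤ M / ρ := by
    intro y hy
    refine ContinuousLinearMap.opNorm_le_bound _ (by positivity) (fun u => ?_)
    rcases eq_or_ne u 0 with rfl | hu
    · simp
    have hu' : 0 < ‖u‖ := norm_pos_iff.2 hu
    have hin : ∀ s ∈ Metric.closedBall (0 : ℂ) (ρ / ‖u‖),
        y + s • u ∈ Metric.closedBall z0 (3 * ρ) := by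
      intro s hs
      rw [mem_closedBall_iff_norm] at hs hy ⊢
      rw [sub_zero] at hs
      have h3 : ‖s • u‖ ≤ ρ := by
        rw [norm_smul]
        calc ‖s‖ * ‖u‖ ≤ ρ / ‖u‖ * ‖u‖ := by gcongr
          _ = ρ := by field_simp
      calc ‖y + s • u - z0‖ = ‖(y - z0) + s • u‖ := by congr 1; abel
        _ ≤ ‖y - z0‖ + ‖s • u‖ := norm_add_le _ _
        _ ≤ 3 * ρ := by linarith
    have hdc : DiffContOnCl ℂ (fun s : ℂ => H (y + s • u)) (Metric.ball 0 (ρ / ‖u‖)) :=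
      (line_diff hH y u).diffContOnCl_ball (fun s hs => hsub' (hin s hs))
    have h4 := Complex.norm_deriv_le_of_forall_mem_sphere_norm_le (by positivity) hdc
      (fun s hs => hM _ (hin s (Metric.sphere_subset_closedBall hs)))
    rw [line_deriv hΩ hH y u 0 (hsub' (hin 0 (by simp; positivity)))] at h4
    simp only [zero_smul, add_zero] at h4
    refine h4.trans (le_of_eq ?_)
    field_simp
  set δ := ρ / (‖v‖ + 1) with hδ
  have hδ0 : 0 < δ := by positivity
  have hδv : δ * ‖v‖ ≤ ρ := by
    rw [hδ, div_mul_eq_mul_div, div_le_iff₀ (by positivity)]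
    nlinarith [norm_nonneg v]
  have hin2 : ∀ z ∈ Metric.ball z0 ρ, ∀ s ∈ Metric.closedBall (0 : ℂ) δ,
      z + s • v ∈ Metric.closedBall z0 (2 * ρ) := by
    intro z hz s hs
    rw [mem_closedBall_iff_norm] at hs ⊢
    rw [mem_ball_iff_norm] at hz
    rw [sub_zero] at hs
    have h3 : ‖s • v‖ ≤ ρ := by
      rw [norm_smul]
      exact (mul_le_mul_of_nonneg_right hs (norm_nonneg v)).trans hδv
    calc ‖z + s • v - z0‖ = ‖(z - z0) + s • v‖ := by congr 1; abel
      _ ≤ ‖z - z0‖ + ‖s • v‖ := norm_add_le _ _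
      _ ≤ 2 * ρ := by linarith
  have h23 : Metric.closedBall z0 (2 * ρ) ⊆ Metric.closedBall z0 (3 * ρ) :=
    Metric.closedBall_subset_closedBall (by linarith)
  have hcirc : ∀ θ : ℝ, circleMap 0 δ θ ∈ Metric.closedBall (0 : ℂ) δ :=
    fun θ => circleMap_mem_closedBall 0 hδ0.le θ
  let k : ℝ → ℂ := fun θ => deriv (circleMap 0 δ) θ * ((circleMap 0 δ θ - 0) ^ 2)⁻¹
  have hkc : Continuous k := by
    have : ∀ θ, circleMap 0 δ θ - 0 ≠ 0 := fun θ => by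
      simpa using hδ0.ne'
    have h0 : Continuous (circleMap 0 δ) := continuous_circleMap 0 δ
    simp only [k, deriv_circleMap]
    refine (h0.mul continuous_const).mul (Continuous.inv₀ (by fun_prop) ?_)
    intro θ
    exact pow_ne_zero _ (this θ)
  have hmeq : ∀ᶠ z in 𝓝 z0, fderiv ℂ H z v =
      (2 * Real.pi * I : ℂ)⁻¹ • ∫ θ in (0:ℝ)..2 * Real.pi, k θ * H (z + circleMap 0 δ θ • v) := by
    filter_upwards [Metric.ball_mem_nhds z0 hρ] with z hz
    have h5 := Complex.two_pi_I_inv_smul_circleIntegral_sub_sq_inv_smul_of_differentiable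
      (line_open hΩ z v) (c := 0) (w₀ := 0) (R := δ)
      (fun s hs => hsub' (h23 (hin2 z hz s hs))) (line_diff hH z v) (by simpa using hδ0)
    rw [line_deriv hΩ hH z v 0 (hsub' (h23 (hin2 z hz 0 (by simp; positivity))))] at h5
    simp only [zero_smul, add_zero] at h5
    rw [← h5]
    simp only [circleIntegral, k, smul_eq_mul, mul_assoc]
  refine DifferentiableAt.congr_of_eventuallyEq ?_ hmeq
  refine DifferentiableAt.fun_const_smul ?_ _
  obtain ⟨B, hB⟩ := isCompact_Icc (a := (0:ℝ)) (b := 2 * Real.pi) |>.exists_bound_of_continuousOn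
    hkc.continuousOn
  have hpi : (0:ℝ) ≤ 2 * Real.pi := by positivity
  have hFc : ∀ z ∈ Metric.ball z0 ρ,
      Continuous (fun θ : ℝ => k θ * H (z + circleMap 0 δ θ • v)) := by
    intro z hz
    refine hkc.mul ?_
    rw [continuous_iff_continuousAt]
    intro θ
    have h6 : ContinuousAt H (z + circleMap 0 δ θ • v) :=
      (hH.differentiableAt (hΩ.mem_nhds
        (hsub' (h23 (hin2 z hz _ (hcirc θ)))))).continuousAt
    have h7 : ContinuousAt (fun θ : ℝ => z + circleMap 0 δ θ • v) θ := by
      have h0 : Continuous (circleMap 0 δ) := continuous_circleMap 0 δ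
      exact (by fun_prop : Continuous fun θ : ℝ => z + circleMap 0 δ θ • v).continuousAt
    exact ContinuousAt.comp (f := fun θ : ℝ => z + circleMap 0 δ θ • v) h6 h7
  refine (intervalIntegral.hasFDerivAt_integral_of_dominated_of_fderiv_le
    (F' := fun z θ => k θ • fderiv ℂ H (z + circleMap 0 δ θ • v))
    (bound := fun _ => B * (M / ρ)) (Metric.ball_mem_nhds z0 hρ) ?_ ?_ ?_ ?_ ?_ ?_).differentiableAt
  · filter_upwards [Metric.ball_mem_nhds z0 hρ] with z hz
    exact (hFc z hz).aestronglyMeasurable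
  · exact (hFc z0 (Metric.mem_ball_self hρ)).intervalIntegrable _ _
  · refine (Measurable.aestronglyMeasurable ?_)
    have h0 : Continuous (circleMap 0 δ) := continuous_circleMap 0 δ
    refine hkc.measurable.smul ?_
    refine (measurable_fderiv ℂ H).comp ?_
    exact (by fun_prop : Continuous fun θ : ℝ => z0 + circleMap 0 δ θ • v).measurable
  · refine Eventually.of_forall (fun θ hθ z hz => ?_)
    rw [Set.uIoc_of_le hpi] at hθ
    rw [norm_smul]
    have h8 := hB θ ⟨hθ.1.le, hθ.2⟩
    gcongr
    · exact (norm_nonneg _).trans h8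
    · exact hbd _ (hin2 z hz _ (hcirc θ))
  · exact intervalIntegrable_const
  · refine Eventually.of_forall (fun θ hθ z hz => ?_)
    have h9 : HasFDerivAt H (fderiv ℂ H (z + circleMap 0 δ θ • v)) (z + circleMap 0 δ θ • v) :=
      (hH.differentiableAt (hΩ.mem_nhds (hsub' (h23 (hin2 z hz _ (hcirc θ)))))).hasFDerivAt
    have h10 : HasFDerivAt (fun z => H (z + circleMap 0 δ θ • v))
        (fderiv ℂ H (z + circleMap 0 δ θ • v)) z := by
      have h11 := HasFDerivAt.comp (f := fun z => z + circleMap 0 δ θ • v) z h9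
        ((hasFDerivAt_id z).add_const (circleMap 0 δ θ • v))
      simpa [Function.comp_def] using h11
    exact h10.const_mul (k θ)

theorem homog_poly {d : ℕ} {Ω : Set (Fin d → ℂ)} (hΩ : IsOpen Ω) (h0 : (0 : Fin d → ℂ) ∈ Ω)
    (k : ℕ) : ∀ {H : (Fin d → ℂ) → ℂ} (_ : DifferentiableOn ℂ H Ω),
    ∃ P : MvPolynomial (Fin d) ℂ, P.IsHomogeneous k ∧
      ∀ η : Fin d → ℂ, iteratedDeriv k (fun s : ℂ => H (s • η)) 0 = MvPolynomial.eval η P := by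
  induction k with
  | zero =>
    intro H hH
    exact ⟨MvPolynomial.C (H 0), MvPolynomial.isHomogeneous_C _ _, by intro η; simp⟩
  | succ k ih =>
    intro H hH
    choose P hP1 hP2 using fun i : Fin d => ih (goursat hΩ hH (Pi.single i 1))
    refine ⟨∑ i, MvPolynomial.X i * P i, ?_, ?_⟩
    · refine MvPolynomial.IsHomogeneous.sum _ _ _ (fun i _ => ?_)
      rw [add_comm]
      exact (MvPolynomial.isHomogeneous_X _ i).mul (hP1 i)
    · intro η
      rw [iteratedDeriv_succ']
      have hmem : (fun s : ℂ => 0 + s • η) ⁻¹' Ω ∈ 𝓝 (0 : ℂ) :=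
        (line_open hΩ 0 η).mem_nhds (by simpa using h0)
      have heq : deriv (fun s : ℂ => H (s • η)) =ᶠ[𝓝 0]
          fun s => ∑ i, η i * (fun s : ℂ => fderiv ℂ H (s • η) (Pi.single i 1)) s := by
        filter_upwards [hmem] with s hs
        have := line_deriv hΩ hH 0 η s hs
        simp only [zero_add] at this
        rw [this]
        have hη : η = ∑ i, η i • (Pi.single i (1:ℂ) : Fin d → ℂ) := by
          simpa using (pi_eq_sum_univ' η)
        refine (congrArg (fderiv ℂ H (s • η)) hη).trans ?_
        rw [map_sum]
        simp only [map_smul, smul_eq_mul]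
      rw [heq.iteratedDeriv_eq]
      have hcd : ∀ i : Fin d, ContDiffAt ℂ k
          (fun s : ℂ => fderiv ℂ H (s • η) (Pi.single i 1)) 0 := by
        intro i
        have := line_diff (goursat hΩ hH (Pi.single i 1)) 0 η
        simp only [zero_add] at this hmem
        exact (this.analyticAt hmem).contDiffAt
      rw [iteratedDeriv_fun_sum (fun i _ => contDiffAt_const.mul (hcd i))]
      rw [map_sum]
      refine Finset.sum_congr rfl (fun i _ => ?_)
      rw [iteratedDeriv_const_mul _ (hcd i), hP2]
      simp

/-- monomials with natural exponent functions -/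
def mono {d : ℕ} (α : Fin d → ℕ) (ζ : Fin d → ℂ) : ℂ := ∏ i, ζ i ^ α i

theorem eval_eq_sum_midx {d : ℕ} (n : ℕ) (Q : MvPolynomial (Fin d) ℂ) (hQ : Q.totalDegree ≤ n)
    (ζ : Fin d → ℂ) :
    MvPolynomial.eval ζ Q =
      ∑ a : MIdx d n, MvPolynomial.coeff (Finsupp.equivFunOnFinite.symm a.1) Q * mono a.1 ζ := by
  classical
  rw [MvPolynomial.eval_eq']
  have hdeg : ∀ s ∈ Q.support, ∑ i, s i ≤ n := by
    intro s hs
    have := (MvPolynomial.le_totalDegree hs).trans hQ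
    rwa [Finsupp.sum_fintype _ _ (fun _ => rfl)] at this
  refine Finset.sum_bij_ne_zero (fun s hs _ => (⟨s, hdeg s hs⟩ : MIdx d n)) ?_ ?_ ?_ ?_
  · intros; exact Finset.mem_univ _
  · intro s hs _ t ht _ h
    have := congrArg Subtype.val h
    exact DFunLike.coe_injective this
  · intro b _ hb
    have hb' : MvPolynomial.coeff (Finsupp.equivFunOnFinite.symm b.1) Q ≠ 0 := left_ne_zero_of_mul hb
    refine ⟨Finsupp.equivFunOnFinite.symm b.1, MvPolynomial.mem_support_iff.2 hb', ?_, ?_⟩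
    · simpa [mono] using hb
    · apply Subtype.ext; simp
  · intro s hs _
    have : Finsupp.equivFunOnFinite.symm (s : Fin d → ℕ) = s := by ext; simp
    simp only [mono, this]

theorem slice_tail (φ : ℂ → ℂ) (V : Set ℂ) (hφ : DifferentiableOn ℂ φ V)
    (hVc : Metric.closedBall (0:ℂ) 1 ⊆ V) (M : ℝ) (hM : ∀ s ∈ Metric.closedBall (0:ℂ) 1, ‖φ s‖ ≤ M)
    (R : ℝ) (hR0 : 0 < R) (hR1 : R < 1) (n : ℕ) :
    ‖φ R - ∑ k ∈ Finset.range (n + 1), ((k.factorial : ℂ)⁻¹ * (R : ℂ) ^ k * iteratedDeriv k φ 0)‖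
      ≤ M * R ^ (n + 1) / (1 - R) := by
  have hc : ∀ k, ‖iteratedDeriv k φ 0‖ ≤ k.factorial * M := by
    intro k
    have := Complex.norm_iteratedDeriv_le_of_forall_mem_sphere_norm_le k one_pos
      (hφ.diffContOnCl_ball hVc) (fun z hz => hM z (Metric.sphere_subset_closedBall hz))
    simpa using this
  have hs := Complex.hasSum_taylorSeries_on_ball (c := 0) (r := 1) (z := (R:ℂ))
    (hφ.mono (Metric.ball_subset_closedBall.trans hVc)) (by simp [abs_of_pos hR0, hR1])
  have hs2 := (hasSum_nat_add_iff' (n + 1)).2 hs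
  have hg := (hasSum_geometric_of_lt_one hR0.le hR1).mul_left (M * R ^ (n + 1))
  simp only [smul_eq_mul, sub_zero, ← mul_assoc] at hs2
  rw [← hs2.tsum_eq]
  rw [div_eq_mul_inv]
  refine tsum_of_norm_bounded hg (fun i => ?_)
  rw [norm_mul, norm_mul, norm_inv, norm_pow, Complex.norm_natCast, Complex.norm_real,
    Real.norm_of_nonneg hR0.le]
  have hf : (0:ℝ) < (i + (n+1)).factorial := by positivity
  calc ((i + (n+1)).factorial : ℝ)⁻¹ * R ^ (i + (n+1)) * ‖iteratedDeriv (i + (n+1)) φ 0‖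
      ≤ ((i + (n+1)).factorial : ℝ)⁻¹ * R ^ (i + (n+1)) * ((i + (n+1)).factorial * M) := by
        gcongr; exact hc _
    _ = M * R ^ (n + 1) * R ^ i := by field_simp; ring

theorem homog_eval {d k : ℕ} {P : MvPolynomial (Fin d) ℂ} (hP : P.IsHomogeneous k)
    (c : ℂ) (η : Fin d → ℂ) :
    MvPolynomial.eval (c • η) P = c ^ k * MvPolynomial.eval η P := by
  rw [MvPolynomial.eval_eq', MvPolynomial.eval_eq', Finset.mul_sum]
  refine Finset.sum_congr rfl (fun s hs => ?_)
  have hdeg : Finsupp.degree s = k := by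
    by_contra h
    exact (MvPolynomial.mem_support_iff.1 hs) (hP.coeff_eq_zero h)
  rw [Finsupp.degree_eq_sum] at hdeg
  simp only [Pi.smul_apply, smul_eq_mul, mul_pow, Finset.prod_mul_distrib,
    Finset.prod_pow_eq_pow_sum, hdeg]
  ring

theorem taylor {d : ℕ} {K₀ : Set (Fin d → ℂ)} (hK₀c : IsCompact K₀) (hK₀a : AbsConvex K₀)
    (hK₀n : K₀ ∈ nhds (0 : Fin d → ℂ)) {Ω : Set (Fin d → ℂ)} (hΩ : IsOpen Ω) (hKΩ : K₀ ⊆ Ω)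
    {H : (Fin d → ℂ) → ℂ} (hH : DifferentiableOn ℂ H Ω) (M : ℝ) (hM : ∀ z ∈ K₀, ‖H z‖ ≤ M) :
    ∃ t : (Fin d → ℕ) → ℂ, ∀ n : ℕ, ∀ R : ℝ, R < 1 → ∀ ζ : Fin d → ℂ, gauge K₀ ζ ≤ R →
      ‖H ζ - ∑ a : MIdx d n, t a.1 * mono a.1 ζ‖ ≤ M * R ^ (n + 1) / (1 - R) := by
  have h00 : (0 : Fin d → ℂ) ∈ K₀ := mem_of_mem_nhds hK₀n
  choose P hP1 hP2 using fun k => homog_poly hΩ (hKΩ h00) k hH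
  refine ⟨fun α => ((∑ i, α i).factorial : ℂ)⁻¹ *
    MvPolynomial.coeff (Finsupp.equivFunOnFinite.symm α) (P (∑ i, α i)), ?_⟩
  intro n R hR1 ζ hζ
  have hsum : ∑ a : MIdx d n, ((∑ i, a.1 i).factorial : ℂ)⁻¹ *
      MvPolynomial.coeff (Finsupp.equivFunOnFinite.symm a.1) (P (∑ i, a.1 i)) * mono a.1 ζ =
      ∑ k ∈ Finset.range (n + 1), (k.factorial : ℂ)⁻¹ * MvPolynomial.eval ζ (P k) := by
    have : ∀ k ∈ Finset.range (n + 1), (k.factorial : ℂ)⁻¹ * MvPolynomial.eval ζ (P k) =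
        ∑ a : MIdx d n, (k.factorial : ℂ)⁻¹ *
          (MvPolynomial.coeff (Finsupp.equivFunOnFinite.symm a.1) (P k) * mono a.1 ζ) := by
      intro k hk
      rw [eval_eq_sum_midx n (P k) ((hP1 k).totalDegree_le.trans
        (Nat.lt_succ_iff.1 (Finset.mem_range.1 hk))) ζ, Finset.mul_sum]
    rw [Finset.sum_congr rfl this, Finset.sum_comm]
    refine Finset.sum_congr rfl (fun a _ => ?_)
    rw [Finset.sum_eq_single (∑ i, a.1 i)]
    · ring
    · intro k _ hk
      rw [(hP1 k).coeff_eq_zero]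
      · simp
      · rw [Finsupp.degree_eq_sum]
        simpa using hk.symm
    · intro h
      exact absurd (Finset.mem_range.2 (Nat.lt_succ_iff.2 a.2)) h
  simp only [hsum]
  have hR0 : 0 ≤ R := (gauge_nonneg ζ).trans hζ
  have key : ∀ R' : ℝ, R < R' → R' < 1 →
      ‖H ζ - ∑ k ∈ Finset.range (n + 1), (k.factorial : ℂ)⁻¹ * MvPolynomial.eval ζ (P k)‖
        ≤ M * R' ^ (n + 1) / (1 - R') := by
    intro R' hR' hR'1
    have hR'0 : 0 < R' := hR0.trans_lt hR'
    obtain ⟨b, hb0, hbR, η', hη', hηe'⟩ := exists_lt_of_gauge_lt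
      (absorbent_nhds_zero hK₀n : Absorbent ℝ K₀) (hζ.trans_lt hR')
    obtain ⟨η, hη, hηe⟩ : ∃ η ∈ K₀, (R' : ℂ) • η = ζ := by
      refine ⟨((b / R' : ℝ) : ℂ) • η' + (0:ℂ) • η', hK₀a _ hη' _ hη' _ _ ?_, ?_⟩
      · rw [norm_zero, add_zero, Complex.norm_real, Real.norm_of_nonneg (by positivity)]
        exact (div_le_one hR'0).2 hbR.le
      · rw [← hηe']
        ext i
        have : (R' : ℂ) ≠ 0 := by exact_mod_cast hR'0.ne'
        simp
        field_simp
    have hin : ∀ s ∈ Metric.closedBall (0:ℂ) 1, s • η ∈ K₀ := by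
      intro s hs
      have := hK₀a _ hη _ hη s 0 (by simpa using hs)
      simpa using this
    have hd := line_diff hH 0 η
    simp only [zero_add] at hd
    have := slice_tail (fun s : ℂ => H (s • η)) _ hd (fun s hs => hKΩ (hin s hs)) M
      (fun s hs => hM _ (hin s hs)) R' hR'0 hR'1 n
    rw [hηe] at this
    have heq : ∑ k ∈ Finset.range (n + 1), (k.factorial : ℂ)⁻¹ * MvPolynomial.eval ζ (P k) =
        ∑ k ∈ Finset.range (n + 1), ((k.factorial : ℂ)⁻¹ * (R' : ℂ) ^ k *
          iteratedDeriv k (fun s : ℂ => H (s • η)) 0) := by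
      refine Finset.sum_congr rfl (fun k _ => ?_)
      rw [hP2, mul_assoc, ← hηe, homog_eval (hP1 k)]
    rw [heq]
    exact this
  have hlim : Tendsto (fun R' : ℝ => M * R' ^ (n + 1) / (1 - R')) (𝓝[>] R)
      (𝓝 (M * R ^ (n + 1) / (1 - R))) := by
    have : ContinuousAt (fun R' : ℝ => M * R' ^ (n + 1) / (1 - R')) R := by
      refine ContinuousAt.div (by fun_prop) (by fun_prop) (by linarith)
    exact this.tendsto.mono_left nhdsWithin_le_nhds
  refine ge_of_tendsto hlim ?_
  filter_upwards [Ioo_mem_nhdsGT hR1] with R' hR'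
  exact key R' hR'.1 hR'.2

theorem msum {𝕜 : Type*} [Field 𝕜] [CharZero 𝕜] {d : ℕ} (n : ℕ) (x : Fin d → 𝕜) :
    ∑ a : MIdx d n, (∏ i, x i ^ a.1 i) / (∏ i, ((a.1 i).factorial : 𝕜)) =
      ∑ k ∈ Finset.range (n + 1), (∑ i, x i) ^ k / (k.factorial : 𝕜) := by
  classical
  rw [← Finset.sum_fiberwise_of_maps_to (s := Finset.univ) (t := Finset.range (n + 1))
    (g := fun a : MIdx d n => ∑ i, a.1 i)
    (fun a _ => Finset.mem_range.2 (Nat.lt_succ_iff.2 a.2))]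
  refine Finset.sum_congr rfl (fun k hk => ?_)
  rw [Finset.sum_pow_eq_sum_piAntidiag, Finset.sum_div]
  refine Finset.sum_bij (fun a _ => a.1) ?_ ?_ ?_ ?_
  · intro a ha
    simpa using (Finset.mem_filter.1 ha).2
  · intro a _ b _ h
    exact Subtype.ext h
  · intro s hs
    have hs' : ∑ i, s i = k := by simpa using hs
    exact ⟨⟨s, by rw [hs']; exact Nat.lt_succ_iff.1 (Finset.mem_range.1 hk)⟩,
      by simp [hs'], rfl⟩
  · intro a ha
    have ha' : ∑ i, a.1 i = k := (Finset.mem_filter.1 ha).2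
    have h1 := Nat.multinomial_spec Finset.univ a.1
    rw [ha'] at h1
    have h2 : (k.factorial : 𝕜) = (∏ i, ((a.1 i).factorial : 𝕜)) *
        (Nat.multinomial Finset.univ a.1 : 𝕜) := by
      rw [← h1]; push_cast; rfl
    have h3 : (∏ i, ((a.1 i).factorial : 𝕜)) ≠ 0 :=
      Finset.prod_ne_zero_iff.2 (fun i _ => by exact_mod_cast Nat.factorial_ne_zero _)
    have h4 : (k.factorial : 𝕜) ≠ 0 := by exact_mod_cast Nat.factorial_ne_zero _
    rw [div_eq_div_iff h3 h4, h2]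
    ring

/-- partial sums of the exponential series -/
def expS (n : ℕ) (x : ℂ) : ℂ := ∑ k ∈ Finset.range n, x ^ k / (k.factorial : ℂ)

theorem exp_tail (n : ℕ) (x : ℂ) :
    ‖Complex.exp x - expS n x‖ ≤ ‖x‖ ^ n / n.factorial * Real.exp ‖x‖ := by
  have hs : HasSum (fun k : ℕ => x ^ k / (k.factorial : ℂ)) (Complex.exp x) := by
    rw [Complex.exp_eq_exp_ℂ]
    exact NormedSpace.expSeries_div_hasSum_exp x
  have hr : HasSum (fun k : ℕ => ‖x‖ ^ k / (k.factorial : ℝ)) (Real.exp ‖x‖) := by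
    rw [Real.exp_eq_exp_ℝ]
    exact NormedSpace.expSeries_div_hasSum_exp ‖x‖
  have hs2 := (hasSum_nat_add_iff' n).2 hs
  rw [expS, ← hs2.tsum_eq]
  refine tsum_of_norm_bounded (hr.mul_left (‖x‖ ^ n / n.factorial)) (fun i => ?_)
  rw [norm_div, norm_pow, Complex.norm_natCast, div_mul_div_comm, ← pow_add, add_comm n i]
  have h1 : n.factorial * i.factorial ≤ (i + n).factorial := by
    rw [add_comm i n]
    exact Nat.le_of_dvd (Nat.factorial_pos _) (Nat.factorial_mul_factorial_dvd_factorial_add n i)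
  gcongr
  exact_mod_cast h1

theorem expS_hasDerivAt (n : ℕ) (x : ℂ) : HasDerivAt (expS (n + 1)) (expS n x) x := by
  have h : ∀ k ∈ Finset.range (n + 1), HasDerivAt (fun x : ℂ => x ^ k / (k.factorial : ℂ))
      (k * x ^ (k - 1) / (k.factorial : ℂ)) x := fun k _ => (hasDerivAt_pow k x).div_const _
  have h2 := HasDerivAt.fun_sum h
  refine HasDerivAt.congr_deriv h2 ?_
  rw [Finset.sum_range_succ', expS]
  simp only [Nat.cast_zero, zero_mul, zero_div, add_zero]
  refine Finset.sum_congr rfl (fun k _ => ?_)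
  rw [Nat.factorial_succ]
  have h4 : (k.factorial : ℂ) ≠ 0 := by exact_mod_cast Nat.factorial_ne_zero _
  have h5 : (k + 1 : ℂ) ≠ 0 := by exact_mod_cast Nat.succ_ne_zero k
  push_cast
  field_simp
  try simp

/-- Hermitian form -/
def hinner {r : ℕ} (z w : Fin r → ℂ) : ℂ := ∑ i, z i * (starRingEnd ℂ) (w i)

theorem uFn_kernel {r : ℕ} (m : ℕ) (q w w' : Fin r → ℂ) :
    ∑ b : MIdx r m, (starRingEnd ℂ) (uFn q b.1 w) * uFn q b.1 w' =
      ((Real.exp (-(∑ i, ‖q i‖ ^ 2)) : ℝ) : ℂ) * (starRingEnd ℂ) (Complex.exp (hinner w q)) *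
        Complex.exp (hinner w' q) * expS (m + 1) (hinner (w' - q) (w - q)) := by
  have h1 : expS (m + 1) (hinner (w' - q) (w - q)) =
      ∑ b : MIdx r m, (∏ i, ((w' - q) i * (starRingEnd ℂ) ((w - q) i)) ^ b.1 i) /
        (∏ i, ((b.1 i).factorial : ℂ)) := (msum m _).symm
  rw [h1, Finset.mul_sum]
  refine Finset.sum_congr rfl (fun b _ => ?_)
  have hf : (0 : ℝ) ≤ ((∏ i, (b.1 i).factorial : ℕ) : ℝ) := by positivity
  have h2 : (((Real.exp (-(∑ i, ‖q i‖ ^ 2) / 2) /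
      Real.sqrt ((∏ i, (b.1 i).factorial : ℕ) : ℝ) : ℝ)) : ℂ) *
      (((Real.exp (-(∑ i, ‖q i‖ ^ 2) / 2) / Real.sqrt ((∏ i, (b.1 i).factorial : ℕ) : ℝ) : ℝ)) : ℂ)
      = ((Real.exp (-(∑ i, ‖q i‖ ^ 2)) : ℝ) : ℂ) / (∏ i, ((b.1 i).factorial : ℂ)) := by
    rw [← Complex.ofReal_mul, div_mul_div_comm, Real.mul_self_sqrt hf, ← Real.exp_add, add_halves]
    push_cast
    rfl
  simp only [uFn, map_mul, Complex.conj_ofReal, map_prod, map_pow, map_sub, Pi.sub_apply,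
    mul_pow, Finset.prod_mul_distrib]
  unfold hinner
  simp only [← Nat.cast_prod] at h2 ⊢
  linear_combination (∏ i, ((starRingEnd ℂ) (w i) - (starRingEnd ℂ) (q i)) ^ b.1 i) *
    (∏ i, (w' i - q i) ^ b.1 i) *
    (starRingEnd ℂ) (Complex.exp (∑ i, w i * (starRingEnd ℂ) (q i))) *
    Complex.exp (∑ i, w' i * (starRingEnd ℂ) (q i)) * h2

theorem uFn_differentiable {r : ℕ} (q : Fin r → ℂ) (b : Fin r → ℕ) :
    Differentiable ℂ (uFn q b) := by
  unfold uFn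
  fun_prop

theorem pderiv_line {r : ℕ} (j : Fin r) (g : (Fin r → ℂ) → ℂ) (hg : Differentiable ℂ g) (c : ℂ)
    (h : HasDerivAt (fun s : ℂ => g (s • (Pi.single j 1 : Fin r → ℂ))) c 0) :
    pderivAt j g 0 = c := by
  have h1 := line_deriv isOpen_univ hg.differentiableOn 0 (Pi.single j 1 : Fin r → ℂ) 0 trivial
  simp only [zero_add] at h1
  rw [h.deriv, zero_smul] at h1
  exact h1.symm

theorem F_conj {r : ℕ} (m : ℕ) (q w : Fin r → ℂ) (j : Fin r) :
    ∑ b : MIdx r m, (starRingEnd ℂ) (uFn q b.1 w) * pderivAt j (uFn q b.1) 0 =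
      (starRingEnd ℂ) (Complex.exp (hinner (w - q) q)) *
        ((starRingEnd ℂ) (q j) * expS (m + 1) (-(starRingEnd ℂ) (hinner (w - q) q)) +
          (starRingEnd ℂ) (w j - q j) * expS m (-(starRingEnd ℂ) (hinner (w - q) q))) := by
  have h1 : ∑ b : MIdx r m, (starRingEnd ℂ) (uFn q b.1 w) * pderivAt j (uFn q b.1) 0 =
      pderivAt j (fun w' => ∑ b : MIdx r m, (starRingEnd ℂ) (uFn q b.1 w) * uFn q b.1 w') 0 := by
    unfold pderivAt
    rw [fderiv_fun_sum (fun b _ => ((uFn_differentiable q b.1).differentiableAt.const_mul _))]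
    rw [_root_.sum_apply]
    refine Finset.sum_congr rfl (fun b _ => ?_)
    rw [fderiv_const_mul (uFn_differentiable q b.1).differentiableAt]
    rfl
  rw [h1]
  refine pderiv_line _ _ ?_ _ ?_
  · refine Differentiable.fun_sum (fun b _ => (uFn_differentiable q b.1).const_mul _)
  simp only [uFn_kernel]
  have h2 : ∀ s : ℂ, hinner (s • (Pi.single j 1 : Fin r → ℂ)) q = s * (starRingEnd ℂ) (q j) := by
    intro s
    unfold hinner
    rw [Finset.sum_eq_single j]
    · simp
    · intro i _ hi; simp [hi]
    · simp
  have h3 : ∀ s : ℂ, hinner (s • (Pi.single j 1 : Fin r → ℂ) - q) (w - q) =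
      s * (starRingEnd ℂ) (w j - q j) + -(starRingEnd ℂ) (hinner (w - q) q) := by
    intro s
    have h4 : hinner (s • (Pi.single j 1 : Fin r → ℂ)) (w - q) = s * (starRingEnd ℂ) (w j - q j) := by
      unfold hinner
      rw [Finset.sum_eq_single j]
      · simp
      · intro i _ hi; simp [hi]
      · simp
    rw [← h4]
    unfold hinner
    simp only [map_sum, map_mul, Complex.conj_conj, ← Finset.sum_neg_distrib,
      ← Finset.sum_add_distrib]
    refine Finset.sum_congr rfl (fun i _ => ?_)
    simp only [Pi.sub_apply]
    ring
  simp only [h2, h3]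
  set t := hinner (w - q) q with ht
  have h5 : ((Real.exp (-(∑ i, ‖q i‖ ^ 2)) : ℝ) : ℂ) * (starRingEnd ℂ) (Complex.exp (hinner w q)) =
      (starRingEnd ℂ) (Complex.exp t) := by
    rw [← Complex.exp_conj, ← Complex.exp_conj, Complex.ofReal_exp, ← Complex.exp_add]
    congr 1
    have h6 : hinner w q = t + hinner q q := by
      rw [ht]
      unfold hinner
      rw [← Finset.sum_add_distrib]
      refine Finset.sum_congr rfl (fun i _ => ?_)
      simp only [Pi.sub_apply]
      ring
    have h7 : hinner q q = ((∑ i, ‖q i‖ ^ 2 : ℝ) : ℂ) := by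
      unfold hinner
      push_cast
      refine Finset.sum_congr rfl (fun i _ => ?_)
      rw [Complex.mul_conj, Complex.normSq_eq_norm_sq]
      push_cast; rfl
    rw [h6, map_add, h7, Complex.conj_ofReal]
    push_cast
    ring
  simp only [h5]
  have h8 : HasDerivAt (fun s : ℂ => Complex.exp (s * (starRingEnd ℂ) (q j)))
      ((starRingEnd ℂ) (q j)) 0 := by
    have := ((hasDerivAt_id (0:ℂ)).mul_const ((starRingEnd ℂ) (q j))).cexp
    simpa using this
  have h9 : HasDerivAt (fun s : ℂ => expS (m + 1) (s * (starRingEnd ℂ) (w j - q j) +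
      -(starRingEnd ℂ) t)) (expS m (-(starRingEnd ℂ) t) * (starRingEnd ℂ) (w j - q j)) 0 := by
    have ha : HasDerivAt (fun s : ℂ => s * (starRingEnd ℂ) (w j - q j) + -(starRingEnd ℂ) t)
        ((starRingEnd ℂ) (w j - q j)) 0 := by
      simpa using ((hasDerivAt_id (0:ℂ)).mul_const ((starRingEnd ℂ) (w j - q j))).add_const
        (-(starRingEnd ℂ) t)
    have hb := expS_hasDerivAt m ((0:ℂ) * (starRingEnd ℂ) (w j - q j) + -(starRingEnd ℂ) t)
    have hc := HasDerivAt.comp (0:ℂ) hb ha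
    simpa [Function.comp_def] using hc
  have h10 := (h8.const_mul ((starRingEnd ℂ) (Complex.exp t))).mul h9
  refine HasDerivAt.congr_deriv h10 ?_
  simp
  ring

/-- the truncated coordinate function -/
def Fm {r : ℕ} (m : ℕ) (q : Fin r → ℂ) (j : Fin r) (w : Fin r → ℂ) : ℂ :=
  ∑ b : MIdx r m, uFn q b.1 w * (starRingEnd ℂ) (pderivAt j (uFn q b.1) 0)

theorem expS_conj (n : ℕ) (x : ℂ) : (starRingEnd ℂ) (expS n x) = expS n ((starRingEnd ℂ) x) := by
  simp [expS, map_sum]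

theorem Fm_eq {r : ℕ} (m : ℕ) (q w : Fin r → ℂ) (j : Fin r) :
    Fm m q j w = Complex.exp (hinner (w - q) q) *
        (q j * expS (m + 1) (-(hinner (w - q) q)) +
          (w j - q j) * expS m (-(hinner (w - q) q))) := by
  have := congrArg (starRingEnd ℂ) (F_conj m q w j)
  simpa [Fm, map_sum, expS_conj] using this

theorem Fm_err {r : ℕ} (m : ℕ) (q w : Fin r → ℂ) (j : Fin r) :
    ‖Fm m q j w - w j‖ ≤ Real.exp (2 * ‖hinner (w - q) q‖) * (‖w j‖ + ‖q j‖) *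
      (‖hinner (w - q) q‖ ^ m / (m.factorial : ℝ)) := by
  rw [Fm_eq]
  set t := hinner (w - q) q
  have h1 : expS (m + 1) (-t) = expS m (-t) + (-t) ^ m / (m.factorial : ℂ) :=
    Finset.sum_range_succ _ _
  have h2 : ‖Complex.exp (-t) - expS m (-t)‖ ≤ ‖t‖ ^ m / m.factorial * Real.exp ‖t‖ := by
    simpa using exp_tail m (-t)
  have h3 : Complex.exp t * Complex.exp (-t) = 1 := by rw [← Complex.exp_add]; simp
  have h4 : Complex.exp t * (q j * expS (m + 1) (-t) + (w j - q j) * expS m (-t)) - w j =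
      Complex.exp t * (q j * ((-t) ^ m / (m.factorial : ℂ)) -
        w j * (Complex.exp (-t) - expS m (-t))) := by
    rw [h1]
    linear_combination (w j) * h3
  rw [h4, norm_mul]
  have h5 : ‖Complex.exp t‖ ≤ Real.exp ‖t‖ := Complex.norm_exp_le_exp_norm t
  have h6 : ‖q j * ((-t) ^ m / (m.factorial : ℂ)) - w j * (Complex.exp (-t) - expS m (-t))‖ ≤
      ‖q j‖ * (‖t‖ ^ m / m.factorial * Real.exp ‖t‖) +
        ‖w j‖ * (‖t‖ ^ m / m.factorial * Real.exp ‖t‖) := by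
    refine (norm_sub_le _ _).trans ?_
    rw [norm_mul, norm_mul, norm_div, norm_pow, norm_neg, Complex.norm_natCast]
    gcongr
    exact le_mul_of_one_le_right (by positivity) (Real.one_le_exp (norm_nonneg _))
  calc _ ≤ Real.exp ‖t‖ * (‖q j‖ * (‖t‖ ^ m / m.factorial * Real.exp ‖t‖) +
        ‖w j‖ * (‖t‖ ^ m / m.factorial * Real.exp ‖t‖)) := by gcongr
    _ = _ := by rw [two_mul, Real.exp_add]; ring

theorem msupport_compl_null {d : ℕ} (μ : Measure (Fin d → ℝ)) : μ (msupport μ)ᶜ = 0 := by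
  refine measure_null_of_locally_null _ (fun x hx => ?_)
  simp only [msupport, Set.mem_compl_iff, Set.mem_ofPred_eq, not_forall, not_lt,
    nonpos_iff_eq_zero] at hx
  obtain ⟨U, hU, hxU, h0⟩ := hx
  exact ⟨U, mem_nhdsWithin_of_mem_nhds (hU.mem_nhds hxU), h0⟩

/-- real monomials -/
def rmono {d : ℕ} (α : Fin d → ℕ) (x : Fin d → ℝ) : ℝ := ∏ i, x i ^ α i

theorem rmono_add {d : ℕ} (α β : Fin d → ℕ) (x : Fin d → ℝ) :
    ∏ i, x i ^ (α i + β i) = rmono α x * rmono β x := by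
  simp [rmono, pow_add, Finset.prod_mul_distrib]

theorem rmono_cont {d : ℕ} (α : Fin d → ℕ) : Continuous (rmono α) := by
  unfold rmono; fun_prop

theorem integrable_of_supp {d : ℕ} (μ : Measure (Fin d → ℝ)) [IsProbabilityMeasure μ]
    (hμc : IsCompact (msupport μ)) (g : (Fin d → ℝ) → ℝ) (hg : Continuous g) : Integrable g μ := by
  obtain ⟨C, hC⟩ := hμc.exists_bound_of_continuousOn hg.continuousOn
  refine Integrable.of_bound hg.aestronglyMeasurable C ?_
  have : ∀ᵐ x ∂μ, x ∈ msupport μ := by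
    rw [ae_iff]; exact msupport_compl_null μ
  filter_upwards [this] with x hx using hC x hx

theorem quad_moment {d n : ℕ} (ν : Measure (Fin d → ℝ))
    (hintble : ∀ g : (Fin d → ℝ) → ℝ, Continuous g → Integrable g ν) (v : MIdx d n → ℝ) :
    v ⬝ᵥ (momentMatrix d n ν *ᵥ v) = ∫ x, (∑ a, v a * rmono a.1 x) ^ 2 ∂ν := by
  have h1 : ∀ x, (∑ a, v a * rmono a.1 x) ^ 2 =
      ∑ a, ∑ b, v a * ((∏ i, x i ^ (a.1 i + b.1 i)) * v b) := by
    intro x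
    rw [sq, Finset.sum_mul_sum]
    refine Finset.sum_congr rfl (fun a _ => Finset.sum_congr rfl (fun b _ => ?_))
    rw [rmono_add]; ring
  simp only [h1]
  rw [integral_finsetSum _ (fun a _ => hintble _ (by fun_prop))]
  simp only [dotProduct, mulVec, momentMatrix, Matrix.of_apply]
  refine Finset.sum_congr rfl (fun a _ => ?_)
  rw [integral_finsetSum _ (fun b _ => hintble _ (by fun_prop)), Finset.mul_sum]
  refine Finset.sum_congr rfl (fun b _ => ?_)
  rw [integral_const_mul, integral_mul_const]

theorem moment_symm {d n : ℕ} (ν : Measure (Fin d → ℝ)) : (momentMatrix d n ν).IsHermitian := by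
  ext a b
  simp [momentMatrix, add_comm]

theorem moment_psd {d n : ℕ} (ν : Measure (Fin d → ℝ))
    (hintble : ∀ g : (Fin d → ℝ) → ℝ, Continuous g → Integrable g ν) :
    (momentMatrix d n ν).PosSemidef := by
  refine PosSemidef.of_dotProduct_mulVec_nonneg (moment_symm ν) (fun v => ?_)
  rw [star_trivial, quad_moment ν hintble v]
  exact integral_nonneg (fun x => sq_nonneg _)

theorem minEig_spec {ι : Type*} [Fintype ι] [DecidableEq ι] [Nonempty ι] (M : Matrix ι ι ℝ)
    (hM : M.PosDef) : 0 < minEig M ∧ ∀ x : ι → ℝ, minEig M * (x ⬝ᵥ x) ≤ x ⬝ᵥ (M *ᵥ x) := by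
  set S := {t : ℝ | ∃ v : ι → ℝ, v ≠ 0 ∧ M.mulVec v = t • v} with hS
  have hpos : ∀ t ∈ S, 0 < t := by
    rintro t ⟨v, hv, hvt⟩
    have h1 := hM.dotProduct_mulVec_pos hv
    rw [star_trivial, hvt, dotProduct_smul, smul_eq_mul] at h1
    have h2 : 0 ≤ v ⬝ᵥ v := Finset.sum_nonneg (fun i _ => mul_self_nonneg _)
    exact pos_of_mul_pos_left h1 h2
  have hbdd : BddBelow S := ⟨0, fun t ht => (hpos t ht).le⟩
  have hev : ∀ (A : Matrix ι ι ℝ) (hA : A.IsHermitian) (i : ι),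
      ∃ v : ι → ℝ, v ≠ 0 ∧ A *ᵥ v = hA.eigenvalues i • v := by
    intro A hA i
    refine ⟨(hA.eigenvectorBasis i).ofLp, ?_, hA.mulVec_eigenvectorBasis i⟩
    intro h
    have h2 := hA.eigenvectorBasis.orthonormal.ne_zero i
    exact h2 (by ext k; simpa using congrFun h k)
  have hne : S.Nonempty := by
    obtain ⟨i⟩ := ‹Nonempty ι›
    exact ⟨_, hev M hM.isHermitian i⟩
  have hfin : S.Finite := by
    refine (Module.End.finite_hasEigenvalue (Matrix.toLin' M)).subset ?_
    rintro t ⟨v, hv, hvt⟩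
    exact Module.End.hasEigenvalue_of_hasEigenvector
      (Module.End.hasEigenvector_iff.2 ⟨Module.End.mem_eigenspace_iff.2 (by simpa using hvt), hv⟩)
  refine ⟨hpos _ (hne.csInf_mem hfin), fun x => ?_⟩
  have hN : (M - minEig M • (1 : Matrix ι ι ℝ)).IsHermitian := by
    refine hM.isHermitian.sub ?_
    ext a b
    simp [Matrix.one_apply, eq_comm]
  have hpsd : (M - minEig M • (1 : Matrix ι ι ℝ)).PosSemidef := by
    rw [hN.posSemidef_iff_eigenvalues_nonneg]
    intro i
    obtain ⟨v, hv, hvt⟩ := hev _ hN i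
    have : hN.eigenvalues i + minEig M ∈ S := by
      refine ⟨v, hv, ?_⟩
      rw [sub_mulVec, smul_mulVec, one_mulVec, sub_eq_iff_eq_add] at hvt
      rw [hvt, add_smul]
    have h3 := csInf_le hbdd this
    change minEig M ≤ _ at h3
    simp only [Pi.zero_apply]
    linarith
  have h4 := hpsd.dotProduct_mulVec_nonneg x
  rw [star_trivial, sub_mulVec, smul_mulVec, one_mulVec, dotProduct_sub, dotProduct_smul,
    smul_eq_mul] at h4
  linarith

theorem opnorm_quad {ι : Type*} [Fintype ι] (A : Matrix ι ι ℝ) (c : ℝ) (h : matOpNorm A ≤ c)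
    (v : ι → ℝ) : v ⬝ᵥ (A *ᵥ v) ≤ c * (v ⬝ᵥ v) := by
  have hcs : ∀ u w : ι → ℝ, (u ⬝ᵥ w) ^ 2 ≤ (u ⬝ᵥ u) * (w ⬝ᵥ w) := by
    intro u w
    have := Finset.sum_mul_sq_le_sq_mul_sq Finset.univ u w
    simpa [dotProduct, sq] using this
  have hnn : ∀ u : ι → ℝ, 0 ≤ u ⬝ᵥ u := fun u => Finset.sum_nonneg (fun i _ => mul_self_nonneg _)
  have hbdd : BddAbove {t : ℝ | ∃ v : ι → ℝ, (∑ j, ‖v j‖ ^ 2) ≤ 1 ∧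
      t = Real.sqrt (∑ i, ‖∑ j, A i j * v j‖ ^ 2)} := by
    refine ⟨Real.sqrt (∑ i, A i ⬝ᵥ A i), ?_⟩
    rintro t ⟨w, hw, rfl⟩
    apply Real.sqrt_le_sqrt
    refine Finset.sum_le_sum (fun i _ => ?_)
    have h1 := hcs (A i) w
    have h2 : w ⬝ᵥ w ≤ 1 := by simpa [dotProduct, ← sq] using hw
    rw [Real.norm_eq_abs, sq_abs]
    exact h1.trans (mul_le_of_le_one_right (hnn _) h2)
  rcases (hnn v).eq_or_lt with h0 | h0
  · have hv : v = 0 := dotProduct_self_eq_zero.1 h0.symm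
    simp [hv]
  set s := Real.sqrt (v ⬝ᵥ v) with hs
  have hs0 : 0 < s := Real.sqrt_pos.2 h0
  have hss : s * s = v ⬝ᵥ v := Real.mul_self_sqrt h0.le
  have h3 : Real.sqrt (∑ i, ‖∑ j, A i j * (s⁻¹ • v) j‖ ^ 2) ≤ c := by
    refine (le_csSup hbdd ⟨s⁻¹ • v, ?_, rfl⟩).trans h
    have : ∑ j, ‖(s⁻¹ • v) j‖ ^ 2 = s⁻¹ * s⁻¹ * (v ⬝ᵥ v) := by
      simp only [dotProduct, Finset.mul_sum, Real.norm_eq_abs, sq_abs, Pi.smul_apply, smul_eq_mul]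
      refine Finset.sum_congr rfl (fun i _ => by ring)
    rw [this, ← hss]
    field_simp
    exact le_rfl
  have h4 : ∑ i, ‖∑ j, A i j * (s⁻¹ • v) j‖ ^ 2 = (A *ᵥ (s⁻¹ • v)) ⬝ᵥ (A *ᵥ (s⁻¹ • v)) := by
    simp [dotProduct, mulVec, sq, Real.norm_eq_abs, ]
  rw [h4] at h3
  have hc : 0 ≤ c := (Real.sqrt_nonneg _).trans h3
  have h5 := (Real.sqrt_le_left hc).1 h3
  rw [mulVec_smul, smul_dotProduct, dotProduct_smul, smul_eq_mul, smul_eq_mul] at h5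
  have h6 : (A *ᵥ v) ⬝ᵥ (A *ᵥ v) ≤ c ^ 2 * (v ⬝ᵥ v) := by
    rw [← hss]
    have := mul_le_mul_of_nonneg_left h5 (mul_pos hs0 hs0).le
    calc _ = s * s * (s⁻¹ * (s⁻¹ * ((A *ᵥ v) ⬝ᵥ (A *ᵥ v)))) := by field_simp
      _ ≤ _ := this
      _ = _ := by ring
  refine abs_le_of_sq_le_sq' ?_ (mul_nonneg hc h0.le) |>.2
  calc _ ≤ (v ⬝ᵥ v) * ((A *ᵥ v) ⬝ᵥ (A *ᵥ v)) := hcs _ _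
    _ ≤ (v ⬝ᵥ v) * (c ^ 2 * (v ⬝ᵥ v)) := by gcongr
    _ = _ := by ring

open scoped MatrixOrder in
theorem exists_sqrt {ι : Type*} [Fintype ι] [DecidableEq ι] (M : Matrix ι ι ℝ)
    (hM : M.PosSemidef) : ∃ R : Matrix ι ι ℝ, R.PosSemidef ∧ R * R = M := by
  refine ⟨CFC.sqrt M, (CFC.sqrt_nonneg M).posSemidef, CFC.sqrt_mul_sqrt_self M hM.nonneg⟩

theorem quad_compare {ι : Type*} [Fintype ι] [DecidableEq ι] (D E : Matrix ι ι ℝ)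
    (hD : D.PosDef) (γ : ℝ)
    (h : ∀ R : Matrix ι ι ℝ, R.PosSemidef → R * R = D⁻¹ → matOpNorm (1 - R * E * R) ≤ 1 - γ)
    (x : ι → ℝ) : γ * (x ⬝ᵥ (D *ᵥ x)) ≤ x ⬝ᵥ (E *ᵥ x) := by
  obtain ⟨R, hR, hRR⟩ := exists_sqrt _ hD.inv.posSemidef
  have h1 := h R hR hRR
  have hRt : Rᵀ = R := by
    have := hR.isHermitian
    rwa [Matrix.IsHermitian, conjTranspose_eq_transpose_of_trivial] at this
  have hDu : IsUnit D.det := (Matrix.isUnit_iff_isUnit_det D).1 hD.isUnit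
  set y := R *ᵥ (D *ᵥ x) with hy
  have hRy : R *ᵥ y = x := by
    rw [hy, mulVec_mulVec, hRR, mulVec_mulVec, Matrix.nonsing_inv_mul _ hDu, one_mulVec]
  have hsym : ∀ u w : ι → ℝ, u ⬝ᵥ (R *ᵥ w) = (R *ᵥ u) ⬝ᵥ w := by
    intro u w
    rw [dotProduct_mulVec, ← mulVec_transpose, hRt]
  have hyy : y ⬝ᵥ y = x ⬝ᵥ (D *ᵥ x) := by
    have h5 : y ⬝ᵥ y = y ⬝ᵥ (R *ᵥ (D *ᵥ x)) := by rw [← hy]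
    rw [h5, hsym, hRy]
  have h2 := opnorm_quad _ _ h1 y
  rw [sub_mulVec, one_mulVec, dotProduct_sub, ← mulVec_mulVec, ← mulVec_mulVec, hRy,
    hsym y (E *ᵥ x), hRy, hyy] at h2
  linarith

theorem midx_nonempty (d n : ℕ) : Nonempty (MIdx d n) := ⟨⟨0, by simp⟩⟩

theorem mono_cpx {d : ℕ} (α : Fin d → ℕ) (x : Fin d → ℝ) :
    mono α (cpx x) = ((rmono α x : ℝ) : ℂ) := by
  simp [mono, rmono, cpx]

theorem quad_emp {d n N : ℕ} (z₀ : Fin N → Fin d → ℝ) (hN : 0 < N) (v : MIdx d n → ℝ) :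
    N * (v ⬝ᵥ (momentMatrix d n ((N : ℝ≥0∞)⁻¹ • ∑ i : Fin N, Measure.dirac (z₀ i)) *ᵥ v)) =
      ∑ i, (∑ a, v a * rmono a.1 (z₀ i)) ^ 2 := by
  have hNt : ((N : ℝ≥0∞)⁻¹) ≠ ⊤ := by
    simp only [ne_eq, ENNReal.inv_eq_top, Nat.cast_eq_zero]; omega
  have hintble0 : ∀ g : (Fin d → ℝ) → ℝ, ∀ i : Fin N, Integrable g (Measure.dirac (z₀ i)) :=
    fun g i => integrable_dirac (by simp)
  have hintble : ∀ g : (Fin d → ℝ) → ℝ, Continuous g →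
      Integrable g ((N : ℝ≥0∞)⁻¹ • ∑ i : Fin N, Measure.dirac (z₀ i)) := by
    intro g _
    refine Integrable.smul_measure ?_ hNt
    exact integrable_finsetSum_measure.2 (fun i _ => hintble0 g i)
  rw [quad_moment _ hintble, integral_smul_measure, integral_finsetSum_measure (fun i _ => hintble0 _ i)]
  simp only [integral_dirac, ENNReal.toReal_inv, ENNReal.toReal_natCast, smul_eq_mul]
  have : (N : ℝ) ≠ 0 := by exact_mod_cast hN.ne'
  field_simp

theorem sample_lower {d n N : ℕ} (μ : Measure (Fin d → ℝ)) [IsProbabilityMeasure μ]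
    (hμc : IsCompact (msupport μ)) (γ : ℝ) (hγ : 0 < γ) (hN : 0 < N) (z₀ : Fin N → Fin d → ℝ)
    (hdet : IsUnit (momentMatrix d n μ).det)
    (h : ∀ R : Matrix (MIdx d n) (MIdx d n) ℝ, R.PosSemidef →
          R * R = (momentMatrix d n μ)⁻¹ →
          matOpNorm (1 - R * momentMatrix d n
              ((N : ℝ≥0∞)⁻¹ • ∑ i : Fin N, Measure.dirac (z₀ i)) * R) ≤ 1 - γ) :
    0 < minEig (momentMatrix d n μ) ∧ ∀ x : MIdx d n → ℂ,
      γ * minEig (momentMatrix d n μ) * N * ∑ a, ‖x a‖ ^ 2 ≤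
        ∑ i, ‖∑ a, x a * mono a.1 (cpx (z₀ i))‖ ^ 2 := by
  have := midx_nonempty d n
  have hpd : (momentMatrix d n μ).PosDef :=
    (moment_psd μ (fun g hg => integrable_of_supp μ hμc g hg)).posDef_iff_isUnit.2
      ((Matrix.isUnit_iff_isUnit_det _).2 hdet)
  obtain ⟨hpos, hlow⟩ := minEig_spec _ hpd
  refine ⟨hpos, fun x => ?_⟩
  set Λ := minEig (momentMatrix d n μ)
  have hreal : ∀ v : MIdx d n → ℝ, γ * Λ * N * (v ⬝ᵥ v) ≤
      ∑ i, (∑ a, v a * rmono a.1 (z₀ i)) ^ 2 := by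
    intro v
    rw [← quad_emp z₀ hN v]
    have h1 := quad_compare _ _ hpd γ h v
    have h2 := hlow v
    have hN' : (0:ℝ) < N := by exact_mod_cast hN
    calc γ * Λ * N * (v ⬝ᵥ v) = N * (γ * (Λ * (v ⬝ᵥ v))) := by ring
      _ ≤ N * (γ * (v ⬝ᵥ (momentMatrix d n μ *ᵥ v))) := by gcongr
      _ ≤ _ := by gcongr
  have h1 := hreal (fun a => (x a).re)
  have h2 := hreal (fun a => (x a).im)
  have h3 : ∑ a, ‖x a‖ ^ 2 = (fun a => (x a).re) ⬝ᵥ (fun a => (x a).re) +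
      (fun a => (x a).im) ⬝ᵥ (fun a => (x a).im) := by
    simp only [dotProduct, ← Finset.sum_add_distrib]
    refine Finset.sum_congr rfl (fun a _ => ?_)
    rw [← Complex.normSq_eq_norm_sq, Complex.normSq_apply]
  have h4 : ∀ i, ‖∑ a, x a * mono a.1 (cpx (z₀ i))‖ ^ 2 =
      (∑ a, (x a).re * rmono a.1 (z₀ i)) ^ 2 + (∑ a, (x a).im * rmono a.1 (z₀ i)) ^ 2 := by
    intro i
    rw [← Complex.normSq_eq_norm_sq, Complex.normSq_apply, Complex.re_sum, Complex.im_sum]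
    simp only [mono_cpx, Complex.re_mul_ofReal, Complex.im_mul_ofReal]
    ring
  simp only [h4, Finset.sum_add_distrib]
  rw [h3]
  linarith

theorem pinv_left {ι κ : Type*} [Fintype ι] [Fintype κ] [DecidableEq κ] (U : Matrix ι κ ℂ)
    (X : Matrix ι κ ℂ) (hX : IsMoorePenrose Uᴴ X) (hinj : ∀ x : κ → ℂ, U *ᵥ x = 0 → x = 0)
    (x : κ → ℂ) : Xᴴ *ᵥ (U *ᵥ x) = x := by
  have h1 : U * Xᴴ * U = U := by
    have := congrArg conjTranspose hX.1
    simpa [conjTranspose_mul, Matrix.mul_assoc] using this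
  have h2 : U *ᵥ (Xᴴ *ᵥ (U *ᵥ x) - x) = 0 := by
    rw [mulVec_sub, mulVec_mulVec, mulVec_mulVec, h1, sub_self]
  exact sub_eq_zero.1 (hinj _ h2)

theorem pinv_contr {ι κ : Type*} [Fintype ι] [Fintype κ] (U : Matrix ι κ ℂ)
    (X : Matrix ι κ ℂ) (hX : IsMoorePenrose Uᴴ X) (e : ι → ℂ) :
    ∑ i, ‖(U *ᵥ (Xᴴ *ᵥ e)) i‖ ^ 2 ≤ ∑ i, ‖e i‖ ^ 2 := by
  set P := U * Xᴴ with hP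
  have hPe : P = X * Uᴴ := by
    have := hX.2.2.2
    rw [conjTranspose_mul, conjTranspose_conjTranspose] at this
    exact this
  have hPh : Pᴴ = P := by
    conv_rhs => rw [hPe]
    rw [hP, conjTranspose_mul, conjTranspose_conjTranspose]
  have hPP : P * P = P := by
    rw [hPe, Matrix.mul_assoc, ← Matrix.mul_assoc Uᴴ, hX.1]
  rw [mulVec_mulVec, ← hP]
  have hn : ∀ u : ι → ℂ, ((∑ i, ‖u i‖ ^ 2 : ℝ) : ℂ) = star u ⬝ᵥ u := by
    intro u
    simp only [dotProduct, Pi.star_apply]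
    push_cast
    refine Finset.sum_congr rfl (fun i _ => ?_)
    exact (Complex.conj_mul' (u i)).symm
  have key : star (P *ᵥ e) ⬝ᵥ (P *ᵥ e) = star e ⬝ᵥ (P *ᵥ e) := by
    rw [star_mulVec, ← dotProduct_mulVec, mulVec_mulVec, hPh, hPP]
  have key2 : star (e - P *ᵥ e) ⬝ᵥ (e - P *ᵥ e) = star e ⬝ᵥ e - star (P *ᵥ e) ⬝ᵥ (P *ᵥ e) := by
    have key3 : star (P *ᵥ e) ⬝ᵥ e = star e ⬝ᵥ (P *ᵥ e) := by
      rw [star_mulVec, ← dotProduct_mulVec, hPh]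
    rw [star_sub, sub_dotProduct, dotProduct_sub, dotProduct_sub, key3, key]
    ring
  rw [← hn, ← hn, ← hn] at key2
  have key4 : ∑ i, ‖(e - P *ᵥ e) i‖ ^ 2 = ∑ i, ‖e i‖ ^ 2 - ∑ i, ‖(P *ᵥ e) i‖ ^ 2 := by
    exact_mod_cast key2
  have : 0 ≤ ∑ i, ‖(e - P *ᵥ e) i‖ ^ 2 := by positivity
  linarith

/-- square root of the multi-index factorial -/
def sf {d : ℕ} (α : Fin d → ℕ) : ℝ := Real.sqrt (∏ i, ((α i).factorial : ℝ))

theorem sf_pos {d : ℕ} (α : Fin d → ℕ) : 0 < sf α := by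
  exact Real.sqrt_pos.2 (Finset.prod_pos fun i _ => by positivity)

/-- normalising constant -/
def kap {d : ℕ} (p : Fin d → ℝ) : ℝ := Real.exp ((∑ i, p i ^ 2) / 2)

theorem uFn_eq {d : ℕ} (p : Fin d → ℝ) (α : Fin d → ℕ) (ζ : Fin d → ℂ) :
    uFn (cpx p) α (cpx p + ζ) =
      (kap p : ℂ) / (sf α : ℂ) * mono α ζ * Complex.exp (hinner ζ (cpx p)) := by
  have h1 : ∑ i, (cpx p + ζ) i * (starRingEnd ℂ) (cpx p i) =
      ((∑ i, p i ^ 2 : ℝ) : ℂ) + hinner ζ (cpx p) := by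
    unfold hinner
    push_cast
    rw [← Finset.sum_add_distrib]
    refine Finset.sum_congr rfl (fun i _ => ?_)
    simp only [Pi.add_apply, cpx, Complex.conj_ofReal]
    ring
  have h2 : ∑ i, ‖cpx p i‖ ^ 2 = ∑ i, p i ^ 2 := by simp [cpx]
  unfold uFn
  rw [h1, Complex.exp_add, h2]
  have h3 : (kap p : ℂ) = ((Real.exp (-(∑ i, p i ^ 2) / 2) : ℝ) : ℂ) *
      Complex.exp ((∑ i, p i ^ 2 : ℝ) : ℂ) := by
    rw [← Complex.ofReal_exp, ← Complex.ofReal_mul, ← Real.exp_add]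
    unfold kap
    congr 2
    ring
  rw [h3]
  simp only [sf, mono, Complex.ofReal_div, Pi.add_apply, add_sub_cancel_left]
  ring


theorem kap_ge {d : ℕ} (p : Fin d → ℝ) : 1 ≤ kap p := by
  unfold kap
  exact Real.one_le_exp (by positivity)

theorem recon {d n N : ℕ} (p : Fin d → ℝ) (z₀ : Fin N → Fin d → ℝ) (hN : 0 < N)
    (X : Matrix (Fin N) (MIdx d n) ℂ)
    (hX : IsMoorePenrose (sampMat n (cpx p) (fun i => cpx p + cpx (z₀ i)))ᴴ X)
    (G : Fin N → ℂ) (t : (Fin d → ℕ) → ℂ) (L ε lam : ℝ) (hε : 0 ≤ ε) (hlam : 0 < lam)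
    (hL : ∀ i, ‖hinner (cpx (z₀ i)) (cpx p)‖ ≤ L)
    (hG : ∀ i, ‖G i * Complex.exp (-hinner (cpx (z₀ i)) (cpx p)) -
      ∑ a : MIdx d n, t a.1 * mono a.1 (cpx (z₀ i))‖ ≤ ε)
    (hlow : ∀ x : MIdx d n → ℂ, lam * N * ∑ a, ‖x a‖ ^ 2 ≤
        ∑ i, ‖∑ a, x a * mono a.1 (cpx (z₀ i))‖ ^ 2) :
    ∃ x : MIdx d n → ℂ, ∑ a, ‖x a‖ ^ 2 ≤ (Real.exp (2 * L) * ε) ^ 2 / lam ∧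
      ∀ a, ∑ i, (starRingEnd ℂ) (X i a) * G i =
        (sf a.1 : ℂ) / (kap p : ℂ) * t a.1 + (sf a.1 : ℂ) * x a := by
  classical
  set U := sampMat n (cpx p) (fun i => cpx p + cpx (z₀ i)) with hU
  have hN' : (0:ℝ) < N := by exact_mod_cast hN
  have hk1 := kap_ge p
  have hk : (kap p : ℂ) ≠ 0 := by
    have : kap p ≠ 0 := by linarith
    exact_mod_cast this
  have hsf : ∀ a : MIdx d n, (sf a.1 : ℂ) ≠ 0 := fun a => by
    exact_mod_cast (sf_pos a.1).ne'
  have hUx : ∀ (y : MIdx d n → ℂ) (i : Fin N), (U *ᵥ y) i = (kap p : ℂ) *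
      Complex.exp (hinner (cpx (z₀ i)) (cpx p)) *
        ∑ a, (y a / (sf a.1 : ℂ)) * mono a.1 (cpx (z₀ i)) := by
    intro y i
    simp only [mulVec, dotProduct, hU, sampMat, Matrix.of_apply, uFn_eq, Finset.mul_sum]
    refine Finset.sum_congr rfl (fun a _ => ?_)
    ring
  have hexp : ∀ i, Real.exp (-L) ≤ ‖Complex.exp (hinner (cpx (z₀ i)) (cpx p))‖ := by
    intro i
    rw [Complex.norm_exp]
    refine Real.exp_le_exp.2 ?_
    have := Complex.abs_re_le_norm (hinner (cpx (z₀ i)) (cpx p))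
    have := neg_abs_le (hinner (cpx (z₀ i)) (cpx p)).re
    linarith [hL i]
  have hexp2 : ∀ i, ‖Complex.exp (hinner (cpx (z₀ i)) (cpx p))‖ ≤ Real.exp L := by
    intro i
    rw [Complex.norm_exp]
    refine Real.exp_le_exp.2 ?_
    have := Complex.abs_re_le_norm (hinner (cpx (z₀ i)) (cpx p))
    have := le_abs_self (hinner (cpx (z₀ i)) (cpx p)).re
    linarith [hL i]
  have hlowU : ∀ y : MIdx d n → ℂ, lam * N * ∑ a, ‖y a / (sf a.1 : ℂ)‖ ^ 2 ≤
      Real.exp L ^ 2 * ∑ i, ‖(U *ᵥ y) i‖ ^ 2 := by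
    intro y
    refine (hlow _).trans ?_
    rw [Finset.mul_sum]
    refine Finset.sum_le_sum (fun i _ => ?_)
    rw [← mul_pow]
    refine pow_le_pow_left₀ (norm_nonneg _) ?_ 2
    rw [hUx, norm_mul, norm_mul]
    set s := ‖∑ a, (y a / (sf a.1 : ℂ)) * mono a.1 (cpx (z₀ i))‖
    have h1 : ‖(kap p : ℂ)‖ = kap p := by
      rw [Complex.norm_real, Real.norm_of_nonneg (by linarith)]
    rw [h1]
    have h2 : 1 ≤ Real.exp L * (kap p * ‖Complex.exp (hinner (cpx (z₀ i)) (cpx p))‖) := by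
      calc (1:ℝ) = Real.exp L * (1 * Real.exp (-L)) := by
            rw [one_mul, ← Real.exp_add]; simp
        _ ≤ _ := by
          gcongr
          exact hexp i
    have hs : 0 ≤ s := norm_nonneg _
    nlinarith
  have hinj : ∀ y : MIdx d n → ℂ, U *ᵥ y = 0 → y = 0 := by
    intro y hy
    have h1 := hlowU y
    rw [hy] at h1
    simp only [Pi.zero_apply, norm_zero, ne_eq, OfNat.ofNat_ne_zero, not_false_eq_true, zero_pow,
      Finset.sum_const_zero, mul_zero] at h1
    have h2 : ∑ a, ‖y a / (sf a.1 : ℂ)‖ ^ 2 = 0 := by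
      refine le_antisymm ?_ (by positivity)
      by_contra hc
      push Not at hc
      have : 0 < lam * N * ∑ a, ‖y a / (sf a.1 : ℂ)‖ ^ 2 := by positivity
      linarith
    funext a
    have h3 := (Finset.sum_eq_zero_iff_of_nonneg (fun a _ => by positivity)).1 h2 a
      (Finset.mem_univ a)
    have h4 : y a / (sf a.1 : ℂ) = 0 := by simpa using h3
    simpa [hsf a] using h4
  set g : MIdx d n → ℂ := fun a => (sf a.1 : ℂ) / (kap p : ℂ) * t a.1 with hg
  set e : Fin N → ℂ := G - U *ᵥ g with he
  set y := Xᴴ *ᵥ e with hy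
  have he1 : ∀ i, ‖e i‖ ≤ Real.exp L * ε := by
    intro i
    have h1 : e i = Complex.exp (hinner (cpx (z₀ i)) (cpx p)) *
        (G i * Complex.exp (-hinner (cpx (z₀ i)) (cpx p)) -
          ∑ a : MIdx d n, t a.1 * mono a.1 (cpx (z₀ i))) := by
      have h2 : Complex.exp (hinner (cpx (z₀ i)) (cpx p)) *
          Complex.exp (-hinner (cpx (z₀ i)) (cpx p)) = 1 := by
        rw [← Complex.exp_add]; simp
      have h3 : (kap p : ℂ) * ∑ a, (g a / (sf a.1 : ℂ)) * mono a.1 (cpx (z₀ i)) =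
          ∑ a : MIdx d n, t a.1 * mono a.1 (cpx (z₀ i)) := by
        rw [Finset.mul_sum]
        refine Finset.sum_congr rfl (fun a _ => ?_)
        have := hsf a
        simp only [hg]
        field_simp
      rw [← h3, he, Pi.sub_apply, hUx]
      linear_combination (-G i) * h2
    rw [h1, norm_mul]
    gcongr
    · exact hexp2 i
    · exact hG i
  refine ⟨fun a => y a / (sf a.1 : ℂ), ?_, ?_⟩
  · have h1 := hlowU y
    have h2 := pinv_contr U X hX e
    rw [← hy] at h2
    have h3 : ∑ i, ‖e i‖ ^ 2 ≤ N * (Real.exp L * ε) ^ 2 := by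
      calc ∑ i, ‖e i‖ ^ 2 ≤ ∑ i : Fin N, (Real.exp L * ε) ^ 2 := by
            refine Finset.sum_le_sum (fun i _ => ?_)
            exact pow_le_pow_left₀ (norm_nonneg _) (he1 i) 2
        _ = _ := by simp
    have h4 : lam * N * ∑ a, ‖y a / (sf a.1 : ℂ)‖ ^ 2 ≤
        Real.exp L ^ 2 * (N * (Real.exp L * ε) ^ 2) := by
      refine h1.trans ?_
      gcongr
      exact h2.trans h3
    rw [le_div_iff₀ hlam]
    have h5 : Real.exp (2 * L) = Real.exp L * Real.exp L := by
      rw [← Real.exp_add]; ring_nf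
    rw [h5]
    refine le_of_mul_le_mul_left ?_ hN'
    calc _ = lam * N * ∑ a, ‖y a / (sf a.1 : ℂ)‖ ^ 2 := by ring
      _ ≤ _ := h4
      _ = _ := by ring
  · intro a
    have h1 : Xᴴ *ᵥ G = g + y := by
      have h2 : G = U *ᵥ g + e := by rw [he]; abel
      rw [hy]
      conv_lhs => rw [h2]
      rw [mulVec_add, pinv_left U X hX hinj]
    have h3 := congrFun h1 a
    have h4 : (Xᴴ *ᵥ G) a = ∑ i, (starRingEnd ℂ) (X i a) * G i := rfl
    rw [← h4, h3, Pi.add_apply, mul_div_cancel₀ _ (hsf a)]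


theorem sup_gauge {d : ℕ} {K₀ : Set (Fin d → ℂ)} (hK₀a : AbsConvex K₀)
    (hK₀n : K₀ ∈ nhds (0 : Fin d → ℂ)) (S : Set (Fin d → ℂ)) (hS : IsCompact S)
    (hSK : S ⊆ interior K₀) :
    0 ≤ sSup (gauge K₀ '' S) ∧ sSup (gauge K₀ '' S) < 1 ∧
      ∀ x ∈ S, gauge K₀ x ≤ sSup (gauge K₀ '' S) := by
  have hconv : Convex ℝ K₀ := by
    intro x hx y hy a b ha hb hab
    have := hK₀a x hx y hy (a : ℂ) (b : ℂ) (by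
      rw [Complex.norm_real, Complex.norm_real, Real.norm_of_nonneg ha, Real.norm_of_nonneg hb,
        hab])
    convert this using 2 <;> ext i <;> simp
  have hcont : Continuous (gauge K₀) := continuous_gauge hconv hK₀n
  have hbdd : BddAbove (gauge K₀ '' S) := (hS.image hcont).bddAbove
  refine ⟨Real.sSup_nonneg (by rintro _ ⟨x, -, rfl⟩; exact gauge_nonneg x), ?_,
    fun x hx => le_csSup hbdd ⟨x, hx, rfl⟩⟩
  rcases S.eq_empty_or_nonempty with rfl | hne
  · simp
  · obtain ⟨x, hx, hxe⟩ := (hS.image hcont).sSup_mem (hne.image _)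
    rw [← hxe]
    exact interior_subset_gauge_lt_one K₀ (hSK hx)

theorem mono_sum_sq {d m : ℕ} (ζ : Fin d → ℂ) :
    ∑ a : MIdx d m, ‖mono a.1 ζ‖ ^ 2 ≤ m.factorial * Real.exp (∑ i, ‖ζ i‖ ^ 2) := by
  have h1 := msum m (fun i => ‖ζ i‖ ^ 2)
  have h2 : ∑ k ∈ Finset.range (m + 1), (∑ i, ‖ζ i‖ ^ 2) ^ k / (k.factorial : ℝ) ≤
      Real.exp (∑ i, ‖ζ i‖ ^ 2) := Real.sum_le_exp_of_nonneg (by positivity) _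
  rw [← h1] at h2
  refine le_trans ?_ (mul_le_mul_of_nonneg_left h2 (by positivity))
  rw [Finset.mul_sum]
  refine Finset.sum_le_sum (fun a _ => ?_)
  have h3 : ∏ i, ((a.1 i).factorial : ℝ) ≤ m.factorial := by
    have h4 : ∏ i, (a.1 i).factorial ≤ m.factorial :=
      (Nat.le_of_dvd (Nat.factorial_pos _) (Nat.prod_factorial_dvd_factorial_sum _ _)).trans
        (Nat.factorial_le a.2)
    exact_mod_cast h4
  have h5 : 0 < ∏ i, ((a.1 i).factorial : ℝ) := Finset.prod_pos fun i _ => by positivity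
  have h6 : ‖mono a.1 ζ‖ ^ 2 = ∏ i, (‖ζ i‖ ^ 2) ^ a.1 i := by
    rw [mono, norm_prod, ← Finset.prod_pow]
    refine Finset.prod_congr rfl (fun i _ => ?_)
    rw [norm_pow, ← pow_mul, ← pow_mul, mul_comm]
  rw [h6, mul_div_assoc', le_div_iff₀ h5, mul_comm]
  gcongr

theorem mono_sum {d m n : ℕ} (hmn : m ≤ n) (ζ : Fin d → ℂ) (x : MIdx d n → ℂ) (E : ℝ)
    (hE : ∑ a, ‖x a‖ ^ 2 ≤ E) :
    ‖∑ a : MIdx d m, x (midxIncl hmn a) * mono a.1 ζ‖ ≤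
      Real.sqrt E * Real.sqrt (m.factorial * Real.exp (∑ i, ‖ζ i‖ ^ 2)) := by
  have hinj : Function.Injective (midxIncl (d := d) hmn) := by
    intro a b hab
    have := congrArg Subtype.val hab
    exact Subtype.ext this
  have h0 : ∑ a : MIdx d m, ‖x (midxIncl hmn a)‖ ^ 2 ≤ ∑ a, ‖x a‖ ^ 2 := by
    classical
    rw [← Finset.sum_image (s := Finset.univ) (g := midxIncl hmn) (f := fun a => ‖x a‖ ^ 2)
      (fun a _ b _ h => hinj h)]
    exact Finset.sum_le_sum_of_subset_of_nonneg (Finset.subset_univ _)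
      (fun _ _ _ => by positivity)
  calc _ ≤ ∑ a : MIdx d m, ‖x (midxIncl hmn a)‖ * ‖mono a.1 ζ‖ := by
        refine (norm_sum_le _ _).trans (le_of_eq ?_)
        simp only [norm_mul]
    _ ≤ Real.sqrt (∑ a : MIdx d m, ‖x (midxIncl hmn a)‖ ^ 2) *
        Real.sqrt (∑ a : MIdx d m, ‖mono a.1 ζ‖ ^ 2) := Real.sum_mul_le_sqrt_mul_sqrt _ _ _
    _ ≤ _ := by
      gcongr
      · exact h0.trans hE
      · exact mono_sum_sq ζ

theorem hinner_le {r : ℕ} (z w : Fin r → ℂ) : ‖hinner z w‖ ≤ enorm' z * enorm' w := by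
  refine (norm_sum_le _ _).trans ?_
  simp only [norm_mul, RCLike.norm_conj]
  exact Real.sum_mul_le_sqrt_mul_sqrt _ _ _

theorem enorm_nonneg {r : ℕ} (z : Fin r → ℂ) : 0 ≤ enorm' z := Real.sqrt_nonneg _

theorem enorm_le_sum {r : ℕ} (z : Fin r → ℂ) : enorm' z ≤ ∑ j, ‖z j‖ := by
  refine Real.sqrt_le_iff.2 ⟨by positivity, ?_⟩
  exact Finset.sum_sq_le_sq_sum_of_nonneg (fun i _ => norm_nonneg _)

theorem enorm_cont {r : ℕ} : Continuous (enorm' (d := r)) := by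
  unfold enorm'
  fun_prop

theorem scal_bound (B Q : ℝ) (hB : 0 ≤ B) (hQ : 0 ≤ Q) (m : ℕ) :
    (B * Q) ^ m / m.factorial ≤ Real.exp (B ^ 2) * (Q ^ m / Real.sqrt (m - 1).factorial) := by
  have h1 : (B ^ 2) ^ m / m.factorial ≤ Real.exp (B ^ 2) :=
    Real.pow_div_factorial_le_exp _ (by positivity) m
  have hm : (0:ℝ) < m.factorial := by positivity
  have hm1 : (0:ℝ) < (m - 1).factorial := by positivity
  have hs := Real.mul_self_sqrt hm.le
  have hsp := Real.sqrt_pos.2 hm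
  have hsp1 := Real.sqrt_pos.2 hm1
  have hle : Real.sqrt (m - 1).factorial ≤ Real.sqrt m.factorial := by
    refine Real.sqrt_le_sqrt ?_
    exact_mod_cast Nat.factorial_le (Nat.sub_le m 1)
  have h2 : B ^ m / Real.sqrt m.factorial ≤ Real.exp (B ^ 2) := by
    have h3 : (B ^ m / Real.sqrt m.factorial) ^ 2 ≤ Real.exp (B ^ 2) ^ 2 := by
      calc _ = (B ^ 2) ^ m / m.factorial := by
            rw [div_pow, Real.sq_sqrt hm.le]; ring
        _ ≤ Real.exp (B ^ 2) := h1
        _ ≤ _ := by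
          have : 1 ≤ Real.exp (B ^ 2) := Real.one_le_exp (by positivity)
          nlinarith
    exact (sq_le_sq₀ (by positivity) (by positivity)).1 h3
  calc (B * Q) ^ m / m.factorial = (B ^ m / Real.sqrt m.factorial) *
        (Q ^ m / Real.sqrt m.factorial) := by
          rw [div_mul_div_comm, hs, mul_pow]
    _ ≤ _ := by gcongr


theorem Fm_diff {r : ℕ} (m : ℕ) (q : Fin r → ℂ) (j : Fin r) : Differentiable ℂ (Fm m q j) := by
  unfold Fm
  exact Differentiable.fun_sum (fun b _ => (uFn_differentiable q b.1).mul_const _)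

theorem dataMat_sum {d r N m n : ℕ} (hmn : m ≤ n) (q : Fin r → ℂ) (W : Fin N → Fin r → ℂ)
    (X : Matrix (Fin N) (MIdx d n) ℂ) (a : MIdx d m) (j : Fin r) (u : ℂ) :
    ∑ b : MIdx r m, u * (starRingEnd ℂ) (dataMat hmn q W X b a) *
        (starRingEnd ℂ) (pderivAt j (uFn q b.1) 0) =
      u * ∑ i, (starRingEnd ℂ) (X i (midxIncl hmn a)) * Fm m q j (W i) := by
  have h1 : ∀ b : MIdx r m, (starRingEnd ℂ) (dataMat hmn q W X b a) =
      ∑ i, uFn q b.1 (W i) * (starRingEnd ℂ) (X i (midxIncl hmn a)) := by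
    intro b
    simp [dataMat, sampMat, Matrix.mul_apply, map_sum]
  simp only [h1, Fm, Finset.mul_sum, Finset.sum_mul]
  rw [Finset.sum_comm]
  refine Finset.sum_congr rfl (fun i _ => Finset.sum_congr rfl (fun b _ => ?_))
  ring

theorem point (d r : ℕ) (p : Fin d → ℝ) (K₀ : Set (Fin d → ℂ))
    (hK₀c : IsCompact K₀) (hK₀a : AbsConvex K₀) (hK₀n : K₀ ∈ nhds (0 : Fin d → ℂ))
    (f : (Fin d → ℂ) → Fin r → ℂ)
    (Uo : Set (Fin d → ℂ)) (hUo : IsOpen Uo) (hKUo : transSet (cpx p) K₀ ⊆ Uo)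
    (hf : DifferentiableOn ℂ f Uo) (q : Fin r → ℂ) (L B B' Q R₁ Rμ S : ℝ) (hB0 : 0 ≤ B)
    (hB'0 : 0 ≤ B') (hQ : Q = enorm' q)
    (hL : ∀ ζ ∈ K₀, ‖hinner ζ (cpx p)‖ ≤ L)
    (hB : ∀ ζ ∈ K₀, enorm' (f (cpx p + ζ) - q) ≤ B)
    (hB' : ∀ ζ ∈ K₀, ∀ j, ‖f (cpx p + ζ) j‖ + ‖q j‖ ≤ B')
    (hR₁0 : 0 ≤ R₁) (hR₁ : R₁ < 1) (hRμ0 : 0 ≤ Rμ) (hRμ : Rμ < 1)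
    (m n N : ℕ) (hmn : m ≤ n) (hN : 0 < N) (z₀ : Fin N → Fin d → ℝ)
    (hz₀ : ∀ i, cpx (z₀ i) ∈ K₀) (hz₀g : ∀ i, gauge K₀ (cpx (z₀ i)) ≤ Rμ)
    (lam : ℝ) (hlam : 0 < lam)
    (hlow : ∀ x : MIdx d n → ℂ, lam * N * ∑ a, ‖x a‖ ^ 2 ≤
        ∑ i, ‖∑ a, x a * mono a.1 (cpx (z₀ i))‖ ^ 2)
    (X : Matrix (Fin N) (MIdx d n) ℂ)
    (hX : IsMoorePenrose (sampMat n (cpx p) (fun i => cpx p + cpx (z₀ i)))ᴴ X)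
    (j : Fin r) (ζ : Fin d → ℂ) (hζ : ζ ∈ K₀) (hζg : gauge K₀ ζ ≤ R₁)
    (hS : ∑ i, ‖ζ i‖ ^ 2 ≤ S) (M : ℝ)
    (hM : M = (B' + Real.exp (2 * (B * Q)) * B' * Real.exp (B * Q)) * Real.exp L) :
    ‖(∑ a : MIdx d m, ∑ b : MIdx r m, uFn (cpx p) a.1 (cpx p + ζ) *
        (starRingEnd ℂ) (dataMat hmn q (fun i => f (cpx p + cpx (z₀ i))) X b a) *
        (starRingEnd ℂ) (pderivAt j (uFn q b.1) 0)) - f (cpx p + ζ) j‖ ≤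
      Real.exp L * (M * R₁ ^ (m + 1) / (1 - R₁)) +
      kap p * Real.exp L * (Real.sqrt ((Real.exp (2 * L) * (M * Rμ ^ (n + 1) / (1 - Rμ))) ^ 2 / lam)
        * Real.sqrt (m.factorial * Real.exp S)) +
      Real.exp (2 * (B * Q)) * B' * ((B * Q) ^ m / m.factorial) := by
  have hQ0 : 0 ≤ Q := hQ ▸ enorm_nonneg q
  have hM0 : 0 ≤ M := by rw [hM]; positivity
  have h1R : 0 < 1 - R₁ := by linarith
  have h2R : 0 < 1 - Rμ := by linarith
  -- error of the truncated coordinate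
  have hFerr : ∀ ξ ∈ K₀, ‖Fm m q j (f (cpx p + ξ)) - f (cpx p + ξ) j‖ ≤
      Real.exp (2 * (B * Q)) * B' * ((B * Q) ^ m / m.factorial) := by
    intro ξ hξ
    have h1 : ‖hinner (f (cpx p + ξ) - q) q‖ ≤ B * Q := by
      refine (hinner_le _ _).trans ?_
      rw [← hQ]
      exact mul_le_mul_of_nonneg_right (hB ξ hξ) hQ0
    refine (Fm_err m q _ j).trans ?_
    have := hB' ξ hξ j
    gcongr
  have hexpn : ∀ ξ ∈ K₀, ‖Complex.exp (hinner ξ (cpx p))‖ ≤ Real.exp L := by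
    intro ξ hξ
    exact (Complex.norm_exp_le_exp_norm _).trans (Real.exp_le_exp.2 (hL ξ hξ))
  have hexpn' : ∀ ξ ∈ K₀, ‖Complex.exp (-hinner ξ (cpx p))‖ ≤ Real.exp L := by
    intro ξ hξ
    refine (Complex.norm_exp_le_exp_norm _).trans (Real.exp_le_exp.2 ?_)
    rw [norm_neg]
    exact hL ξ hξ
  set H : (Fin d → ℂ) → ℂ := fun ξ => Fm m q j (f (cpx p + ξ)) *
    Complex.exp (-hinner ξ (cpx p)) with hH
  have hHM : ∀ ξ ∈ K₀, ‖H ξ‖ ≤ M := by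
    intro ξ hξ
    rw [hH, hM]
    simp only [norm_mul]
    have h1 : ‖Fm m q j (f (cpx p + ξ))‖ ≤
        B' + Real.exp (2 * (B * Q)) * B' * Real.exp (B * Q) := by
      have h2 := hFerr ξ hξ
      have h3 : (B * Q) ^ m / m.factorial ≤ Real.exp (B * Q) :=
        Real.pow_div_factorial_le_exp _ (by positivity) m
      have h4 : ‖f (cpx p + ξ) j‖ ≤ B' := by
        linarith [hB' ξ hξ j, norm_nonneg (q j)]
      have h5 : ‖Fm m q j (f (cpx p + ξ))‖ ≤
          ‖f (cpx p + ξ) j‖ + ‖Fm m q j (f (cpx p + ξ)) - f (cpx p + ξ) j‖ := by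
        have := norm_add_le (f (cpx p + ξ) j) (Fm m q j (f (cpx p + ξ)) - f (cpx p + ξ) j)
        rwa [add_sub_cancel] at this
      have h6 : Real.exp (2 * (B * Q)) * B' * ((B * Q) ^ m / m.factorial) ≤
          Real.exp (2 * (B * Q)) * B' * Real.exp (B * Q) := by gcongr
      linarith
    have := hexpn' ξ hξ
    gcongr
  set Ω : Set (Fin d → ℂ) := (fun ξ => cpx p + ξ) ⁻¹' Uo with hΩdef
  have hΩ : IsOpen Ω := hUo.preimage (by fun_prop)
  have hKΩ : K₀ ⊆ Ω := fun ξ hξ => hKUo ⟨ξ, hξ, rfl⟩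
  have hHd : DifferentiableOn ℂ H Ω := by
    have h1 : DifferentiableOn ℂ (fun ξ => f (cpx p + ξ)) Ω :=
      hf.comp (by fun_prop) (fun ξ hξ => hξ)
    have h2 : DifferentiableOn ℂ (fun ξ => Fm m q j (f (cpx p + ξ))) Ω :=
      (Fm_diff m q j).comp_differentiableOn h1
    refine h2.mul ?_
    unfold hinner
    fun_prop
  obtain ⟨t, ht⟩ := taylor hK₀c hK₀a hK₀n hΩ hKΩ hHd M hHM
  obtain ⟨x, hx1, hx2⟩ := recon p z₀ hN X hX (fun i => Fm m q j (f (cpx p + cpx (z₀ i)))) t L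
    (M * Rμ ^ (n + 1) / (1 - Rμ)) lam (by positivity) hlam (fun i => hL _ (hz₀ i))
    (fun i => ht n Rμ hRμ _ (hz₀g i)) hlow
  have hk1 := kap_ge p
  have hk : (kap p : ℂ) ≠ 0 := by
    have : kap p ≠ 0 := by linarith
    exact_mod_cast this
  set E := Complex.exp (hinner ζ (cpx p)) with hE
  have hEE : E * Complex.exp (-hinner ζ (cpx p)) = 1 := by
    rw [hE, ← Complex.exp_add]; simp
  have hsplit : (∑ a : MIdx d m, ∑ b : MIdx r m, uFn (cpx p) a.1 (cpx p + ζ) *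
        (starRingEnd ℂ) (dataMat hmn q (fun i => f (cpx p + cpx (z₀ i))) X b a) *
        (starRingEnd ℂ) (pderivAt j (uFn q b.1) 0)) - f (cpx p + ζ) j =
      E * -(H ζ - ∑ a : MIdx d m, t a.1 * mono a.1 ζ) +
      (kap p : ℂ) * E * (∑ a : MIdx d m, x (midxIncl hmn a) * mono a.1 ζ) +
      (Fm m q j (f (cpx p + ζ)) - f (cpx p + ζ) j) := by
    have h1 : (∑ a : MIdx d m, ∑ b : MIdx r m, uFn (cpx p) a.1 (cpx p + ζ) *
        (starRingEnd ℂ) (dataMat hmn q (fun i => f (cpx p + cpx (z₀ i))) X b a) *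
        (starRingEnd ℂ) (pderivAt j (uFn q b.1) 0)) =
        E * (∑ a : MIdx d m, t a.1 * mono a.1 ζ) +
        (kap p : ℂ) * E * (∑ a : MIdx d m, x (midxIncl hmn a) * mono a.1 ζ) := by
      rw [Finset.mul_sum, Finset.mul_sum, ← Finset.sum_add_distrib]
      refine Finset.sum_congr rfl (fun a _ => ?_)
      rw [dataMat_sum, hx2, uFn_eq]
      have h2 : (sf a.1 : ℂ) ≠ 0 := by exact_mod_cast (sf_pos a.1).ne'
      simp only [midxIncl]
      rw [← hE]
      field_simp
    rw [h1]
    simp only [hH]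
    linear_combination (Fm m q j (f (cpx p + ζ))) * hEE
  rw [hsplit]
  have hkn : ‖(kap p : ℂ)‖ = kap p := by
    rw [Complex.norm_real, Real.norm_of_nonneg (by linarith)]
  have hEn : ‖E‖ ≤ Real.exp L := hexpn ζ hζ
  have hT := ht m R₁ hR₁ ζ hζg
  have hms := mono_sum hmn ζ x _ hx1
  refine (norm_add_le _ _).trans (add_le_add ((norm_add_le _ _).trans (add_le_add ?_ ?_))
    (hFerr ζ hζ))
  · rw [norm_mul, norm_neg]
    gcongr
  · rw [norm_mul, norm_mul, hkn]
    have hk0 : 0 ≤ kap p := by linarith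
    gcongr
    refine hms.trans ?_
    gcongr


/-- Theorem: reconstruction of the analytic map. -/
theorem statement1 (d r : ℕ) (p : Fin d → ℝ) (K₀ : Set (Fin d → ℂ))
    (hK₀c : IsCompact K₀) (hK₀a : AbsConvex K₀) (hK₀n : K₀ ∈ nhds (0 : Fin d → ℂ))
    (f : (Fin d → ℂ) → Fin r → ℂ)
    (Uo : Set (Fin d → ℂ)) (hUo : IsOpen Uo) (hKUo : transSet (cpx p) K₀ ⊆ Uo)
    (hf : DifferentiableOn ℂ f Uo)
    (μ : Measure (Fin d → ℝ)) [IsProbabilityMeasure μ]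
    (hμc : IsCompact (msupport μ)) (hμK : cpx '' msupport μ ⊆ interior K₀)
    (K₁ : Set (Fin d → ℂ)) (hK₁c : IsCompact K₁) (hK₁ : K₁ ⊆ interior K₀) :
    ∃ C : ℝ, 0 < C ∧
      ∀ (m n : ℕ), 1 ≤ m → ∀ hmn : m ≤ n, ∀ γ : ℝ, 0 < γ → γ < 1 →
      ∀ N : ℕ, 0 < N → ∀ z₀ : Fin N → Fin d → ℝ, (∀ i, z₀ i ∈ msupport μ) →
      IsUnit (momentMatrix d n μ).det →
      (∀ R : Matrix (MIdx d n) (MIdx d n) ℝ, R.PosSemidef →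
          R * R = (momentMatrix d n μ)⁻¹ →
          matOpNorm (1 - R * momentMatrix d n
              ((N : ℝ≥0∞)⁻¹ • ∑ i : Fin N, Measure.dirac (z₀ i)) * R) ≤ 1 - γ) →
      ∀ X : Matrix (Fin N) (MIdx d n) ℂ,
        IsMoorePenrose (sampMat n (cpx p) (fun i => cpx p + cpx (z₀ i)))ᴴ X →
        sSup ((fun z => enorm' (fun j =>
            (∑ a : MIdx d m, ∑ b : MIdx r m,
              uFn (cpx p) a.1 z *
                (starRingEnd ℂ)
                  (dataMat hmn (f (cpx p)) (fun i => f (cpx p + cpx (z₀ i))) X b a) *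
                (starRingEnd ℂ) (pderivAt j (uFn (f (cpx p)) b.1) 0)) - f z j)) ''
            transSet (cpx p) K₁) ≤
          C * (enorm' (f (cpx p)) ^ m / Real.sqrt (m - 1).factorial +
            Real.sqrt (m.factorial / γ) *
              (sSup ((fun x => gauge K₀ (cpx x)) '' msupport μ)) ^ n /
              Real.sqrt (minEig (momentMatrix d n μ)) +
            (sSup (gauge K₀ '' K₁)) ^ m) := by
  have hcK : ∀ g : (Fin d → ℂ) → ℝ, ContinuousOn g K₀ → ∃ C : ℝ, 0 ≤ C ∧ ∀ ζ ∈ K₀, g ζ ≤ C := by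
    intro g hg
    obtain ⟨C, hC⟩ := hK₀c.exists_bound_of_continuousOn hg
    refine ⟨max C 0, le_max_right _ _, fun ζ hζ => ?_⟩
    exact (le_abs_self _).trans ((hC ζ hζ).trans (le_max_left _ _))
  set q := f (cpx p) with hq
  set Q := enorm' q with hQ
  have hfc : ContinuousOn (fun ζ => f (cpx p + ζ)) K₀ :=
    hf.continuousOn.comp (by fun_prop) (fun ζ hζ => hKUo ⟨ζ, hζ, rfl⟩)
  obtain ⟨L, hL0, hL⟩ := hcK (fun ζ => ‖hinner ζ (cpx p)‖) (by unfold hinner; fun_prop)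
  obtain ⟨B, hB0, hB⟩ := hcK (fun ζ => enorm' (f (cpx p + ζ) - q))
    (enorm_cont.comp_continuousOn (hfc.sub continuousOn_const))
  obtain ⟨B', hB'0, hB'⟩ := hcK (fun ζ => ‖f (cpx p + ζ)‖ + ‖q‖)
    (hfc.norm.add continuousOn_const)
  obtain ⟨S, hS0, hS⟩ := hcK (fun ζ => ∑ i, ‖ζ i‖ ^ 2) (by fun_prop)
  have hB'' : ∀ ζ ∈ K₀, ∀ j, ‖f (cpx p + ζ) j‖ + ‖q j‖ ≤ B' := fun ζ hζ j =>
    (add_le_add (norm_le_pi_norm _ j) (norm_le_pi_norm _ j)).trans (hB' ζ hζ)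
  obtain ⟨hR₁0, hR₁, hR₁g⟩ := sup_gauge hK₀a hK₀n K₁ hK₁c hK₁
  have hcpx : Continuous (cpx (d := d)) := by unfold cpx; fun_prop
  obtain ⟨hRμ0, hRμ, hRμg⟩ := sup_gauge hK₀a hK₀n (cpx '' msupport μ) (hμc.image hcpx) hμK
  rw [Set.image_image] at hRμ0 hRμ hRμg
  set R₁ := sSup (gauge K₀ '' K₁)
  set Rμ := sSup ((fun x => gauge K₀ (cpx x)) '' msupport μ)
  have hQ0 : 0 ≤ Q := enorm_nonneg q
  have h1R : 0 < 1 - R₁ := by linarith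
  have h2R : 0 < 1 - Rμ := by linarith
  have hk1 := kap_ge p
  obtain ⟨M, hM⟩ : ∃ M : ℝ,
    M = (B' + Real.exp (2 * (B * Q)) * B' * Real.exp (B * Q)) * Real.exp L := ⟨_, rfl⟩
  have hM0 : 0 ≤ M := by rw [hM]; positivity
  set c₁ := Real.exp L * (M / (1 - R₁)) with hc₁
  set c₂ := kap p * Real.exp L * (Real.exp (2 * L) * (M / (1 - Rμ))) * Real.sqrt (Real.exp S)
    with hc₂
  set c₃ := Real.exp (2 * (B * Q)) * B' * Real.exp (B ^ 2) with hc₃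
  have hc₁0 : 0 ≤ c₁ := by positivity
  have hc₂0 : 0 ≤ c₂ := by
    have : 0 ≤ kap p := by linarith
    positivity
  have hc₃0 : 0 ≤ c₃ := by positivity
  refine ⟨r * (c₁ + c₂ + c₃) + 1, by positivity, ?_⟩
  intro m n hm hmn γ hγ hγ1 N hN z₀ hz₀ hdet hD X hX
  obtain ⟨hΛ, hlow⟩ := sample_lower μ hμc γ hγ hN z₀ hdet hD
  set Λ := minEig (momentMatrix d n μ)
  set A := Q ^ m / Real.sqrt (m - 1).factorial with hA
  set D := Real.sqrt (m.factorial / γ) * Rμ ^ n / Real.sqrt Λ with hDdef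
  have hA0 : 0 ≤ A := by positivity
  have hD0 : 0 ≤ D := by positivity
  have hP0 : 0 ≤ R₁ ^ m := by positivity
  have hlam : 0 < γ * Λ := by positivity
  refine Real.sSup_le ?_ (by positivity)
  rintro _ ⟨_, ⟨ζ, hζ, rfl⟩, rfl⟩
  have hζK : ζ ∈ K₀ := interior_subset (hK₁ hζ)
  have hj : ∀ j : Fin r, ‖(∑ a : MIdx d m, ∑ b : MIdx r m, uFn (cpx p) a.1 (cpx p + ζ) *
        (starRingEnd ℂ) (dataMat hmn q (fun i => f (cpx p + cpx (z₀ i))) X b a) *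
        (starRingEnd ℂ) (pderivAt j (uFn q b.1) 0)) - f (cpx p + ζ) j‖ ≤
      (c₁ + c₂ + c₃) * (A + D + R₁ ^ m) := by
    intro j
    have h := point d r p K₀ hK₀c hK₀a hK₀n f Uo hUo hKUo hf q L B B' Q R₁ Rμ S hB0 hB'0 hQ
      hL hB hB'' hR₁0 hR₁ hRμ0 hRμ m n N hmn hN z₀
      (fun i => interior_subset (hμK ⟨_, hz₀ i, rfl⟩)) (fun i => hRμg _ ⟨_, hz₀ i, rfl⟩)
      (γ * Λ) hlam hlow X hX j ζ hζK (hR₁g ζ hζ) (hS ζ hζK) M hM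
    refine h.trans ?_
    have e1 : Real.exp L * (M * R₁ ^ (m + 1) / (1 - R₁)) ≤ c₁ * R₁ ^ m := by
      calc _ = c₁ * R₁ ^ m * R₁ := by rw [hc₁]; ring
        _ ≤ c₁ * R₁ ^ m * 1 := by gcongr
        _ = _ := mul_one _
    have e2 : kap p * Real.exp L *
        (Real.sqrt ((Real.exp (2 * L) * (M * Rμ ^ (n + 1) / (1 - Rμ))) ^ 2 / (γ * Λ))
        * Real.sqrt (m.factorial * Real.exp S)) ≤ c₂ * D := by
      rw [Real.sqrt_div (by positivity), Real.sqrt_sq (by positivity), Real.sqrt_mul hγ.le,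
        Real.sqrt_mul (by positivity)]
      rw [hDdef, Real.sqrt_div (by positivity), hc₂]
      calc _ = kap p * Real.exp L * (Real.exp (2 * L) * (M / (1 - Rμ))) *
            Real.sqrt (Real.exp S) *
            (Real.sqrt m.factorial / Real.sqrt γ * Rμ ^ n / Real.sqrt Λ) * Rμ := by ring
        _ ≤ kap p * Real.exp L * (Real.exp (2 * L) * (M / (1 - Rμ))) *
            Real.sqrt (Real.exp S) *
            (Real.sqrt m.factorial / Real.sqrt γ * Rμ ^ n / Real.sqrt Λ) * 1 := by
              have : 0 ≤ kap p := by linarith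
              gcongr
        _ = _ := mul_one _
    have e3 : Real.exp (2 * (B * Q)) * B' * ((B * Q) ^ m / m.factorial) ≤ c₃ * A := by
      rw [hc₃, mul_assoc _ (Real.exp (B ^ 2))]
      exact mul_le_mul_of_nonneg_left (scal_bound B Q hB0 hQ0 m) (by positivity)
    have e4 : c₁ * R₁ ^ m + c₂ * D + c₃ * A ≤ (c₁ + c₂ + c₃) * (A + D + R₁ ^ m) := by
      have := mul_nonneg hc₁0 hA0
      have := mul_nonneg hc₁0 hD0
      have := mul_nonneg hc₂0 hA0
      have := mul_nonneg hc₂0 hP0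
      have := mul_nonneg hc₃0 hD0
      have := mul_nonneg hc₃0 hP0
      nlinarith
    linarith
  refine (enorm_le_sum _).trans ((Finset.sum_le_sum (fun j _ => hj j)).trans ?_)
  rw [Finset.sum_const, Finset.card_univ, Fintype.card_fin, nsmul_eq_mul]
  have : 0 ≤ A + D + R₁ ^ m := by positivity
  nlinarith

end PFA
end
end

section
/- Let p ∈ ℂ^d and let f be holomorphic on an open neighbourhood of p with values in ℂ^d, with f(p) = p. For n ∈ ℤ_{≥0} let C_n ∈ ℂ^{r_n^E × r_n^E} be the unique matrix satisfying ν_{p,α^{(i)}}(h∘f) = Σ_{j=1}^{r_n^E} (C_n)_{j,i}·ν_{p,α^{(j)}}(h) for every polynomial h : ℂ^d → ℂ and every i = 1,…,r_n^E (such a matrix exists and is unique). Then the set of eigenvalues of C_n equals {λ_1^{α_1}·…·λ_d^{α_d} : α = (α_1,…,α_d) ∈ ℤ_{≥0}^d, |α| ≤ n}, where λ_1,…,λ_d are the eigenvalues of the Jacobian matrix of f at p. -/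
open MeasureTheory Complex Filter Matrix
open scoped BigOperators ENNReal Topology

noncomputable section

namespace PFA

theorem hol_fderiv {d : ℕ} {U : Set (Fin d → ℂ)} (hU : IsOpen U) {g : (Fin d → ℂ) → ℂ}
    (hg : DifferentiableOn ℂ g U) (v : Fin d → ℂ) :
    DifferentiableOn ℂ (fun z => fderiv ℂ g z v) U := by
  intro z0 hz0
  apply DifferentiableAt.differentiableWithinAt
  have hgc : ContinuousAt g z0 := (hg.differentiableAt (hU.mem_nhds hz0)).continuousAt
  obtain ⟨δ, hδ, hδU⟩ : ∃ δ > 0, Metric.ball z0 δ ⊆ U ∩ g ⁻¹' Metric.ball (g z0) 1 :=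
    Metric.mem_nhds_iff.1 (Filter.inter_mem (hU.mem_nhds hz0)
      (hgc (Metric.ball_mem_nhds _ one_pos)))
  set ε := δ / 3 with hε
  have hεp : 0 < ε := by positivity
  have hδε : δ = 3 * ε := by rw [hε]; ring
  set r := ε / (‖v‖ + 1) with hr
  have hrp : 0 < r := by positivity
  have hrv : r * ‖v‖ ≤ ε := by
    rw [hr, div_mul_eq_mul_div, div_le_iff₀ (by positivity)]
    nlinarith [norm_nonneg v]
  have hin : ∀ z ∈ Metric.ball z0 ε, ∀ ζ : ℂ, ‖ζ‖ ≤ r → z + ζ • v ∈ Metric.ball z0 (2 * ε) := by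
    intro z hz ζ hζ
    rw [Metric.mem_ball, dist_eq_norm] at hz ⊢
    calc ‖z + ζ • v - z0‖ = ‖(z - z0) + ζ • v‖ := by congr 1; abel
      _ ≤ ‖z - z0‖ + ‖ζ • v‖ := norm_add_le _ _
      _ < ε + ε := by
        apply add_lt_add_of_lt_of_le hz
        rw [norm_smul]
        exact (mul_le_mul_of_nonneg_right hζ (norm_nonneg _)).trans hrv
      _ = 2 * ε := by ring
  have hsub2 : Metric.ball z0 (2 * ε) ⊆ U := fun z hz =>
    (hδU (Metric.ball_subset_ball (by linarith) hz)).1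
  have hbd : ∀ z ∈ Metric.ball z0 (2 * ε), ‖fderiv ℂ g z‖ ≤ 2 / ε := by
    intro z hz
    have hs : Metric.ball z ε ⊆ Metric.ball z0 δ :=
      Metric.ball_subset_ball' (by rw [Metric.mem_ball] at hz; linarith)
    apply norm_fderiv_le_div_of_mapsTo_ball (hg.mono fun w hw => (hδU (hs hw)).1) _ hεp
    intro w hw
    have h1 := (hδU (hs hw)).2
    have h2 := (hδU (hs (Metric.mem_ball_self hεp))).2
    simp only [Set.mem_preimage, Metric.mem_ball] at h1 h2 ⊢
    have := dist_triangle_right (g w) (g z) (g z0)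
    apply Metric.ball_subset_closedBall
    rw [Metric.mem_ball]
    linarith
  set s : ℝ → ℂ := fun θ => deriv (circleMap 0 r) θ * (1 / (circleMap 0 r θ) ^ 2) with hs
  have hcm : Continuous (circleMap 0 r) := continuous_circleMap 0 r
  have hcm0 : ∀ θ, circleMap 0 r θ ≠ 0 := fun θ => circleMap_ne_center hrp.ne'
  have hcmn : ∀ θ, ‖circleMap 0 r θ‖ ≤ r := fun θ => by simp [abs_of_pos hrp]
  have hsc : Continuous s := by
    have : s = fun θ => circleMap 0 r θ * I * (1 / (circleMap 0 r θ) ^ 2) := by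
      ext θ; simp [hs]
    rw [this]
    exact (hcm.mul continuous_const).mul
      (continuous_const.div (hcm.pow 2) fun θ => pow_ne_zero 2 (hcm0 θ))
  have hFc : ∀ z ∈ Metric.ball z0 ε, Continuous fun θ : ℝ => s θ * g (z + circleMap 0 r θ • v) := by
    intro z hz
    refine hsc.mul (hg.continuousOn.comp_continuous ?_ fun θ => hsub2 (hin z hz _ (hcmn θ)))
    exact continuous_const.add (hcm.smul continuous_const)
  have hz0b : z0 ∈ Metric.ball z0 ε := Metric.mem_ball_self hεp
  have key := intervalIntegral.hasFDerivAt_integral_of_dominated_of_fderiv_le (𝕜 := ℂ) (μ := volume)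
    (a := 0) (b := 2 * Real.pi) (x₀ := z0) (s := Metric.ball z0 ε)
    (F := fun z θ => s θ * g (z + circleMap 0 r θ • v))
    (F' := fun z θ => s θ • fderiv ℂ g (z + circleMap 0 r θ • v))
    (bound := fun θ => ‖s θ‖ * (2 / ε)) (Metric.ball_mem_nhds _ hεp)
    (by
      filter_upwards [Metric.ball_mem_nhds _ hεp] with z hz
      exact (hFc z hz).aestronglyMeasurable)
    ((hFc z0 hz0b).intervalIntegrable _ _)
    (by
      apply AEStronglyMeasurable.smul hsc.aestronglyMeasurable
      apply StronglyMeasurable.aestronglyMeasurable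
      apply Measurable.stronglyMeasurable
      exact (measurable_fderiv ℂ g).comp
        (continuous_const.add (hcm.smul continuous_const)).measurable)
    (by
      refine Eventually.of_forall fun θ _ z hz => ?_
      rw [norm_smul]
      exact mul_le_mul_of_nonneg_left (hbd _ (hin z hz _ (hcmn θ))) (norm_nonneg _))
    ((hsc.norm.mul continuous_const).intervalIntegrable _ _)
    (by
      refine Eventually.of_forall fun θ _ z hz => ?_
      have h1 : HasFDerivAt g (fderiv ℂ g (z + circleMap 0 r θ • v)) (z + circleMap 0 r θ • v) :=
        (hg.differentiableAt (hU.mem_nhds (hsub2 (hin z hz _ (hcmn θ))))).hasFDerivAt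
      exact ((hasFDerivAt_comp_add_right _).2 h1).const_mul (s θ))
  have hform : ∀ z ∈ Metric.ball z0 ε, (2 * Real.pi * I) * fderiv ℂ g z v =
      ∫ θ in (0)..(2 * Real.pi), s θ * g (z + circleMap 0 r θ • v) := by
    intro z hz
    have hz' : HasFDerivAt g (fderiv ℂ g z) z :=
      (hg.differentiableAt (hU.mem_nhds (hsub2 (Metric.ball_subset_ball (by linarith) hz)))).hasFDerivAt
    have h1 : DifferentiableOn ℂ (fun ζ : ℂ => g (z + ζ • v)) (Metric.closedBall 0 r) := by
      refine hg.comp (by fun_prop) fun ζ hζ => hsub2 (hin z hz ζ ?_)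
      simpa using hζ
    have h2 := DifferentiableOn.deriv_eq_smul_circleIntegral hrp h1
    have h3 : deriv (fun ζ : ℂ => g (z + ζ • v)) 0 = fderiv ℂ g z v := by
      have := (hz'.hasLineDerivAt v).lineDeriv
      rw [← this]; rfl
    rw [h3] at h2
    rw [smul_eq_mul] at h2
    rw [← h2, circleIntegral]
    congr 1
    ext θ
    simp [hs, mul_assoc]
  have h4 : DifferentiableAt ℂ (fun z => (2 * Real.pi * I) * fderiv ℂ g z v) z0 := by
    refine key.differentiableAt.congr_of_eventuallyEq ?_
    filter_upwards [Metric.ball_mem_nhds _ hεp] with z hz using hform z hz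
  have h5 := h4.const_mul (2 * Real.pi * I)⁻¹
  refine h5.congr_of_eventuallyEq (Eventually.of_forall fun z => ?_)
  have : (2 * Real.pi * I : ℂ) ≠ 0 := Complex.two_pi_I_ne_zero
  simp only
  rw [inv_mul_cancel_left₀ this]

theorem hol_fderiv_comm {d : ℕ} {U : Set (Fin d → ℂ)} (hU : IsOpen U) {g : (Fin d → ℂ) → ℂ}
    (hg : DifferentiableOn ℂ g U) (v w : Fin d → ℂ) {z : Fin d → ℂ} (hz : z ∈ U) :
    fderiv ℂ (fun z => fderiv ℂ g z v) z w = fderiv ℂ (fun z => fderiv ℂ g z w) z v := by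
  have hd : DifferentiableAt ℂ (fderiv ℂ g) z := by
    have : fderiv ℂ g = fun z => ∑ k, fderiv ℂ g z (Pi.single k 1) •
        (ContinuousLinearMap.proj k : (Fin d → ℂ) →L[ℂ] ℂ) := by
      ext z x
      have h := (fderiv ℂ g z).toLinearMap.pi_apply_eq_sum_univ x
      simp only [ContinuousLinearMap.coe_coe] at h
      rw [h]
      simp only [FunLike.coe_sum, Finset.sum_apply, _root_.smul_apply,
        ContinuousLinearMap.proj_apply, smul_eq_mul]
      refine Finset.sum_congr rfl fun k _ => ?_
      rw [mul_comm]
      congr 2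
      ext j
      simp [Pi.single_apply, eq_comm]
    rw [this]
    refine DifferentiableAt.fun_sum fun k _ => ?_
    exact ((hol_fderiv hU hg _).differentiableAt (hU.mem_nhds hz)).smul_const _
  have h1 := second_derivative_symmetric_of_eventually (𝕜 := ℂ) (f := g) (f' := fderiv ℂ g) (x := z)
    (f'' := fderiv ℂ (fderiv ℂ g) z) (by
      filter_upwards [hU.mem_nhds hz] with y hy
      exact (hg.differentiableAt (hU.mem_nhds hy)).hasFDerivAt) hd.hasFDerivAt v w
  have h2 : ∀ u, fderiv ℂ (fun z => fderiv ℂ g z u) z = (fderiv ℂ (fderiv ℂ g) z).flip u := by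
    intro u
    exact (hd.hasFDerivAt.clm_apply (hasFDerivAt_const u z)).fderiv.trans (by ext; simp)
  rw [h2, h2]
  simpa using h1.symm


theorem exists_triang_basis (d : ℕ) : ∀ {V : Type} [AddCommGroup V] [Module ℂ V]
    [FiniteDimensional ℂ V] (_ : Module.finrank ℂ V = d) (f : V →ₗ[ℂ] V),
    ∃ b : Module.Basis (Fin d) ℂ V, ∀ i j, j < i → b.repr (f (b i)) j = 0 := by
  induction d with
  | zero =>
    intro V _ _ _ h f
    exact ⟨Module.finBasisOfFinrankEq ℂ V h, fun i => i.elim0⟩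
  | succ d ih =>
    intro V _ _ _ h f
    have : Nontrivial V := Module.nontrivial_of_finrank_pos (R := ℂ) (by omega)
    have : Nontrivial (Module.Dual ℂ V) := inferInstance
    obtain ⟨c, hc⟩ := Module.End.exists_eigenvalue (K := ℂ) (V := Module.Dual ℂ V)
      (LinearMap.dualMap f)
    obtain ⟨φ, hφ⟩ := hc.exists_hasEigenvector
    have hφ0 : φ ≠ 0 := hφ.2
    have hφf : ∀ x, φ (f x) = c * φ x := by
      intro x
      have := congrArg (fun ψ : Module.Dual ℂ V => ψ x) hφ.apply_eq_smul
      simpa using this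
    have hrk := Module.Dual.finrank_ker_add_one_of_ne_zero hφ0
    have hinv : ∀ x ∈ LinearMap.ker φ, f x ∈ LinearMap.ker φ := by
      intro x hx
      rw [LinearMap.mem_ker] at hx ⊢
      rw [hφf, hx, mul_zero]
    obtain ⟨b, hb⟩ := ih (V := LinearMap.ker φ) (by omega) (f.restrict hinv)
    obtain ⟨y, hy⟩ : ∃ y, φ y ≠ 0 := by
      by_contra hcon
      push Not at hcon
      exact hφ0 (LinearMap.ext hcon)
    let B : Module.Basis (Fin (d + 1)) ℂ V := Module.Basis.mkFinCons y b (by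
        intro c x hx h
        have := congrArg φ h
        rw [LinearMap.mem_ker] at hx
        simp [hx, hy] at this
        exact this) (by
        intro z
        refine ⟨-(φ z / φ y), ?_⟩
        simp [hy])
    have hB : (B : Fin (d + 1) → V) = Fin.cons y ((↑) ∘ b) := Module.Basis.coe_mkFinCons _ _ _ _
    have hrep : ∀ x : LinearMap.ker φ, (B.repr (x : V)) = ∑ k, b.repr x k • Finsupp.single k.succ 1 := by
      intro x
      conv_lhs => rw [← b.sum_repr x]
      simp only [Submodule.coe_sum, Submodule.coe_smul, map_sum, map_smul]
      refine Finset.sum_congr rfl fun k _ => ?_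
      congr 1
      have : (b k : V) = B k.succ := by rw [hB]; simp
      rw [this, Module.Basis.repr_self]
    refine ⟨B, fun i j hij => ?_⟩
    obtain ⟨i, rfl⟩ := Fin.exists_succ_eq.2 (Fin.ne_zero_of_lt hij)
    have h1 : f (B i.succ) = ((f.restrict hinv) (b i) : LinearMap.ker φ) := by
      rw [hB]; simp
    rw [h1, hrep]
    simp only [Finsupp.coe_finsetSum, Finset.sum_apply, Finsupp.smul_apply, smul_eq_mul]
    refine Finset.sum_eq_zero fun k _ => ?_
    by_cases hk : k.succ = j
    · subst hk
      rw [hb i k (by simpa using hij), zero_mul]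
    · rw [Finsupp.single_eq_of_ne (Ne.symm hk), mul_zero]

theorem exists_perm_of_map_eq {d : ℕ} (m l : Fin d → ℂ)
    (h : (Finset.univ.val.map m : Multiset ℂ) = Finset.univ.val.map l) :
    ∃ σ : Equiv.Perm (Fin d), ∀ i, m i = l (σ i) := by
  classical
  have hc : ∀ c, Nonempty ({i // m i = c} ≃ {i // l i = c}) := by
    intro c
    rw [← Fintype.card_eq, Fintype.card_subtype, Fintype.card_subtype]
    have := congrArg (Multiset.count c) h
    rw [Multiset.count_map, Multiset.count_map] at this
    simp only [eq_comm (a := c)] at this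
    exact this
  let e : Fin d ≃ Fin d := (Equiv.sigmaFiberEquiv m).symm.trans
    ((Equiv.sigmaCongrRight fun c => (hc c).some).trans (Equiv.sigmaFiberEquiv l))
  refine ⟨e, fun i => ?_⟩
  exact (((hc (m i)).some ⟨i, rfl⟩).2).symm

theorem exists_triang {d : ℕ} (J : Matrix (Fin d) (Fin d) ℂ) (l : Fin d → ℂ)
    (hl : J.charpoly = ∏ i, (Polynomial.X - Polynomial.C (l i))) :
    ∃ V W : Matrix (Fin d) (Fin d) ℂ, W * V = 1 ∧ V * W = 1 ∧
      (∀ i j, j < i → (W * J * V) j i = 0) ∧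
      ∃ σ : Equiv.Perm (Fin d), ∀ i, (W * J * V) i i = l (σ i) := by
  obtain ⟨b, hb⟩ := exists_triang_basis d (V := Fin d → ℂ) (by simp) (Matrix.toLin' J)
  set e := Pi.basisFun ℂ (Fin d)
  have hVW : e.toMatrix b * b.toMatrix e = 1 := Module.Basis.toMatrix_mul_toMatrix_flip _ _
  have hWV : b.toMatrix e * e.toMatrix b = 1 := Module.Basis.toMatrix_mul_toMatrix_flip _ _
  have hT : b.toMatrix e * J * e.toMatrix b = LinearMap.toMatrix b b (Matrix.toLin' J) := by
    have := basis_toMatrix_mul_linearMap_toMatrix_mul_basis_toMatrix b e b e (Matrix.toLin' J)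
    rw [← this]
    congr 2
    exact (LinearMap.toMatrix'_toLin' J).symm
  refine ⟨e.toMatrix b, b.toMatrix e, hWV, hVW, ?_, ?_⟩
  · intro i j hij
    rw [hT, LinearMap.toMatrix_apply]
    exact hb i j hij
  · set T := LinearMap.toMatrix b b (Matrix.toLin' J) with hTdef
    have hlow : Tᵀ.IsUpperTriangular := by
      intro i j hij
      rw [Matrix.transpose_apply, hTdef, LinearMap.toMatrix_apply]
      exact hb _ _ hij
    have hcp : T.charpoly = J.charpoly := by
      rw [hTdef, LinearMap.charpoly_toMatrix, Matrix.charpoly_toLin']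
    rw [← Matrix.charpoly_transpose, Matrix.charpoly_of_isUpperTriangular _ hlow, hl] at hcp
    have hroots := congrArg Polynomial.roots hcp
    have hr : ∀ m : Fin d → ℂ, (∏ i, (Polynomial.X - Polynomial.C (m i))).roots =
        Finset.univ.val.map m := by
      intro m
      rw [← Polynomial.roots_multiset_prod_X_sub_C (Finset.univ.val.map m), Multiset.map_map]
      rfl
    rw [hr, hr] at hroots
    obtain ⟨σ, hσ⟩ := exists_perm_of_map_eq _ _ hroots
    refine ⟨σ, fun i => ?_⟩
    rw [hT, ← hσ i, Matrix.transpose_apply]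

section core

variable {d : ℕ} {A : Type*} [CommRing A] [Algebra ℂ A]

/-- iterated derivative along a word of derivations -/
def Dw (D : Fin d → Derivation ℂ A A) : List (Fin d) → A →ₗ[ℂ] A
  | [] => LinearMap.id
  | i :: u => (Dw D u).comp (D i : A →ₗ[ℂ] A)

@[simp] theorem Dw_nil (D : Fin d → Derivation ℂ A A) (g : A) : Dw D [] g = g := rfl
@[simp] theorem Dw_cons (D : Fin d → Derivation ℂ A A) (i : Fin d) (u : List (Fin d)) (g : A) :
    Dw D (i :: u) g = Dw D u (D i g) := rfl

theorem Dw_perm (D : Fin d → Derivation ℂ A A) (hD : ∀ i j g, D i (D j g) = D j (D i g))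
    {u u' : List (Fin d)} (h : u.Perm u') : ∀ g, Dw D u g = Dw D u' g := by
  induction h with
  | nil => intro g; rfl
  | cons x _ ih => intro g; simp [ih]
  | swap x y l => intro g; simp [hD x y]
  | trans _ _ ih1 ih2 => intro g; rw [ih1, ih2]

/-- weight of a word -/
def wtL (w : Fin d → ℤ) (u : List (Fin d)) : ℤ := (u.map w).sum

@[simp] theorem wtL_nil (w : Fin d → ℤ) : wtL w [] = 0 := rfl
@[simp] theorem wtL_cons (w : Fin d → ℤ) (i : Fin d) (u : List (Fin d)) :
    wtL w (i :: u) = w i + wtL w u := by simp [wtL]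

theorem wtL_nonneg (w : Fin d → ℤ) (hw : ∀ i, 0 < w i) (u : List (Fin d)) : 0 ≤ wtL w u := by
  induction u with
  | nil => simp
  | cons i u ih => have := hw i; simp; omega

/-- weighted filtration -/
def Filt (ev : A →ₐ[ℂ] ℂ) (D : Fin d → Derivation ℂ A A) (w : Fin d → ℤ) (k : ℤ) (g : A) : Prop :=
  ∀ u : List (Fin d), wtL w u < k → ev (Dw D u g) = 0

variable {ev : A →ₐ[ℂ] ℂ} {D : Fin d → Derivation ℂ A A} {w : Fin d → ℤ}

theorem Filt.add {k : ℤ} {g h : A} (hg : Filt ev D w k g) (hh : Filt ev D w k h) :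
    Filt ev D w k (g + h) := fun u hu => by rw [map_add, map_add, hg u hu, hh u hu, add_zero]

theorem Filt.smul {k : ℤ} {g : A} (c : ℂ) (hg : Filt ev D w k g) :
    Filt ev D w k (c • g) := fun u hu => by rw [map_smul, map_smul, hg u hu, smul_zero]

theorem Filt.mul_aux (u : List (Fin d)) : ∀ (j k : ℤ) (g h : A), Filt ev D w j g →
    Filt ev D w k h → wtL w u < j + k → ev (Dw D u (g * h)) = 0 := by
  induction u with
  | nil =>
    intro j k g h hg hh hu
    simp only [wtL_nil] at hu
    simp only [Dw_nil, map_mul]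
    by_cases hj : 0 < j
    · have := hg [] (by simpa using hj)
      simp only [Dw_nil] at this
      rw [this, zero_mul]
    · have := hh [] (by simp; omega)
      simp only [Dw_nil] at this
      rw [this, mul_zero]
  | cons i u ih =>
    intro j k g h hg hh hu
    simp only [wtL_cons] at hu
    rw [Dw_cons, Derivation.leibniz, map_add, map_add, smul_eq_mul, smul_eq_mul]
    rw [ih j (k - w i) g (D i h) hg, ih k (j - w i) h (D i g) hh, add_zero]
    · intro u' hu'
      exact hg (i :: u') (by rw [wtL_cons]; omega)
    · omega
    · intro u' hu'
      exact hh (i :: u') (by rw [wtL_cons]; omega)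
    · omega

theorem Filt.mul {j k : ℤ} {g h : A} (hg : Filt ev D w j g) (hh : Filt ev D w k h) :
    Filt ev D w (j + k) (g * h) := fun u hu => Filt.mul_aux u j k g h hg hh hu

/-- congruence modulo higher weight -/
def FRel (ev : A →ₐ[ℂ] ℂ) (D : Fin d → Derivation ℂ A A) (w : Fin d → ℤ) (k : ℤ) (g g' : A) :
    Prop := Filt ev D w k g ∧ Filt ev D w k g' ∧ Filt ev D w (k + 1) (g - g')

theorem FRel.mul {j k : ℤ} {g g' h h' : A} (hg : FRel ev D w j g g') (hh : FRel ev D w k h h') :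
    FRel ev D w (j + k) (g * h) (g' * h') := by
  refine ⟨hg.1.mul hh.1, hg.2.1.mul hh.2.1, ?_⟩
  have h1 := hg.1.mul hh.2.2
  have h2 := hg.2.2.mul hh.2.1
  have e1 : j + (k + 1) = j + k + 1 := by ring
  have e2 : j + 1 + k = j + k + 1 := by ring
  rw [e1] at h1
  rw [e2] at h2
  have := h1.add h2
  convert this using 1
  ring

theorem FRel.one (hw : ∀ i, 0 < w i) : FRel ev D w 0 1 1 := by
  have : ∀ u, ¬ (wtL w u < 0) := fun u => not_lt.2 (wtL_nonneg w hw u)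
  refine ⟨fun u hu => (this u hu).elim, fun u hu => (this u hu).elim, ?_⟩
  intro u _
  simp

theorem FRel.pow (hw : ∀ i, 0 < w i) {k : ℤ} {g g' : A} (hg : FRel ev D w k g g') (m : ℕ) :
    FRel ev D w (m * k) (g ^ m) (g' ^ m) := by
  induction m with
  | zero => simpa using FRel.one hw
  | succ m ih =>
    have := ih.mul hg
    rw [pow_succ, pow_succ]
    convert this using 1
    push_cast; ring

theorem FRel.prod (hw : ∀ i, 0 < w i) (s : Finset (Fin d)) {k : Fin d → ℤ} {g g' : Fin d → A}
    (hg : ∀ i, FRel ev D w (k i) (g i) (g' i)) :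
    FRel ev D w (∑ i ∈ s, k i) (∏ i ∈ s, g i) (∏ i ∈ s, g' i) := by
  classical
  induction s using Finset.induction_on with
  | empty => simpa using FRel.one hw
  | insert a s ha ih =>
    rw [Finset.sum_insert ha, Finset.prod_insert ha, Finset.prod_insert ha]
    exact (hg a).mul ih

/-- canonical word of a multi-index -/
def wd (β : Fin d → ℕ) : List (Fin d) := (List.finRange d).flatMap fun i => List.replicate (β i) i

theorem count_wd (β : Fin d → ℕ) (j : Fin d) : (wd β).count j = β j := by
  rw [wd, List.count_flatMap]
  have : (List.map (List.count j ∘ fun i => List.replicate (β i) i) (List.finRange d)) =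
      List.map (fun i => if i = j then β i else 0) (List.finRange d) := by
    congr 1
    ext i
    simp [List.count_replicate]
  rw [this, ← List.ofFn_eq_map, List.sum_ofFn]
  simp

theorem length_eq_sum_count (u : List (Fin d)) : u.length = ∑ i, u.count i := by
  rw [← Multiset.coe_card, ← Multiset.toFinset_sum_count_eq (u : Multiset (Fin d))]
  simp only [Multiset.coe_count]
  apply Finset.sum_subset (Finset.subset_univ _)
  intro x _ hx
  simpa [List.count_eq_zero] using hx

theorem wtL_eq_sum (u : List (Fin d)) : wtL w u = ∑ i, (u.count i : ℤ) * w i := by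
  induction u with
  | nil => simp
  | cons i u ih =>
    rw [wtL_cons, ih]
    simp [List.count_cons, add_mul, Finset.sum_add_distrib, add_comm]

theorem length_wd (β : Fin d → ℕ) : (wd β).length = ∑ i, β i := by
  rw [length_eq_sum_count]; simp [count_wd]

theorem wtL_wd (β : Fin d → ℕ) : wtL w (wd β) = ∑ i, (β i : ℤ) * w i := by
  rw [wtL_eq_sum]; simp [count_wd]

theorem perm_wd (u : List (Fin d)) : u.Perm (wd fun i => u.count i) := by
  rw [List.perm_iff_count]
  intro a
  rw [count_wd]

/-- monomials -/
def mon (y : Fin d → A) (β : Fin d → ℕ) : A := ∏ i, y i ^ β i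

theorem D_mon (y : Fin d → A) (hy : ∀ i j, D i (y j) = if i = j then 1 else 0)
    (i : Fin d) (β : Fin d → ℕ) :
    D i (mon y β) = (β i : ℂ) • mon y (Function.update β i (β i - 1)) := by
  classical
  have hconst : ∀ s : Finset (Fin d), i ∉ s → D i (∏ j ∈ s, y j ^ β j) = 0 := by
    intro s
    induction s using Finset.induction_on with
    | empty => intro _; simp
    | insert a s ha ih =>
      intro hi
      rw [Finset.mem_insert, not_or] at hi
      rw [Finset.prod_insert ha, Derivation.leibniz, ih hi.2, Derivation.leibniz_pow, hy i a,
        if_neg hi.1]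
      simp
  unfold mon
  rw [← Finset.mul_prod_erase _ _ (Finset.mem_univ i), Derivation.leibniz,
    hconst _ (Finset.notMem_erase _ _), Derivation.leibniz_pow, hy i i, if_pos rfl,
    ← Finset.mul_prod_erase _ (fun j => y j ^ (Function.update β i (β i - 1)) j) (Finset.mem_univ i)]
  have : ∏ j ∈ Finset.univ.erase i, y j ^ (Function.update β i (β i - 1)) j =
      ∏ j ∈ Finset.univ.erase i, y j ^ β j := by
    refine Finset.prod_congr rfl fun j hj => ?_
    rw [Function.update_of_ne (Finset.ne_of_mem_erase hj)]
  rw [this]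
  simp [Algebra.smul_def]
  ring

theorem ev_Dw_mon (y : Fin d → A) (hy0 : ∀ i, ev (y i) = 0)
    (hy : ∀ i j, D i (y j) = if i = j then 1 else 0) (u : List (Fin d)) : ∀ (β : Fin d → ℕ),
    ev (Dw D u (mon y β)) = if (fun i => u.count i) = β then ∏ i, ((β i).factorial : ℂ) else 0 := by
  induction u with
  | nil =>
    intro β
    simp only [Dw_nil, mon, map_prod, map_pow, hy0]
    by_cases h : (fun i : Fin d => ([] : List (Fin d)).count i) = β
    · subst h; simp
    · rw [if_neg h]
      obtain ⟨i, hi⟩ : ∃ i, β i ≠ 0 := by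
        by_contra hcon
        push Not at hcon
        exact h (funext fun i => by rw [hcon i]; rfl)
      have h0 : (0 : ℂ) ^ β i = 0 := zero_pow hi
      exact Finset.prod_eq_zero (f := fun i => (0 : ℂ) ^ β i) (Finset.mem_univ i) h0
  | cons i u ih =>
    intro β
    rw [Dw_cons, D_mon y hy, map_smul, map_smul, ih, smul_eq_mul]
    by_cases hb : β i = 0
    · rw [hb, Nat.cast_zero, zero_mul, if_neg]
      intro h
      have := congrFun h i
      simp [hb] at this
    · obtain ⟨b, hb⟩ := Nat.exists_eq_succ_of_ne_zero hb
      have hiff : (fun j => u.count j) = Function.update β i (β i - 1) ↔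
          (fun j => (i :: u).count j) = β := by
        constructor
        · intro h
          ext j
          have := congrFun h j
          by_cases hj : i = j
          · subst hj; simp at this ⊢; omega
          · simp [Function.update_of_ne (Ne.symm hj), hj] at this ⊢
            exact this
        · intro h
          ext j
          have := congrFun h j
          by_cases hj : i = j
          · subst hj; simp at this ⊢; omega
          · simp [Function.update_of_ne (Ne.symm hj), hj] at this ⊢
            exact this
      simp only [hiff]
      split_ifs
      · rw [← Finset.mul_prod_erase _ _ (Finset.mem_univ i),
          ← Finset.mul_prod_erase _ (fun j => ((β j).factorial : ℂ)) (Finset.mem_univ i)]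
        have : ∏ j ∈ Finset.univ.erase i, (((Function.update β i (β i - 1)) j).factorial : ℂ) =
            ∏ j ∈ Finset.univ.erase i, ((β j).factorial : ℂ) := by
          refine Finset.prod_congr rfl fun j hj => ?_
          rw [Function.update_of_ne (Finset.ne_of_mem_erase hj)]
        rw [this, hb]
        simp [Nat.factorial_succ]
        ring
      · simp

/-- vanishing of all derivatives up to order `n` -/
def ZJ (ev : A →ₐ[ℂ] ℂ) (D : Fin d → Derivation ℂ A A) (n : ℕ) (g : A) : Prop :=
  ∀ u : List (Fin d), u.length ≤ n → ev (Dw D u g) = 0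

theorem core_spectrum (n : ℕ) (hD : ∀ i j g, D i (D j g) = D j (D i g))
    (hw2 : ∀ i j k, w i < w j + w k)
    (y F : Fin d → A) (μ : Fin d → ℂ)
    (hy0 : ∀ i, ev (y i) = 0) (hy : ∀ i j, D i (y j) = if i = j then 1 else 0)
    (hF0 : ∀ i, ev (F i) = 0) (hF1 : ∀ i j, i ≠ j → w i ≤ w j → ev (D i (F j)) = 0)
    (hF2 : ∀ i, ev (D i (F i)) = μ i)
    (ν : MIdx d n → A →ₗ[ℂ] ℂ)
    (hν1 : ∀ g, ZJ ev D n g → ∀ a, ν a g = 0) (hν2 : ∀ g, (∀ a, ν a g = 0) → ZJ ev D n g)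
    (C : Matrix (MIdx d n) (MIdx d n) ℂ)
    (hC : ∀ β a : MIdx d n, ν a (mon F β.1) = ∑ b, C b a * ν b (mon y β.1)) :
    spectrum ℂ C = {c : ℂ | ∃ α : Fin d → ℕ, (∑ i, α i) ≤ n ∧ c = ∏ i, μ i ^ α i} := by
  classical
  have hw : ∀ i, 0 < w i := fun i => by have := hw2 i i i; omega
  have hfac : ∀ β : Fin d → ℕ, (∏ i, ((β i).factorial : ℂ)) ≠ 0 := fun β =>
    Finset.prod_ne_zero_iff.2 fun i _ => by exact_mod_cast Nat.factorial_ne_zero _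
  let dd : (Fin d → ℕ) → A → ℂ := fun β g => ev (Dw D (wd β) g) / ∏ i, ((β i).factorial : ℂ)
  have hdd : ∀ β γ, dd β (mon y γ) = if β = γ then 1 else 0 := by
    intro β γ
    simp only [dd]
    rw [ev_Dw_mon y hy0 hy]
    simp only [count_wd]
    by_cases h : β = γ
    · subst h; simp [hfac]
    · have : (fun i => β i) ≠ γ := h
      simp [this, h]
  -- Taylor expansion
  have htaylor : ∀ g a, ν a g = ∑ β : MIdx d n, dd β.1 g * ν a (mon y β.1) := by
    intro g a
    have hz : ZJ ev D n (g - ∑ β : MIdx d n, dd β.1 g • mon y β.1) := by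
      intro u hu
      rw [Dw_perm D hD (perm_wd u)]
      set γ : Fin d → ℕ := fun i => u.count i with hγ
      have hγn : ∑ i, γ i ≤ n := by rw [← length_eq_sum_count]; exact hu
      simp only [map_sub, map_sum, map_smul]
      have h1 : ∀ β : MIdx d n, dd β.1 g • ev (Dw D (wd γ) (mon y β.1)) =
          if β = ⟨γ, hγn⟩ then ev (Dw D (wd γ) g) else 0 := by
        intro β
        rw [ev_Dw_mon y hy0 hy]
        simp only [count_wd]
        by_cases h : β = ⟨γ, hγn⟩
        · subst h
          simp only [dd, smul_eq_mul, if_true]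
          exact div_mul_cancel₀ _ (hfac _)
        · have : (fun i => γ i) ≠ β.1 := fun h' => h (Subtype.ext h'.symm)
          simp [this, h]
      rw [Finset.sum_congr rfl fun β _ => h1 β]
      simp
    have := hν1 _ hz a
    simp only [map_sub, map_sum, map_smul, smul_eq_mul] at this
    exact sub_eq_zero.1 this
  let G : Matrix (MIdx d n) (MIdx d n) ℂ := Matrix.of fun β a => ν a (mon y β.1)
  let M : Matrix (MIdx d n) (MIdx d n) ℂ := Matrix.of fun β β' => dd β'.1 (mon F β.1)
  have hMG : M * G = G * C := by
    ext β a
    simp only [Matrix.mul_apply, M, G, Matrix.of_apply]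
    rw [← htaylor, hC]
    exact Finset.sum_congr rfl fun b _ => mul_comm _ _
  have hG : G.det ≠ 0 := by
    intro hdet
    obtain ⟨v, hv0, hv⟩ := Matrix.exists_vecMul_eq_zero_iff.2 hdet
    apply hv0
    have hz : ZJ ev D n (∑ β : MIdx d n, v β • mon y β.1) := by
      apply hν2
      intro a
      have := congrFun hv a
      simpa [Matrix.vecMul, dotProduct, G] using this
    ext γ
    have h1 := hz (wd γ.1) (by rw [length_wd]; exact γ.2)
    have h2 : dd γ.1 (∑ β : MIdx d n, v β • mon y β.1) = 0 := by simp only [dd]; rw [h1, zero_div]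
    have h3 : dd γ.1 (∑ β : MIdx d n, v β • mon y β.1) =
        ∑ β : MIdx d n, v β * dd γ.1 (mon y β.1) := by
      simp only [dd, map_sum, map_smul, smul_eq_mul, Finset.sum_div, mul_div_assoc]
    rw [h3] at h2
    simp only [hdd] at h2
    have h4 : ∀ β : MIdx d n, (if γ.1 = β.1 then (1 : ℂ) else 0) = if γ = β then 1 else 0 := by
      intro β; simp [Subtype.ext_iff]
    simpa [h4] using h2
  -- triangularity
  have hrel1 : ∀ j, FRel ev D w (w j) (F j) (μ j • y j) := by
    intro j
    refine ⟨?_, ?_, ?_⟩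
    · rintro (_ | ⟨i, _ | ⟨k, u⟩⟩) hu
      · simpa using hF0 j
      · simp at hu
        simpa using hF1 i j (by rintro rfl; omega) hu.le
      · have := hw2 j i k
        have := wtL_nonneg w hw u
        simp at hu
        omega
    · rintro (_ | ⟨i, _ | ⟨k, u⟩⟩) hu
      · simp [hy0 j]
      · simp at hu
        have : i ≠ j := by rintro rfl; omega
        simp [hy, this]
      · have := hw2 j i k
        have := wtL_nonneg w hw u
        simp at hu
        omega
    · rintro (_ | ⟨i, _ | ⟨k, u⟩⟩) hu
      · simp [hF0 j, hy0 j]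
      · simp at hu
        by_cases hij : i = j
        · subst hij; simp [hy, hF2]
        · simp [hy, hij, hF1 i j hij (by omega)]
      · have := hw2 j i k
        have := wtL_nonneg w hw u
        simp at hu
        omega
  let W : MIdx d n → ℤ := fun β => ∑ i, (β.1 i : ℤ) * w i
  have hMtri : ∀ β γ : MIdx d n, W γ ≤ W β → M β γ = if γ = β then ∏ i, μ i ^ β.1 i else 0 := by
    intro β γ hW
    have h1 := FRel.prod (ev := ev) (D := D) hw Finset.univ (k := fun i => (β.1 i : ℤ) * w i)
      (g := fun i => F i ^ β.1 i)
      (g' := fun i => (μ i • y i) ^ β.1 i) fun i => (hrel1 i).pow hw (β.1 i)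
    have h2 := h1.2.2 (wd γ.1) (by rw [wtL_wd]; simp only [W] at hW; omega)
    have h3 : ∏ i, (μ i • y i) ^ β.1 i = (∏ i, μ i ^ β.1 i) • mon y β.1 := by
      simp only [mon, smul_pow]
      rw [Finset.prod_smul]
    rw [h3, map_sub, map_sub, sub_eq_zero, map_smul, map_smul] at h2
    have h4 : M β γ = (∏ i, μ i ^ β.1 i) * dd γ.1 (mon y β.1) := by
      simp only [M, Matrix.of_apply, dd]
      change ev (Dw D (wd γ.1) (∏ i, F i ^ β.1 i)) / _ = _
      rw [h2, smul_eq_mul, mul_div_assoc]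
    rw [h4, hdd]
    simp [Subtype.ext_iff]
  have hdet : ∀ c : ℂ, (algebraMap ℂ (Matrix (MIdx d n) (MIdx d n) ℂ) c - M).det = 0 ↔
      ∃ β : MIdx d n, c = ∏ i, μ i ^ β.1 i := by
    intro c
    have hbt : (algebraMap ℂ (Matrix (MIdx d n) (MIdx d n) ℂ) c - M).BlockTriangular W := by
      intro i j hij
      have hne : i ≠ j := by rintro rfl; exact lt_irrefl _ hij
      rw [Matrix.sub_apply, hMtri i j hij.le, if_neg hne.symm, Matrix.algebraMap_matrix_apply,
        if_neg hne, sub_zero]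
    have hbl : ∀ k, (algebraMap ℂ (Matrix (MIdx d n) (MIdx d n) ℂ) c - M).toSquareBlock W k =
        Matrix.diagonal fun β => c - ∏ i, μ i ^ β.1.1 i := by
      intro k
      ext β γ
      rw [Matrix.toSquareBlock_def, Matrix.of_apply, Matrix.sub_apply,
        hMtri _ _ (by rw [γ.2, β.2]), Matrix.algebraMap_matrix_apply, Matrix.diagonal_apply]
      by_cases h : β = γ
      · subst h; simp
      · have h' : (β : MIdx d n) ≠ γ := fun e => h (Subtype.ext e)
        simp [h, h', h'.symm]
    rw [hbt.det, Finset.prod_eq_zero_iff]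
    simp only [hbl, Matrix.det_diagonal, Finset.prod_eq_zero_iff, sub_eq_zero]
    constructor
    · rintro ⟨k, _, β, _, hβ⟩
      exact ⟨β.1, hβ⟩
    · rintro ⟨β, hβ⟩
      exact ⟨W β, Finset.mem_image_of_mem _ (Finset.mem_univ _), ⟨β, rfl⟩, Finset.mem_univ _, hβ⟩
  ext c
  rw [spectrum.mem_iff, Matrix.isUnit_iff_isUnit_det, isUnit_iff_ne_zero, not_not]
  have hcomm : (algebraMap ℂ (Matrix (MIdx d n) (MIdx d n) ℂ) c - M) * G =
      G * (algebraMap ℂ (Matrix (MIdx d n) (MIdx d n) ℂ) c - C) := by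
    rw [sub_mul, mul_sub, hMG, Algebra.commutes]
  have hdd2 := congrArg Matrix.det hcomm
  rw [Matrix.det_mul, Matrix.det_mul, mul_comm] at hdd2
  rw [← mul_left_cancel₀ hG hdd2, hdet]
  constructor
  · rintro ⟨β, hβ⟩
    exact ⟨β.1, β.2, hβ⟩
  · rintro ⟨α, hα, hc⟩
    exact ⟨⟨α, hα⟩, hc⟩

end core

section hol

variable {d : ℕ}

open Classical in
/-- extension by zero -/
def extU (U : Set (Fin d → ℂ)) (g : U → ℂ) : (Fin d → ℂ) → ℂ :=
  fun z => if h : z ∈ U then g ⟨z, h⟩ else 0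

theorem extU_mem {U : Set (Fin d → ℂ)} (g : U → ℂ) {z : Fin d → ℂ} (h : z ∈ U) :
    extU U g z = g ⟨z, h⟩ := by simp [extU, h]

theorem extU_eqOn (U : Set (Fin d → ℂ)) (G : (Fin d → ℂ) → ℂ) :
    Set.EqOn (extU U fun z => G z) G U := fun z hz => by rw [extU_mem _ hz]

/-- the algebra of holomorphic functions on `U` -/
def holAlg (U : Set (Fin d → ℂ)) : Subalgebra ℂ (U → ℂ) where
  carrier := {g | DifferentiableOn ℂ (extU U g) U}
  mul_mem' := by
    intro a b ha hb
    refine (DifferentiableOn.mul ha hb).congr fun z hz => ?_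
    simp [extU_mem _ hz]
  add_mem' := by
    intro a b ha hb
    refine (DifferentiableOn.add ha hb).congr fun z hz => ?_
    simp [extU_mem _ hz]
  algebraMap_mem' := by
    intro c
    refine (differentiableOn_const c).congr fun z hz => ?_
    simp [extU_mem _ hz]

/-- element of the algebra from a function holomorphic on `U` -/
def hmk (U : Set (Fin d → ℂ)) (G : (Fin d → ℂ) → ℂ) (hG : DifferentiableOn ℂ G U) : holAlg U :=
  ⟨fun z => G z, hG.congr (extU_eqOn U G)⟩

theorem hmk_congr {U : Set (Fin d → ℂ)} {G G' : (Fin d → ℂ) → ℂ} (hG : DifferentiableOn ℂ G U)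
    (hG' : DifferentiableOn ℂ G' U) (h : Set.EqOn G G' U) : hmk U G hG = hmk U G' hG' := by
  apply Subtype.ext
  funext z
  exact h z.2

theorem hmk_ext {U : Set (Fin d → ℂ)} (g : holAlg U) : hmk U (extU U g.1) g.2 = g := by
  apply Subtype.ext
  funext z
  exact extU_mem _ z.2

/-- evaluation -/
def hev (U : Set (Fin d → ℂ)) {p : Fin d → ℂ} (hp : p ∈ U) : holAlg U →ₐ[ℂ] ℂ :=
  (Pi.evalAlgHom ℂ (fun _ : U => ℂ) ⟨p, hp⟩).comp (holAlg U).val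

theorem hev_hmk {U : Set (Fin d → ℂ)} {p : Fin d → ℂ} (hp : p ∈ U) {G : (Fin d → ℂ) → ℂ}
    (hG : DifferentiableOn ℂ G U) : hev U hp (hmk U G hG) = G p := rfl

/-- directional derivative of an element -/
def hdv {U : Set (Fin d → ℂ)} (hU : IsOpen U) (v : Fin d → ℂ) (g : holAlg U) : holAlg U :=
  hmk U (fun z => fderiv ℂ (extU U g.1) z v) (hol_fderiv hU g.2 v)

theorem hdv_apply {U : Set (Fin d → ℂ)} (hU : IsOpen U) (v : Fin d → ℂ) (g : holAlg U) (z : U) :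
    (hdv hU v g).1 z = fderiv ℂ (extU U g.1) z v := rfl

theorem holAlg_diffAt {U : Set (Fin d → ℂ)} (hU : IsOpen U) (g : holAlg U) (z : U) :
    DifferentiableAt ℂ (extU U g.1) z :=
  DifferentiableOn.differentiableAt g.2 (hU.mem_nhds z.2)

theorem fderiv_eqOn {U : Set (Fin d → ℂ)} (hU : IsOpen U) {G G' : (Fin d → ℂ) → ℂ}
    (h : Set.EqOn G G' U) {z : Fin d → ℂ} (hz : z ∈ U) : fderiv ℂ G z = fderiv ℂ G' z :=
  Filter.EventuallyEq.fderiv_eq (Filter.eventually_of_mem (hU.mem_nhds hz) h)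

/-- directional derivative as a derivation -/
def hD {U : Set (Fin d → ℂ)} (hU : IsOpen U) (v : Fin d → ℂ) :
    Derivation ℂ (holAlg U) (holAlg U) :=
  Derivation.mk'
    { toFun := hdv hU v
      map_add' := by
        intro a b
        apply Subtype.ext
        funext z
        have h : fderiv ℂ (extU U (a + b).1) z =
            fderiv ℂ (extU U a.1 + extU U b.1) z := by
          refine fderiv_eqOn hU (fun z hz => ?_) z.2
          simp [extU_mem _ hz]
        change fderiv ℂ (extU U (a + b).1) z v =
          fderiv ℂ (extU U a.1) z v + fderiv ℂ (extU U b.1) z v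
        rw [h, fderiv_add (holAlg_diffAt hU a z) (holAlg_diffAt hU b z)]
        rfl
      map_smul' := by
        intro c a
        apply Subtype.ext
        funext z
        have h : fderiv ℂ (extU U (c • a).1) z =
            fderiv ℂ (c • extU U a.1) z := by
          refine fderiv_eqOn hU (fun z hz => ?_) z.2
          simp [extU_mem _ hz]
        change fderiv ℂ (extU U (c • a).1) z v = c • fderiv ℂ (extU U a.1) z v
        rw [h, fderiv_const_smul (holAlg_diffAt hU a z)]
        rfl }
    (by
      intro a b
      apply Subtype.ext
      funext z
      have h : fderiv ℂ (extU U (a * b).1) z =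
          fderiv ℂ (extU U a.1 * extU U b.1) z := by
        refine fderiv_eqOn hU (fun z hz => ?_) z.2
        simp [extU_mem _ hz]
      change fderiv ℂ (extU U (a * b).1) z v =
        a.1 z * fderiv ℂ (extU U b.1) z v + b.1 z * fderiv ℂ (extU U a.1) z v
      rw [h, fderiv_mul (holAlg_diffAt hU a z) (holAlg_diffAt hU b z), extU_mem _ z.2,
        extU_mem _ z.2]
      rfl)

theorem hD_hmk {U : Set (Fin d → ℂ)} (hU : IsOpen U) (v : Fin d → ℂ) {G : (Fin d → ℂ) → ℂ}
    (hG : DifferentiableOn ℂ G U) :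
    hD hU v (hmk U G hG) = hmk U (fun z => fderiv ℂ G z v) (hol_fderiv hU hG v) := by
  refine hmk_congr (hol_fderiv hU (hmk U G hG).2 v) (hol_fderiv hU hG v) ?_
  intro z hz
  change fderiv ℂ (extU U fun z => G z) z v = fderiv ℂ G z v
  rw [fderiv_eqOn hU (extU_eqOn U G) hz]

theorem hD_comm {U : Set (Fin d → ℂ)} (hU : IsOpen U) (v w : Fin d → ℂ) (g : holAlg U) :
    hD hU v (hD hU w g) = hD hU w (hD hU v g) := by
  have hg : DifferentiableOn ℂ (extU U g.1) U := g.2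
  have e : g = hmk U (extU U g.1) hg := (hmk_ext g).symm
  rw [e, hD_hmk, hD_hmk, hD_hmk, hD_hmk]
  apply hmk_congr
  intro z hz
  exact hol_fderiv_comm hU hg w v hz

theorem hD_sum {U : Set (Fin d → ℂ)} (hU : IsOpen U) (c : Fin d → ℂ) (v : Fin d → Fin d → ℂ)
    (g : holAlg U) : hD hU (∑ k, c k • v k) g = ∑ k, c k • hD hU (v k) g := by
  apply Subtype.ext
  funext z
  change fderiv ℂ (extU U g.1) z (∑ k, c k • v k) = _
  rw [map_sum]
  simp only [map_smul, AddSubmonoidClass.coe_finsetSum, Finset.sum_apply]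
  rfl

theorem ZJ_transfer {A : Type*} [CommRing A] [Algebra ℂ A] {ev : A →ₐ[ℂ] ℂ}
    {D D' : Fin d → Derivation ℂ A A} (c : Fin d → Fin d → ℂ)
    (h : ∀ i g, D' i g = ∑ k, c i k • D k g) {n : ℕ} {g : A} (hg : ZJ ev D n g) :
    ZJ ev D' n g := by
  intro u
  induction u generalizing n g with
  | nil => intro hu; exact hg [] hu
  | cons i u ih =>
    intro hu
    rw [List.length_cons] at hu
    rw [Dw_cons, h, map_sum, map_sum]
    refine Finset.sum_eq_zero fun k _ => ?_
    rw [map_smul, map_smul, ih (n := n - 1) (g := D k g), smul_zero]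
    · intro u' hu'
      exact hg (k :: u') (by rw [List.length_cons]; omega)
    · omega

theorem Dw_append {A : Type*} [CommRing A] [Algebra ℂ A] (D : Fin d → Derivation ℂ A A)
    (u v : List (Fin d)) : ∀ g, Dw D (u ++ v) g = Dw D v (Dw D u g) := by
  induction u with
  | nil => intro g; rfl
  | cons i u ih => intro g; simp [ih]

/-- standard derivations -/
def sD {U : Set (Fin d → ℂ)} (hU : IsOpen U) (k : Fin d) : Derivation ℂ (holAlg U) (holAlg U) :=
  hD hU (Pi.single k 1)

theorem iter_pderiv {U : Set (Fin d → ℂ)} (hU : IsOpen U) (k : Fin d) (m : ℕ) :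
    ∀ (G : (Fin d → ℂ) → ℂ) (hG : DifferentiableOn ℂ G U),
    ∃ h : DifferentiableOn ℂ ((pderivAt k)^[m] G) U,
      hmk U ((pderivAt k)^[m] G) h = Dw (sD hU) (List.replicate m k) (hmk U G hG) := by
  induction m with
  | zero => intro G hG; exact ⟨hG, rfl⟩
  | succ m ih =>
    intro G hG
    obtain ⟨h, e⟩ := ih (pderivAt k G) (hol_fderiv hU hG _)
    refine ⟨h, ?_⟩
    rw [List.replicate_succ, Dw_cons]
    have : sD hU k (hmk U G hG) = hmk U (pderivAt k G) (hol_fderiv hU hG _) := hD_hmk hU _ hG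
    rw [this, ← e]
    rfl

theorem foldr_pderiv {U : Set (Fin d → ℂ)} (hU : IsOpen U) (γ : Fin d → ℕ) (L : List (Fin d)) :
    ∃ u : List (Fin d), u.Perm (L.flatMap fun i => List.replicate (γ i) i) ∧
    ∀ (G : (Fin d → ℂ) → ℂ) (hG : DifferentiableOn ℂ G U),
    ∃ h : DifferentiableOn ℂ ((L.map fun k => (pderivAt k)^[γ k]).foldr (fun F h => F h) G) U,
      hmk U ((L.map fun k => (pderivAt k)^[γ k]).foldr (fun F h => F h) G) h =
        Dw (sD hU) u (hmk U G hG) := by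
  induction L with
  | nil => exact ⟨[], by simp, fun G hG => ⟨hG, rfl⟩⟩
  | cons k L ih =>
    obtain ⟨u, hu, h⟩ := ih
    refine ⟨u ++ List.replicate (γ k) k, ?_, ?_⟩
    · rw [List.flatMap_cons]
      exact (List.perm_append_comm).trans (List.Perm.append_left _ hu)
    · intro G hG
      obtain ⟨h1, e1⟩ := h G hG
      obtain ⟨h2, e2⟩ := iter_pderiv hU k (γ k) _ h1
      refine ⟨h2, ?_⟩
      rw [Dw_append, ← e1, ← e2]
      rfl

theorem mpderiv_eq {U : Set (Fin d → ℂ)} (hU : IsOpen U) {p : Fin d → ℂ} (hp : p ∈ U)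
    (γ : Fin d → ℕ) (G : (Fin d → ℂ) → ℂ) (hG : DifferentiableOn ℂ G U) :
    mpderiv γ G p = hev U hp (Dw (sD hU) (wd γ) (hmk U G hG)) := by
  obtain ⟨u, hu, h⟩ := foldr_pderiv hU γ (List.finRange d)
  obtain ⟨h1, e1⟩ := h G hG
  have e2 := Dw_perm (sD hU) (fun i j g => hD_comm hU _ _ g) hu (hmk U G hG)
  rw [wd, ← e2, ← e1, hev_hmk]
  rfl

/-- jet functional as a linear map -/
def jetLin {U : Set (Fin d → ℂ)} (hU : IsOpen U) {p : Fin d → ℂ} (hp : p ∈ U) (κ : Fin d → ℕ) :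
    holAlg U →ₗ[ℂ] ℂ :=
  ((Real.exp (-(∑ i, ‖p i‖ ^ 2) / 2) / Real.sqrt (∏ i, (κ i).factorial) : ℝ) : ℂ) •
    ∑ γ ∈ Fintype.piFinset fun i => Finset.range (κ i + 1),
      ((∏ i, ((κ i).choose (γ i) : ℂ)) *
        (∏ i, (-(starRingEnd ℂ) (p i)) ^ (κ i - γ i))) •
          ((hev U hp).toLinearMap ∘ₗ Dw (sD hU) (wd γ))

theorem jetLin_apply {U : Set (Fin d → ℂ)} (hU : IsOpen U) {p : Fin d → ℂ} (hp : p ∈ U)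
    (κ : Fin d → ℕ) (g : holAlg U) : jetLin hU hp κ g =
  ((Real.exp (-(∑ i, ‖p i‖ ^ 2) / 2) / Real.sqrt (∏ i, (κ i).factorial) : ℝ) : ℂ) *
    ∑ γ ∈ Fintype.piFinset fun i => Finset.range (κ i + 1),
      ((∏ i, ((κ i).choose (γ i) : ℂ)) *
        (∏ i, (-(starRingEnd ℂ) (p i)) ^ (κ i - γ i))) * hev U hp (Dw (sD hU) (wd γ) g) := by
  rw [jetLin, LinearMap.smul_apply, LinearMap.sum_apply]
  rfl

theorem jetFun_eq {U : Set (Fin d → ℂ)} (hU : IsOpen U) {p : Fin d → ℂ} (hp : p ∈ U)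
    (κ : Fin d → ℕ) (G : (Fin d → ℂ) → ℂ) (hG : DifferentiableOn ℂ G U) :
    jetFun p κ G = jetLin hU hp κ (hmk U G hG) := by
  rw [jetLin_apply, jetFun]
  simp only [mpderiv_eq hU hp _ G hG]

theorem mem_pi_sum {κ γ : Fin d → ℕ} (h : γ ∈ Fintype.piFinset fun i => Finset.range (κ i + 1)) :
    (∀ i, γ i ≤ κ i) := by
  intro i
  have := Fintype.mem_piFinset.1 h i
  rw [Finset.mem_range] at this
  omega

theorem jetLin_zero {U : Set (Fin d → ℂ)} (hU : IsOpen U) {p : Fin d → ℂ} (hp : p ∈ U) {n : ℕ}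
    (g : holAlg U) (hg : ZJ (hev U hp) (sD hU) n g) (a : MIdx d n) : jetLin hU hp a.1 g = 0 := by
  rw [jetLin_apply]
  refine mul_eq_zero_of_right _ (Finset.sum_eq_zero ?_)
  intro γ hγ
  rw [hg (wd γ), mul_zero]
  rw [length_wd]
  exact (Finset.sum_le_sum fun i _ => mem_pi_sum hγ i).trans a.2

theorem jetLin_inv {U : Set (Fin d → ℂ)} (hU : IsOpen U) {p : Fin d → ℂ} (hp : p ∈ U) {n : ℕ}
    (g : holAlg U) (hg : ∀ a : MIdx d n, jetLin hU hp a.1 g = 0) :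
    ZJ (hev U hp) (sD hU) n g := by
  have key : ∀ m, m ≤ n → ∀ κ : Fin d → ℕ, ∑ i, κ i = m →
      hev U hp (Dw (sD hU) (wd κ) g) = 0 := by
    intro m
    induction m using Nat.strong_induction_on with
    | _ m ih =>
      intro hm κ hκ
      have h1 := hg ⟨κ, hκ.le.trans hm⟩
      rw [jetLin_apply] at h1
      have hc : ((Real.exp (-(∑ i, ‖p i‖ ^ 2) / 2) /
          Real.sqrt (∏ i, (κ i).factorial) : ℝ) : ℂ) ≠ 0 := by
        rw [Complex.ofReal_ne_zero]
        have : (0 : ℝ) < ((∏ i, (κ i).factorial : ℕ) : ℝ) := by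
          exact_mod_cast Finset.prod_pos fun i _ => Nat.factorial_pos _
        have := Real.sqrt_pos.2 this
        have := Real.exp_pos (-(∑ i, ‖p i‖ ^ 2) / 2)
        push_cast at *
        positivity
      have h2 := (mul_eq_zero.1 h1).resolve_left hc
      rw [Finset.sum_eq_single κ] at h2
      · simpa using h2
      · intro γ hγ hne
        have hle := mem_pi_sum hγ
        have hlt : ∑ i, γ i < m := by
          rw [← hκ]
          obtain ⟨i, hi⟩ := Function.ne_iff.1 hne
          exact Finset.sum_lt_sum (fun i _ => hle i)
            ⟨i, Finset.mem_univ i, lt_of_le_of_ne (hle i) hi⟩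
        rw [ih _ hlt (hlt.le.trans hm) γ rfl, mul_zero]
      · intro h
        exact (h (Fintype.mem_piFinset.2 fun i => by simp)).elim
  intro u hu
  rw [Dw_perm (sD hU) (fun i j g => hD_comm hU _ _ g) (perm_wd u)]
  exact key _ hu _ (length_eq_sum_count u).symm

theorem pi_sum_single (v : Fin d → ℂ) : v = ∑ k, v k • (Pi.single k 1 : Fin d → ℂ) := by
  funext i
  simp [Finset.sum_apply, Pi.single_apply]

theorem hmk_prod {U : Set (Fin d → ℂ)} (y : Fin d → (Fin d → ℂ) → ℂ)
    (hy : ∀ i, DifferentiableOn ℂ (y i) U) (β : Fin d → ℕ) (G : (Fin d → ℂ) → ℂ)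
    (hG : DifferentiableOn ℂ G U) (h : ∀ z, G z = ∏ i, y i z ^ β i) :
    hmk U G hG = mon (fun i => hmk U (y i) (hy i)) β := by
  apply Subtype.ext
  funext z
  change G z = _
  rw [h, mon]
  simp [Finset.prod_apply]
  rfl

end hol

theorem diff_prod_pow {d : ℕ} {U : Set (Fin d → ℂ)} (y : Fin d → (Fin d → ℂ) → ℂ)
    (hy : ∀ i, DifferentiableOn ℂ (y i) U) (β : Fin d → ℕ) :
    DifferentiableOn ℂ (fun z => ∏ i, y i z ^ β i) U := by
  have : ∀ s : Finset (Fin d), DifferentiableOn ℂ (fun z => ∏ i ∈ s, y i z ^ β i) U := by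
    intro s
    induction s using Finset.induction_on with
    | empty => simp
    | insert a s ha ih =>
      simp only [Finset.prod_insert ha]
      exact ((hy a).fun_pow (β a)).fun_mul ih
  exact this _

/-- eigenvalues of the jet representation matrix at a fixed point. -/
theorem statement5 (d : ℕ) (p : Fin d → ℂ) (f : (Fin d → ℂ) → Fin d → ℂ)
    (Uo : Set (Fin d → ℂ)) (hUo : IsOpen Uo) (hpU : p ∈ Uo)
    (hf : DifferentiableOn ℂ f Uo) (hfp : f p = p) (n : ℕ)
    (Cn : Matrix (MIdx d n) (MIdx d n) ℂ) (hCn : IsJetMatrix n p f Cn)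
    (l : Fin d → ℂ)
    (hl : (Matrix.of fun i j => pderivAt j (fun z => f z i) p).charpoly =
      ∏ i, (Polynomial.X - Polynomial.C (l i))) :
    spectrum ℂ Cn =
      {c : ℂ | ∃ α : Fin d → ℕ, (∑ i, α i) ≤ n ∧ c = ∏ i, l i ^ α i} := by
  obtain ⟨V, W, hWV, hVW, htri, σ, hσ⟩ := exists_triang _ l hl
  set J : Matrix (Fin d) (Fin d) ℂ := Matrix.of fun i j => pderivAt j (fun z => f z i) p with hJ
  have hfi : ∀ k, DifferentiableOn ℂ (fun z => f z k) Uo := fun k =>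
    (differentiableOn_pi.1 hf) k
  have hy : ∀ i, DifferentiableOn ℂ (fun z : Fin d → ℂ => ∑ k, W i k * (z k - p k)) Uo := by
    intro i
    fun_prop
  have hFd : ∀ i, DifferentiableOn ℂ (fun z : Fin d → ℂ => ∑ k, W i k * (f z k - p k)) Uo := by
    intro i
    refine DifferentiableOn.fun_sum fun k _ => ?_
    exact ((hfi k).sub_const _).const_mul _
  let y : Fin d → holAlg Uo := fun i => hmk Uo _ (hy i)
  let F : Fin d → holAlg Uo := fun i => hmk Uo _ (hFd i)
  let D : Fin d → Derivation ℂ (holAlg Uo) (holAlg Uo) := fun i => hD hUo (fun k => V k i)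
  have hDs : ∀ i g, D i g = ∑ k, V k i • sD hUo k g := by
    intro i g
    change hD hUo (fun k => V k i) g = _
    rw [pi_sum_single (fun k => V k i)]
    exact hD_sum hUo _ _ g
  have hsD : ∀ k g, sD hUo k g = ∑ i, W i k • D i g := by
    intro k g
    have : (Pi.single k 1 : Fin d → ℂ) = ∑ i, W i k • (fun m => V m i) := by
      funext m
      have := congrFun (congrFun hVW m) k
      rw [Matrix.mul_apply] at this
      simp only [Finset.sum_apply, Pi.smul_apply, smul_eq_mul]
      rw [Finset.sum_congr rfl fun i _ => mul_comm (W i k) (V m i), this]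
      simp [Matrix.one_apply, Pi.single_apply]
    change hD hUo (Pi.single k 1) g = _
    rw [this]
    exact hD_sum hUo _ _ g
  -- derivatives of coordinates
  have hDy : ∀ i j, D i (y j) = if i = j then 1 else 0 := by
    intro i j
    have h1 : D i (y j) = hmk Uo (fun _ => if i = j then 1 else 0) (differentiableOn_const _) := by
      refine (hD_hmk hUo _ (hy j)).trans (hmk_congr _ _ fun z hz => ?_)
      have h2 : HasFDerivAt (fun z : Fin d → ℂ => ∑ k, W j k * (z k - p k))
          (∑ k, W j k • (ContinuousLinearMap.proj k : (Fin d → ℂ) →L[ℂ] ℂ)) z := by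
        refine HasFDerivAt.fun_sum fun k _ => ?_
        exact ((hasFDerivAt_apply k z).sub_const _).const_mul _
      simp only [h2.fderiv]
      have := congrFun (congrFun hWV j) i
      rw [Matrix.mul_apply, Matrix.one_apply] at this
      simp [FunLike.coe_sum, Finset.sum_apply, this, eq_comm]
    rw [h1]
    by_cases hij : i = j
    · simp only [hij, if_true]; rfl
    · simp only [hij, if_false]; rfl
  have hDF : ∀ i j, hev Uo hpU (D i (F j)) = (W * J * V) j i := by
    intro i j
    have h1 : D i (F j) = _ := hD_hmk hUo _ (hFd j)
    rw [h1, hev_hmk]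
    have h2 : HasFDerivAt (fun z : Fin d → ℂ => ∑ k, W j k * (f z k - p k))
        (∑ k, W j k • fderiv ℂ (fun z => f z k) p) p := by
      refine HasFDerivAt.fun_sum fun k _ => ?_
      exact ((((hfi k).differentiableAt (hUo.mem_nhds hpU)).hasFDerivAt).sub_const _).const_mul _
    rw [h2.fderiv]
    have h3 : ∀ k, fderiv ℂ (fun z => f z k) p (fun m => V m i) = ∑ m, J k m * V m i := by
      intro k
      rw [pi_sum_single (fun m => V m i), map_sum]
      refine Finset.sum_congr rfl fun m _ => ?_
      rw [map_smul, smul_eq_mul, mul_comm]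
      rfl
    rw [Matrix.mul_assoc, Matrix.mul_apply]
    simp only [FunLike.coe_sum, Finset.sum_apply, _root_.smul_apply, h3, smul_eq_mul,
      Matrix.mul_apply]
  have hmain := core_spectrum (ev := hev Uo hpU) (D := D) (w := fun i => 2 * (d : ℤ) - (i : ℕ)) n
    (fun i j g => hD_comm hUo _ _ g) (fun i j k => by have := i.2; have := j.2; have := k.2; omega)
    y F (fun i => l (σ i))
    (fun i => by
      change ∑ k, W i k * (p k - p k) = 0
      simp) hDy
    (fun i => by
      change ∑ k, W i k * (f p k - p k) = 0
      simp [hfp])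
    (fun i j hne hw => by
      rw [hDF]
      apply htri
      rw [Fin.lt_def]
      have : (i : ℕ) ≠ j := fun h => hne (Fin.ext h)
      omega)
    (fun i => by rw [hDF, hσ])
    (fun a => jetLin hUo hpU a.1)
    (fun g hg => jetLin_zero hUo hpU g (ZJ_transfer (fun k i => W i k) hsD hg))
    (fun g hg => ZJ_transfer (fun i k => V k i) hDs (jetLin_inv hUo hpU g hg))
    Cn
    (by
      intro β a
      let h : MvPolynomial (Fin d) ℂ := ∏ i, (∑ k, MvPolynomial.C (W i k) *
        (MvPolynomial.X k - MvPolynomial.C (p k))) ^ β.1 i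
      have he : ∀ z : Fin d → ℂ, MvPolynomial.eval z h =
          ∏ i, (∑ k, W i k * (z k - p k)) ^ β.1 i := by
        intro z
        simp [h, map_prod, map_sum]
      have hy' : DifferentiableOn ℂ (fun z => MvPolynomial.eval z h) Uo := by
        simp only [he]
        exact diff_prod_pow _ hy β.1
      have hF' : DifferentiableOn ℂ (fun z => MvPolynomial.eval (f z) h) Uo := by
        simp only [he]
        exact diff_prod_pow _ hFd β.1
      have h1 := hCn h a
      rw [hfp, jetFun_eq hUo hpU _ _ hF', hmk_prod _ hFd β.1 _ hF' fun z => he (f z)] at h1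
      simp only [jetFun_eq hUo hpU _ _ hy', hmk_prod _ hy β.1 _ hy' fun z => he z] at h1
      exact h1)
  rw [hmain]
  ext c
  constructor
  · rintro ⟨α, hα, rfl⟩
    refine ⟨fun i => α (σ.symm i), ?_, ?_⟩
    · rw [Equiv.sum_comp σ.symm α]; exact hα
    · rw [← Equiv.prod_comp σ fun i => l i ^ α (σ.symm i)]
      simp
  · rintro ⟨α, hα, rfl⟩
    refine ⟨fun i => α (σ i), ?_, ?_⟩
    · rw [Equiv.sum_comp σ α]; exact hα
    · exact (Equiv.prod_comp σ fun i => l i ^ α i).symm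

end PFA
end
end

section
/- Let μ_0 be a compactly supported complex Borel measure on ℂ^d and define h(ζ) := conj( ∫_{ℂ^d} exp(⟨z,ζ⟩) dμ_0(z) ) for ζ ∈ ℂ^d. Then h is an entire function belonging to the Fock space H, and for every g ∈ H one has ⟨g,h⟩_H = ∫_{ℂ^d} g dμ_0. -/
open MeasureTheory Complex Filter Matrix
open scoped BigOperators ENNReal Topology

noncomputable section

namespace PFA

/-- bound for the Gaussian exponent -/
lemma expo_bound {d : ℕ} (R : ℝ) (z : Fin d → ℂ) :
    Real.exp (R * ∑ i, ‖z i‖) ^ 2 * Real.exp (-(∑ i, ‖z i‖ ^ 2)) ≤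
      Real.exp (d * (2 * R ^ 2)) * ∏ i, Real.exp (-(1 / 2) * ‖z i‖ ^ 2) := by
  rw [← Real.exp_nat_mul, ← Real.exp_sum, ← Real.exp_add, ← Real.exp_add]
  apply Real.exp_le_exp.2
  have : (d : ℝ) * (2 * R ^ 2) = ∑ i : Fin d, 2 * R ^ 2 := by simp
  rw [this, ← Finset.sum_add_distrib, Finset.mul_sum, Finset.mul_sum, ← Finset.sum_neg_distrib,
    ← Finset.sum_add_distrib]
  apply Finset.sum_le_sum
  intro i _
  push_cast
  nlinarith [sq_nonneg (2 * R - ‖z i‖)]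

lemma integrable_gauss1 {b : ℝ} (hb : 0 < b) :
    Integrable (fun z : ℂ => Real.exp (-b * ‖z‖ ^ 2)) := by
  apply Integrable.of_integral_ne_zero
  rw [GaussianFourier.integral_rexp_neg_mul_sq_norm hb]
  positivity

instance instSFiniteMuE (d : ℕ) : SFinite (μE d) := by unfold μE; infer_instance

instance instRightInvMuE (d : ℕ) : Measure.IsAddRightInvariant (μE d) := by
  unfold μE; infer_instance

lemma integrable_muE {d : ℕ} {E : Type*} [NormedAddCommGroup E] {f : (Fin d → ℂ) → E}
    (hf : Integrable f) : Integrable f (μE d) := by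
  unfold μE
  apply hf.smul_measure
  simp [Real.pi_pos]

lemma integrable_gauss {d : ℕ} (R : ℝ) :
    Integrable (fun z : Fin d → ℂ =>
      Real.exp (R * ∑ i, ‖z i‖) ^ 2 * Real.exp (-(∑ i, ‖z i‖ ^ 2))) (μE d) := by
  have h1 : Integrable (fun z : Fin d → ℂ =>
      Real.exp (d * (2 * R ^ 2)) * ∏ i, Real.exp (-(1 / 2) * ‖z i‖ ^ 2)) (μE d) := by
    apply Integrable.const_mul
    apply integrable_muE
    exact Integrable.fintype_prod (fun _ => integrable_gauss1 (by norm_num))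
  refine h1.mono' (Continuous.aestronglyMeasurable (by fun_prop)) (ae_of_all _ fun z => ?_)
  rw [Real.norm_of_nonneg (by positivity)]
  exact expo_bound R z

lemma integral_gauss (d : ℕ) :
    ∫ z : Fin d → ℂ, Real.exp (-(∑ i, ‖z i‖ ^ 2)) ∂(μE d) = 1 := by
  unfold μE
  rw [integral_smul_measure]
  have : ∀ z : Fin d → ℂ, Real.exp (-(∑ i, ‖z i‖ ^ 2)) = ∏ i, Real.exp (-1 * ‖z i‖ ^ 2) := by
    intro z
    rw [← Real.exp_sum, ← Finset.sum_neg_distrib]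
    simp
  simp_rw [this]
  rw [integral_fintype_prod_volume_eq_pow (fun z : ℂ => Real.exp (-1 * ‖z‖ ^ 2)),
    GaussianFourier.integral_rexp_neg_mul_sq_norm one_pos]
  simp [Real.pi_pos.le, Real.pi_pos.ne']

lemma rot_mp (d : ℕ) (c : ℂ) (hc : ‖c‖ = 1) :
    MeasurePreserving (fun z : Fin d → ℂ => c • z) (μE d) (μE d) := by
  have h1 : MeasurePreserving (fun z : ℂ => c * z) := by
    have := (rotation ⟨c, by simpa [Submonoid.unitSphere] using hc⟩).measurePreserving
    convert this using 1
    funext z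
    rfl
  have h2 := volume_preserving_pi (fun _ : Fin d => h1)
  unfold μE
  exact h2.smul_measure _

/-- Gaussian mean value property. -/
lemma mean_value {d : ℕ} (F : (Fin d → ℂ) → ℂ) (hF : Differentiable ℂ F)
    (hi : Integrable (fun z => F z * ((Real.exp (-(∑ i, ‖z i‖ ^ 2)) : ℝ) : ℂ)) (μE d)) :
    ∫ z, F z * ((Real.exp (-(∑ i, ‖z i‖ ^ 2)) : ℝ) : ℂ) ∂(μE d) = F 0 := by
  set W : (Fin d → ℂ) → ℂ := fun z => ((Real.exp (-(∑ i, ‖z i‖ ^ 2)) : ℝ) : ℂ) with hW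
  have hWc : Continuous W := by
    simp only [hW]
    fun_prop
  have hFc := hF.continuous
  have hcn : ∀ θ : ℝ, ‖circleMap 0 1 θ‖ = 1 := by intro θ; simp
  have hWrot : ∀ (θ : ℝ) z, W (circleMap 0 1 θ • z) = W z := by
    intro θ z
    simp [hW]
  have hemb : ∀ θ : ℝ, MeasurableEmbedding (fun z : Fin d → ℂ => circleMap 0 1 θ • z) := fun θ =>
    (Homeomorph.smulOfNeZero (circleMap 0 1 θ) (by simp)).measurableEmbedding
  have hrotI : ∀ θ : ℝ, Integrable (fun z => F (circleMap 0 1 θ • z) * W z) (μE d) := by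
    intro θ
    have := ((rot_mp d _ (hcn θ)).integrable_comp_emb (hemb θ)).2 hi
    refine this.congr (ae_of_all _ fun z => ?_)
    change F (circleMap 0 1 θ • z) * W (circleMap 0 1 θ • z) = _
    rw [hWrot]
  have hrot : ∀ θ : ℝ, ∫ z, F (circleMap 0 1 θ • z) * W z ∂(μE d) = ∫ z, F z * W z ∂(μE d) := by
    intro θ
    rw [← (rot_mp d _ (hcn θ)).integral_comp (hemb θ) (fun z => F z * W z)]
    simp_rw [hWrot]
  have hrotn : ∀ θ : ℝ, ∫ z, ‖F (circleMap 0 1 θ • z) * W z‖ ∂(μE d)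
      = ∫ z, ‖F z * W z‖ ∂(μE d) := by
    intro θ
    rw [← (rot_mp d _ (hcn θ)).integral_comp (hemb θ) (fun z => ‖F z * W z‖)]
    simp_rw [hWrot]
  have hcm : Continuous (circleMap 0 1) := continuous_circleMap 0 1
  have hprod : Integrable (Function.uncurry fun (θ : ℝ) (z : Fin d → ℂ) =>
      F (circleMap 0 1 θ • z) * W z)
      ((volume.restrict (Set.Ioc 0 (2 * Real.pi))).prod (μE d)) := by
    rw [integrable_prod_iff]
    · refine ⟨ae_of_all _ fun θ => hrotI θ, ?_⟩
      simp only [Function.uncurry]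
      simp_rw [hrotn]
      exact integrable_const _
    · apply Continuous.aestronglyMeasurable
      simp only [Function.uncurry_def]
      fun_prop
  have hswap := integral_integral_swap hprod
  simp_rw [hrot] at hswap
  have hin : ∀ z, ∫ θ in Set.Ioc 0 (2 * Real.pi), F (circleMap 0 1 θ • z) * W z
      = (2 * Real.pi) * F 0 * W z := by
    intro z
    rw [integral_mul_const]
    congr 1
    have hd : Differentiable ℂ (fun c : ℂ => F (c • z)) := by fun_prop
    have := (hd.diffContOnCl (s := Metric.ball 0 |1|)).circleAverage
    rw [Real.circleAverage_def, intervalIntegral.integral_of_le (by positivity), inv_smul_eq_iff₀ (by positivity)] at this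
    rw [this]
    simp
  simp_rw [hin] at hswap
  have hW1 : ∫ z, W z ∂(μE d) = 1 := by
    simp only [hW]
    rw [integral_complex_ofReal, integral_gauss]
    simp
  rw [integral_const, integral_const_mul, hW1] at hswap
  simp [Real.pi_pos.le] at hswap
  exact hswap

lemma norm_kernel {d : ℕ} (R : ℝ) (w z : Fin d → ℂ) (hw : ∀ i, ‖w i‖ ≤ R) :
    ‖Complex.exp (∑ i, w i * (starRingEnd ℂ) (z i))‖ ≤ Real.exp (R * ∑ i, ‖z i‖) := by
  refine (Complex.norm_exp_le_exp_norm _).trans (Real.exp_le_exp.2 ?_)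
  rw [Finset.mul_sum]
  refine (norm_sum_le _ _).trans (Finset.sum_le_sum fun i _ => ?_)
  rw [norm_mul, RCLike.norm_conj]
  exact mul_le_mul_of_nonneg_right (hw i) (norm_nonneg _)

lemma dom_integrable {d : ℕ} (R : ℝ) (g : (Fin d → ℂ) → ℂ) (hg : MemFock g) :
    Integrable (fun z => ‖g z‖ * Real.exp (R * ∑ i, ‖z i‖) * Real.exp (-(∑ i, ‖z i‖ ^ 2)))
      (μE d) := by
  have hc := hg.1.continuous
  refine (hg.2.add (integrable_gauss R)).mono' (Continuous.aestronglyMeasurable (by fun_prop))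
    (ae_of_all _ fun z => ?_)
  rw [Real.norm_of_nonneg (by positivity), Pi.add_apply, ← add_mul]
  apply mul_le_mul_of_nonneg_right _ (Real.exp_nonneg _)
  nlinarith [sq_nonneg (‖g z‖ - Real.exp (R * ∑ i, ‖z i‖)), sq_nonneg (‖g z‖), sq_nonneg (Real.exp (R * ∑ i, ‖z i‖))]

lemma conj_cont {d : ℕ} (i : Fin d) : Continuous (fun z : Fin d → ℂ => (starRingEnd ℂ) (z i)) :=
  Complex.continuous_conj.comp (continuous_apply i)

lemma reproducing {d : ℕ} (g : (Fin d → ℂ) → ℂ) (hg : MemFock g) (w : Fin d → ℂ) :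
    ∫ z, g z * Complex.exp (∑ i, w i * (starRingEnd ℂ) (z i)) *
      ((Real.exp (-(∑ i, ‖z i‖ ^ 2)) : ℝ) : ℂ) ∂(μE d) = g w := by
  have hc := hg.1.continuous
  have hcj := fun i => conj_cont (d := d) i
  set f : (Fin d → ℂ) → ℂ := fun z => g z * Complex.exp (∑ i, w i * (starRingEnd ℂ) (z i)) *
      ((Real.exp (-(∑ i, ‖z i‖ ^ 2)) : ℝ) : ℂ) with hf
  have hfi : Integrable f (μE d) := by
    refine (dom_integrable ‖w‖ g hg).mono' (Continuous.aestronglyMeasurable (by fun_prop))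
      (ae_of_all _ fun z => ?_)
    simp only [hf, norm_mul, Complex.norm_real, Real.norm_eq_abs, Real.abs_exp]
    gcongr
    exact norm_kernel _ _ _ (norm_le_pi_norm w)
  set F : (Fin d → ℂ) → ℂ := fun z => g (z + w) * Complex.exp (-∑ i, z i * (starRingEnd ℂ) (w i))
    with hF
  have hFd : Differentiable ℂ F := by
    have := hg.1
    simp only [hF]
    fun_prop
  have key : ∀ z, f (z + w) = F z * ((Real.exp (-(∑ i, ‖z i‖ ^ 2)) : ℝ) : ℂ) := by
    intro z
    simp only [hf, hF, mul_assoc, Complex.ofReal_exp]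
    rw [← Complex.exp_add, ← Complex.exp_add]
    congr 2
    push_cast
    simp_rw [← Complex.mul_conj']
    rw [← Finset.sum_neg_distrib, ← Finset.sum_neg_distrib, ← Finset.sum_neg_distrib,
      ← Finset.sum_add_distrib, ← Finset.sum_add_distrib]
    apply Finset.sum_congr rfl
    intro i _
    simp only [Pi.add_apply, map_add]
    ring
  rw [← integral_add_right_eq_self f w]
  simp_rw [key]
  rw [mean_value F hFd]
  · simp [hF]
  · simp_rw [← key]
    exact hfi.comp_add_right w

lemma h_diff {d : ℕ} (ν : Measure (Fin d → ℂ)) [IsFiniteMeasure ν]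
    (ρ : (Fin d → ℂ) → ℂ) (hρ : Integrable ρ ν) (R : ℝ) (hR : ∀ᵐ z ∂ν, ∀ i, ‖z i‖ ≤ R) :
    Differentiable ℂ (fun ζ : Fin d → ℂ => ∫ z, Complex.exp (∑ i, ζ i * (starRingEnd ℂ) (z i)) *
      (starRingEnd ℂ) (ρ z) ∂ν) := by
  intro ζ₀
  have hcj := fun i => conj_cont (d := d) i
  have hρm : AEStronglyMeasurable (fun z => (starRingEnd ℂ) (ρ z)) ν :=
    Complex.continuous_conj.comp_aestronglyMeasurable hρ.1
  let L : (Fin d → ℂ) → ((Fin d → ℂ) →L[ℂ] ℂ) := fun z =>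
    ∑ i, (starRingEnd ℂ) (z i) • (ContinuousLinearMap.proj (R := ℂ) (φ := fun _ : Fin d => ℂ) i)
  have hLc : Continuous L := by
    simp only [L]
    fun_prop
  have hLa : ∀ z ζ, L z ζ = ∑ i, ζ i * (starRingEnd ℂ) (z i) := by
    intro z ζ
    simp [L, mul_comm]
  have hLn : ∀ z, (∀ i, ‖z i‖ ≤ R) → ‖L z‖ ≤ d * R := by
    intro z hz
    by_cases hd : d = 0
    · subst hd
      simp [L]
    have hR0 : 0 ≤ R := (norm_nonneg _).trans (hz ⟨0, Nat.pos_of_ne_zero hd⟩)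
    refine ContinuousLinearMap.opNorm_le_bound _ (by positivity) fun x => ?_
    rw [hLa]
    refine (norm_sum_le _ _).trans ?_
    have : (d : ℝ) * R * ‖x‖ = ∑ i : Fin d, ‖x‖ * R := by simp; ring
    rw [this]
    refine Finset.sum_le_sum fun i _ => ?_
    rw [norm_mul, RCLike.norm_conj]
    exact mul_le_mul (norm_le_pi_norm x i) (hz i) (norm_nonneg _) (norm_nonneg _)
  have hder := hasFDerivAt_integral_of_dominated_of_fderiv_le (𝕜 := ℂ) (μ := ν)
    (F := fun (ζ z : Fin d → ℂ) => Complex.exp (∑ i, ζ i * (starRingEnd ℂ) (z i)) *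
      (starRingEnd ℂ) (ρ z))
    (F' := fun ζ z => (Complex.exp (∑ i, ζ i * (starRingEnd ℂ) (z i)) *
      (starRingEnd ℂ) (ρ z)) • L z) (x₀ := ζ₀)
    (bound := fun z => Real.exp (d * R * (‖ζ₀‖ + 1)) * ‖ρ z‖ * (d * R)) (s := Metric.ball ζ₀ 1)
    (Metric.ball_mem_nhds _ one_pos) ?_ ?_ ?_ ?_ ?_ ?_
  · exact hder.differentiableAt
  · refine Eventually.of_forall fun ζ => ?_
    exact (Continuous.aestronglyMeasurable (by fun_prop)).mul hρm
  · have hρi : Integrable (fun z => (starRingEnd ℂ) (ρ z)) ν :=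
      hρ.norm.mono' hρm (ae_of_all _ fun z => by simp)
    refine hρi.bdd_mul (c := Real.exp (d * R * ‖ζ₀‖)) (Continuous.aestronglyMeasurable (by fun_prop)) ?_
    filter_upwards [hR] with z hz
    refine (Complex.norm_exp_le_exp_norm _).trans (Real.exp_le_exp.2 ?_)
    rw [← hLa]
    exact (L z).le_of_opNorm_le (hLn z hz) _
  · exact ((Continuous.aestronglyMeasurable (by fun_prop)).mul hρm).smul hLc.aestronglyMeasurable
  · filter_upwards [hR] with z hz ζ hζ
    have hL := hLn z hz
    have h0 : 0 ≤ d * R := (norm_nonneg _).trans hL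
    rw [norm_smul, norm_mul, RCLike.norm_conj]
    gcongr
    refine (Complex.norm_exp_le_exp_norm _).trans (Real.exp_le_exp.2 ?_)
    rw [← hLa]
    refine ((L z).le_of_opNorm_le hL _).trans ?_
    gcongr
    have : ‖ζ - ζ₀‖ < 1 := by simpa [dist_eq_norm] using hζ
    have := norm_le_norm_add_norm_sub' ζ ζ₀
    linarith
  · exact (hρ.norm.const_mul _).mul_const _
  · refine ae_of_all _ fun z ζ _ => ?_
    have h1 := ((L z).hasFDerivAt (x := ζ)).cexp.mul_const ((starRingEnd ℂ) (ρ z))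
    simp_rw [hLa] at h1
    rw [smul_smul, mul_comm ((starRingEnd ℂ) (ρ z))] at h1
    exact h1

/-- (Fourier–Borel transform of a compactly supported complex
measure, written as `ρ dν` with `ν` a finite positive measure and `ρ` an
integrable density, lies in the Fock space and represents integration). -/
theorem statement11 (d : ℕ) (ν : Measure (Fin d → ℂ)) [IsFiniteMeasure ν]
    (ρ : (Fin d → ℂ) → ℂ) (hρ : Integrable ρ ν)
    (S : Set (Fin d → ℂ)) (hS : IsCompact S) (hνS : ν Sᶜ = 0)
    (h : (Fin d → ℂ) → ℂ)
    (hdef : h = fun ζ => (starRingEnd ℂ)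
      (∫ z, Complex.exp (∑ i, z i * (starRingEnd ℂ) (ζ i)) * ρ z ∂ν)) :
    MemFock h ∧
    ∀ g : (Fin d → ℂ) → ℂ, MemFock g →
      fockInner g h = ∫ z, g z * ρ z ∂ν := by
  obtain ⟨R, hR⟩ := hS.isBounded.exists_norm_le
  have hae : ∀ᵐ z ∂ν, ∀ i, ‖z i‖ ≤ R := by
    have : ∀ᵐ z ∂ν, z ∈ S := by
      rw [ae_iff]
      exact hνS
    filter_upwards [this] with z hz i
    exact (norm_le_pi_norm z i).trans (hR z hz)
  have hcj := fun i => conj_cont (d := d) i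
  have hd : Differentiable ℂ h := by
    convert h_diff ν ρ hρ R hae using 1
    rw [hdef]
    funext ζ
    rw [← integral_conj]
    congr 1
    funext z
    rw [map_mul, ← Complex.exp_conj, map_sum]
    simp [mul_comm]
  have hb : ∀ ζ, ‖h ζ‖ ≤ Real.exp (R * ∑ i, ‖ζ i‖) * ∫ z, ‖ρ z‖ ∂ν := by
    intro ζ
    rw [hdef]
    simp only [RCLike.norm_conj]
    rw [← integral_const_mul]
    refine norm_integral_le_of_norm_le (hρ.norm.const_mul _) ?_
    filter_upwards [hae] with z hz
    rw [norm_mul]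
    gcongr
    exact norm_kernel R z ζ hz
  have hhc := hd.continuous
  refine ⟨⟨hd, ?_⟩, ?_⟩
  · refine ((integrable_gauss (d := d) R).mul_const ((∫ z, ‖ρ z‖ ∂ν) ^ 2)).mono'
      (Continuous.aestronglyMeasurable (by fun_prop)) (ae_of_all _ fun ζ => ?_)
    rw [Real.norm_of_nonneg (by positivity), mul_right_comm, ← mul_pow]
    gcongr
    exact hb ζ
  · intro g hg
    have hgc := hg.1.continuous
    have hint : Integrable (Function.uncurry fun (ζ z : Fin d → ℂ) =>
        (g ζ * Complex.exp (∑ i, z i * (starRingEnd ℂ) (ζ i)) *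
          ((Real.exp (-(∑ i, ‖ζ i‖ ^ 2)) : ℝ) : ℂ)) * ρ z) ((μE d).prod ν) := by
      refine ((dom_integrable R g hg).mul_prod hρ.norm).mono' ?_ ?_
      · refine AEStronglyMeasurable.mul (Continuous.aestronglyMeasurable ?_) hρ.1.comp_snd
        have h1 : ∀ i, Continuous fun p : (Fin d → ℂ) × (Fin d → ℂ) => (starRingEnd ℂ) (p.1 i) :=
          fun i => (hcj i).comp continuous_fst
        fun_prop
      · have := Measure.quasiMeasurePreserving_snd (μ := μE d) (ν := ν) |>.ae hae
        filter_upwards [this] with p hp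
        simp only [Function.uncurry, norm_mul, Complex.norm_real, Real.norm_eq_abs, Real.abs_exp]
        gcongr
        exact norm_kernel R p.2 p.1 hp
    have hswap := integral_integral_swap hint
    simp_rw [integral_mul_const, reproducing g hg] at hswap
    rw [← hswap]
    unfold fockInner
    congr 1
    funext ζ
    rw [hdef]
    simp only [Complex.conj_conj]
    rw [mul_right_comm, ← integral_const_mul]
    congr 1
    funext z
    ring

end PFA
end
end
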